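/- (Sharpened version of Pintz's Lemma 4) Let k be sufficiently large, ℓ ≍ √k, δ > 0 small compared to k^{−3/2}, and let c₁, c₂ be as in Proposition 1 with N^{c₁} ≤ R ≤ N^{1/(2+δ)}(log N)^{−c₂}. Let H ⊂ [1,h] be an admissible k-tuple with h ≪ log R. Then Σ_{N < n ≤ 2N, (P_H(n), 𝒫(R^δ)) > 1} Λ_R(n;H,ℓ)² ≤ (k³δ²/4)·Σ_{N < n ≤ 2N} Λ_R(n;H,ℓ)². -/

import Mathlib

open Finset

/-- The `n`-th prime number (`nthPrime 0 = 2`). -/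
noncomputable def nthPrime (n : ℕ) : ℕ := Nat.nth Nat.Prime n

/-- The prime counting function `π(x)` at a real argument: the number of primes `≤ x`. -/
noncomputable def primePi (x : ℝ) : ℕ := Nat.primeCounting ⌊x⌋₊

/-- `P_H(n) = ∏_{h ∈ H} (n + h)`. -/
def tuplePoly (H : Finset ℕ) (n : ℕ) : ℕ := ∏ h ∈ H, (n + h)

/-- `ν_p(H)`: the number of distinct residue classes modulo `p` occupied by `H`. -/
def nuP (p : ℕ) (H : Finset ℕ) : ℕ := (H.image (· % p)).card

/-- `H` is admissible: for every prime `p`, the elements of `H` miss a residue class mod `p`. -/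
def Admissible (H : Finset ℕ) : Prop := ∀ p : ℕ, p.Prime → nuP p H < p

/-- The singular series `𝔖(H) = ∏_p (1 - 1/p)^{-|H|} (1 - ν_p(H)/p)`. -/
noncomputable def singularSeries (H : Finset ℕ) : ℝ :=
  ∏' p : Nat.Primes, ((1 - 1/((p : ℕ) : ℝ)) ^ (-(H.card : ℤ)) * (1 - (nuP p H : ℝ)/((p : ℕ) : ℝ)))

/-- `Λ_R(n; H, ℓ) = (1/(|H|+ℓ)!) ∑_{d ∣ P_H(n), d ≤ R} μ(d) (log (R/d))^{|H|+ℓ}`. -/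
noncomputable def LambdaR (R : ℝ) (n : ℕ) (H : Finset ℕ) (ℓ : ℕ) : ℝ :=
  (1 / (H.card + ℓ).factorial : ℝ) *
    ∑ d ∈ (tuplePoly H n).divisors.filter (fun d : ℕ => (d : ℝ) ≤ R),
      (ArithmeticFunction.moebius d : ℝ) * (Real.log (R / d)) ^ (H.card + ℓ)

/-- `𝒫(x)`: the product of all primes `≤ x`. -/
noncomputable def primorialReal (x : ℝ) : ℕ :=
  ∏ p ∈ (Finset.range (⌊x⌋₊ + 1)).filter Nat.Prime, p

/-- `θ(n) = log n` if `n` is prime, and `0` otherwise. -/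
noncomputable def theta (n : ℕ) : ℝ := if n.Prime then Real.log n else 0

/-- `∑_{p ≤ N, p prime, p ≡ a (mod q)} log p`. -/
noncomputable def primeSumAP (N q a : ℕ) : ℝ :=
  ∑ p ∈ (Finset.range (N+1)).filter (fun p => p.Prime ∧ p % q = a % q), Real.log p

/-- The primes have level of distribution `ϑ`: for every `A > 0` and `ε > 0`,
`∑_{q ≤ N^{ϑ-ε}} max_{(a,q)=1} |∑_{p ≤ N, p ≡ a (q)} log p - N/φ(q)| ≪_{A,ε} N (log N)^{-A}`
(the max over `a` is expressed via an arbitrary coprime choice function `a : ℕ → ℕ`). -/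
def HasLevelOfDistribution (ϑ : ℝ) : Prop :=
  ∀ A : ℝ, 0 < A → ∀ ε : ℝ, 0 < ε → ∃ C : ℝ, 0 < C ∧
    ∀ N : ℕ, 2 ≤ N → ∀ a : ℕ → ℕ, (∀ q : ℕ, Nat.Coprime (a q) q) →
      ∑ q ∈ Finset.Icc 1 ⌊(N : ℝ) ^ (ϑ - ε)⌋₊,
        |primeSumAP N q (a q) - (N : ℝ) / (Nat.totient q)| ≤ C * N / (Real.log N) ^ A

/-- The number of `j` with `N < p_j ≤ 2N` and `p_{j+1} - p_j ≤ h`. -/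
noncomputable def gapCount (N : ℕ) (h : ℝ) : ℕ :=
  ((Finset.range (2*N+1)).filter (fun j =>
    N < nthPrime j ∧ nthPrime j ≤ 2*N ∧ ((nthPrime (j+1) : ℝ) - nthPrime j) ≤ h)).card

/-- The number of `j` with `N < p_j ≤ 2N` and `p_{j+2} - p_j ≤ h`. -/
noncomputable def gapCount2 (N : ℕ) (h : ℝ) : ℕ :=
  ((Finset.range (2*N+1)).filter (fun j =>
    N < nthPrime j ∧ nthPrime j ≤ 2*N ∧ ((nthPrime (j+2) : ℝ) - nthPrime j) ≤ h)).card

section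

namespace GPY

lemma inv_sqrt_tele (n : ℕ) (hn : 1 ≤ n) :
    1 / ((n:ℝ) * √n) ≤ 6 * (1 / √n - 1 / √((n:ℝ)+1)) := by
  have hn' : (1:ℝ) ≤ n := by exact_mod_cast hn
  set a := √(n:ℝ) with ha
  set b := √((n:ℝ)+1) with hb
  have ha2 : a^2 = n := Real.sq_sqrt (by positivity)
  have hb2 : b^2 = n + 1 := Real.sq_sqrt (by positivity)
  have ha1 : 1 ≤ a := by rw [ha]; exact Real.one_le_sqrt.mpr hn'
  have hb0 : 0 < b := Real.sqrt_pos.mpr (by positivity)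
  have hab : a ≤ b := Real.sqrt_le_sqrt (by linarith)
  have hb3 : b ≤ 1.5 * a := by
    apply le_of_sq_le_sq _ (by positivity)
    nlinarith
  have key : 1 / a - 1 / b = 1 / (a * b * (a + b)) := by
    have : b^2 - a^2 = 1 := by rw [ha2, hb2]; ring
    field_simp
    nlinarith
  rw [key, ← ha2]
  rw [← mul_div_assoc, div_le_div_iff₀ (by positivity) (by positivity)]
  have h1 : a * b * (a+b) ≤ a * (1.5 * a) * (a + 1.5 * a) := by gcongr
  nlinarith [pow_pos (lt_of_lt_of_le one_pos ha1) 3]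

lemma sum_inv_sqrt (X M : ℕ) (hX : 1 ≤ X) (hM : X ≤ M) :
    ∑ n ∈ Ico X M, 1 / ((n:ℝ) * √n) ≤ 6 / √X := by
  have : ∑ n ∈ Ico X M, 1 / ((n:ℝ) * √n) ≤ 6 * (1 / √X - 1 / √M) := by
    induction M, hM using Nat.le_induction with
    | base => simp
    | succ m hm ih =>
      rw [Finset.sum_Ico_succ_top hm]
      have := inv_sqrt_tele m (hX.trans hm)
      push_cast
      linarith
  have h2 : 0 ≤ 1 / √(M:ℝ) := by positivity
  calc _ ≤ _ := this
    _ ≤ 6 * (1 / √X) := by linarith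
    _ = _ := by ring

lemma mvt_step (F f f' : ℝ → ℂ) (B : ℝ) (hB : 0 ≤ B) (n : ℕ) (hn : 1 ≤ n)
    (hF : ∀ u : ℝ, 1 ≤ u → HasDerivAt F (f u) u)
    (hf : ∀ u : ℝ, 1 ≤ u → HasDerivAt f (f' u) u)
    (hb : ∀ u : ℝ, 1 ≤ u → ‖f' u‖ ≤ B * (1 / (u * √u))) :
    ‖f (n+1) - (F (n+1) - F n)‖ ≤ B * (1 / ((n:ℝ) * √n)) := by
  have hn' : (1:ℝ) ≤ n := by exact_mod_cast hn
  set C := B * (1 / ((n:ℝ) * √n)) with hC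
  have hC0 : 0 ≤ C := by positivity
  have hb' : ∀ u ∈ Set.Icc (n:ℝ) (n+1), ‖f' u‖ ≤ C := by
    intro u hu
    refine (hb u (hn'.trans hu.1)).trans ?_
    have : (0:ℝ) < n := by linarith
    have h0 : 0 < √(n:ℝ) := Real.sqrt_pos.mpr this
    have h1 : √(n:ℝ) ≤ √u := Real.sqrt_le_sqrt hu.1
    have h2 := hu.1
    have h3 : 0 ≤ u := by linarith
    rw [hC]; gcongr
  have hdf : ∀ u ∈ Set.Icc (n:ℝ) (n+1), ‖f (n+1) - f u‖ ≤ C := by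
    intro u hu
    have := Convex.norm_image_sub_le_of_norm_hasDerivWithin_le (f := f) (f' := f')
      (s := Set.Icc (n:ℝ) (n+1)) (x := u) (y := n+1)
      (fun x hx => (hf x (hn'.trans hx.1)).hasDerivWithinAt) hb' (convex_Icc _ _) hu
      (by simp)
    refine this.trans ?_
    have : ‖(n:ℝ) + 1 - u‖ ≤ 1 := by
      rw [Real.norm_eq_abs, abs_le]; constructor <;> linarith [hu.1, hu.2]
    nlinarith
  have := Convex.norm_image_sub_le_of_norm_hasDerivWithin_le (f := fun u : ℝ => (u:ℂ) * f (n+1) - F u)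
      (f' := fun u => f (n+1) - f u)
      (s := Set.Icc (n:ℝ) (n+1)) (x := n) (y := n+1)
      (fun x hx => by
        have h1 := (hF x (hn'.trans hx.1)).hasDerivWithinAt (s := Set.Icc (n:ℝ) (n+1))
        have h2 : HasDerivWithinAt (fun u : ℝ => (u:ℂ) * f (n+1)) (1 * f (n+1)) (Set.Icc (n:ℝ) (n+1)) x :=
          ((HasDerivAt.ofReal_comp (hasDerivAt_id x)).mul_const _).hasDerivWithinAt
        rw [one_mul] at h2
        exact h2.sub h1) hdf (convex_Icc _ _) (by simp) (by simp)
  simp only [add_sub_cancel_left, norm_one, mul_one] at this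
  have e : f (n+1) - (F (n+1) - F n)
      = ((((n:ℝ)+1 : ℝ) : ℂ) * f (n+1) - F (n+1)) - (((n:ℝ):ℂ) * f (n+1) - F n) := by
    push_cast
    ring
  rw [e]
  exact this

lemma em_bound (F f f' : ℝ → ℂ) (B : ℝ) (hB : 0 ≤ B) (X M : ℕ) (hX : 1 ≤ X) (hM : X ≤ M)
    (hF : ∀ u : ℝ, 1 ≤ u → HasDerivAt F (f u) u)
    (hf : ∀ u : ℝ, 1 ≤ u → HasDerivAt f (f' u) u)
    (hb : ∀ u : ℝ, 1 ≤ u → ‖f' u‖ ≤ B * (1 / (u * √u))) :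
    ‖∑ n ∈ Ico X M, f ((n:ℝ)+1) - (F M - F X)‖ ≤ B * (6 / √X) := by
  have h1 : ∑ n ∈ Ico X M, f ((n:ℝ)+1) - (F M - F X) = ∑ n ∈ Ico X M, (f ((n:ℝ)+1) - (F ((n:ℝ)+1) - F n)) := by
    rw [Finset.sum_sub_distrib]
    congr 1
    have := Finset.sum_Ico_sub (fun n : ℕ => F n) hM
    push_cast at this
    exact this.symm
  rw [h1]
  calc _ ≤ ∑ n ∈ Ico X M, ‖f ((n:ℝ)+1) - (F ((n:ℝ)+1) - F n)‖ := norm_sum_le _ _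
    _ ≤ ∑ n ∈ Ico X M, B * (1 / ((n:ℝ) * √n)) := by
        apply Finset.sum_le_sum
        intro n hn
        exact mvt_step F f f' B hB n (hX.trans (Finset.mem_Ico.mp hn).1) hF hf hb
    _ = B * ∑ n ∈ Ico X M, (1 / ((n:ℝ) * √n)) := by rw [Finset.mul_sum]
    _ ≤ _ := by
        have := sum_inv_sqrt X M hX hM
        gcongr

/-- generic passage to the limit -/
lemma em_limit (F f f' : ℝ → ℂ) (B : ℝ) (hB : 0 ≤ B) (X : ℕ) (hX : 1 ≤ X)
    (hF : ∀ u : ℝ, 1 ≤ u → HasDerivAt F (f u) u)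
    (hf : ∀ u : ℝ, 1 ≤ u → HasDerivAt f (f' u) u)
    (hb : ∀ u : ℝ, 1 ≤ u → ‖f' u‖ ≤ B * (1 / (u * √u)))
    (hF0 : Filter.Tendsto (fun M : ℕ => F M) Filter.atTop (nhds 0))
    (S : ℂ) (hS : HasSum (fun n : ℕ => f ((n:ℝ)+1)) S) :
    ‖S‖ ≤ ∑ n ∈ range X, ‖f ((n:ℝ)+1)‖ + ‖F X‖ + B * (6 / √X) := by
  have hlim : Filter.Tendsto (fun M : ℕ => ‖∑ n ∈ range M, f ((n:ℝ)+1)‖) Filter.atTop (nhds ‖S‖) :=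
    hS.tendsto_sum_nat.norm
  have hlim2 : Filter.Tendsto (fun M : ℕ => ∑ n ∈ range X, ‖f ((n:ℝ)+1)‖ + (‖F X‖ + ‖F M‖) + B * (6 / √X))
      Filter.atTop (nhds (∑ n ∈ range X, ‖f ((n:ℝ)+1)‖ + (‖F X‖ + 0) + B * (6 / √X))) := by
    have := hF0.norm
    rw [norm_zero] at this
    exact ((this.const_add _).const_add _).add_const _
  rw [add_zero] at hlim2
  refine le_of_tendsto_of_tendsto hlim hlim2 ?_
  filter_upwards [Filter.eventually_ge_atTop X] with M hM
  have h := em_bound F f f' B hB X M hX hM hF hf hb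
  rw [← Finset.sum_range_add_sum_Ico _ hM]
  calc _ = ‖∑ n ∈ range X, f ((n:ℝ)+1) + (F M - F X) + (∑ n ∈ Ico X M, f ((n:ℝ)+1) - (F M - F X))‖ := by
          congr 1; ring
    _ ≤ ‖∑ n ∈ range X, f ((n:ℝ)+1)‖ + ‖F M - F X‖ + ‖(∑ n ∈ Ico X M, f ((n:ℝ)+1) - (F M - F X))‖ :=
        norm_add₃_le
    _ ≤ _ := by
        have h1 := norm_sum_le (range X) (fun n : ℕ => f ((n:ℝ)+1))
        have h2 := norm_sub_le (F M) (F X)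
        linarith

end GPY
end

section

namespace GPY

lemma norm_cpow_neg {u : ℝ} (hu : 1 ≤ u) (s : ℂ) : ‖(u:ℂ) ^ (-s)‖ = u ^ (-s.re) := by
  rw [Complex.norm_cpow_eq_rpow_re_of_pos (by linarith)]; simp

lemma norm_cpow_neg_le {u : ℝ} (hu : 1 ≤ u) (s : ℂ) (a : ℝ) (hs : a ≤ s.re) : ‖(u:ℂ) ^ (-s)‖ ≤ u ^ (-a) := by
  rw [norm_cpow_neg hu]
  exact Real.rpow_le_rpow_of_exponent_le hu (by linarith)

lemma hasDeriv_f (s : ℂ) (hs : s ≠ 0) (u : ℝ) (hu : 1 ≤ u) :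
    HasDerivAt (fun y : ℝ => (y:ℂ) ^ (-s)) (-s * (u:ℂ) ^ (-(s+1))) u := by
  have := hasDerivAt_ofReal_cpow_const (x := u) (by linarith) (r := -s) (by simpa using hs)
  convert this using 2
  ring_nf

lemma hasDeriv_F (s : ℂ) (hs : s ≠ 1) (u : ℝ) (hu : 1 ≤ u) :
    HasDerivAt (fun y : ℝ => (y:ℂ) ^ (-(s-1)) / (1 - s)) ((u:ℂ) ^ (-s)) u := by
  have h1 : s - 1 ≠ 0 := sub_ne_zero.mpr hs
  have h2 : 1 - s ≠ 0 := sub_ne_zero.mpr hs.symm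
  have := (hasDeriv_f (s-1) h1 u hu).div_const (1 - s)
  have e : (u:ℂ) ^ (-s) = -(s-1) * (u:ℂ) ^ (-(s-1+1)) / (1 - s) := by
    rw [sub_add_cancel, eq_div_iff h2]; ring
  rw [e]
  exact this

lemma tendsto_F (s : ℂ) (hs : 1 < s.re) :
    Filter.Tendsto (fun M : ℕ => (((M:ℝ):ℂ) ^ (-(s-1)) / (1 - s))) Filter.atTop (nhds 0) := by
  rw [← zero_div (1 - s)]
  apply Filter.Tendsto.div_const
  rw [tendsto_zero_iff_norm_tendsto_zero]
  have h : Filter.Tendsto (fun M : ℕ => (M:ℝ) ^ (-(s.re - 1))) Filter.atTop (nhds 0) :=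
    (tendsto_rpow_neg_atTop (by linarith)).comp tendsto_natCast_atTop_atTop
  refine h.congr' ?_
  filter_upwards [Filter.eventually_ge_atTop 1] with M hM
  rw [norm_cpow_neg (by exact_mod_cast hM)]; simp

lemma hasSum_zeta (s : ℂ) (hs : 1 < s.re) :
    HasSum (fun n : ℕ => ((((n:ℝ)+1 : ℝ)) : ℂ) ^ (-s)) (riemannZeta s) := by
  have h1 : Summable (fun n : ℕ => 1 / ((n:ℂ)) ^ s) := Complex.summable_one_div_nat_cpow.mpr hs
  have h2 := (summable_nat_add_iff 1).mpr h1
  have h3 := h2.hasSum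
  push_cast at h3
  rw [← zeta_eq_tsum_one_div_nat_add_one_cpow hs] at h3
  refine h3.congr_fun ?_
  intro n
  push_cast
  rw [Complex.cpow_neg, one_div]

lemma one_div_two_le {u : ℝ} (hu : 1 ≤ u) : u ^ (-2:ℝ) ≤ 1 / (u * √u) := by
  have h0 : 0 < u := by linarith
  rw [Real.sqrt_eq_rpow, Real.rpow_neg h0.le, one_div]
  apply inv_anti₀ (by positivity)
  calc u * u ^ ((1:ℝ)/2) = u ^ (1 + (1:ℝ)/2) := by rw [Real.rpow_add h0, Real.rpow_one]
    _ ≤ u ^ (2:ℝ) := Real.rpow_le_rpow_of_exponent_le hu (by norm_num)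

lemma sum_inv_range (X : ℕ) (hX : 1 ≤ X) : ∑ n ∈ range X, ((n:ℝ)+1) ^ (-1:ℝ) ≤ 1 + Real.log X := by
  have := harmonic_le_one_add_log X
  rw [harmonic] at this
  push_cast at this
  simpa [Real.rpow_neg_one] using this

/-- bound for zeta -/
lemma zeta_bound1 (s : ℂ) (hs : 1 < s.re) (ht : 1 ≤ |s.im|) (X : ℕ) (hX : 1 ≤ X) :
    ‖riemannZeta s‖ ≤ 2 + Real.log X + ‖s‖ * (6 / √X) := by
  have hs1 : s ≠ 1 := by rintro rfl; simp at hs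
  have hs0 : s ≠ 0 := by rintro rfl; simp at hs; linarith
  have hsn : 1 ≤ ‖1 - s‖ := by
    have := Complex.abs_im_le_norm (1 - s)
    simp at this; linarith
  have := em_limit (fun y : ℝ => (y:ℂ) ^ (-(s-1)) / (1 - s)) (fun y : ℝ => (y:ℂ) ^ (-s))
    (fun u : ℝ => -s * (u:ℂ) ^ (-(s+1))) ‖s‖ (norm_nonneg _) X hX (hasDeriv_F s hs1) (hasDeriv_f s hs0)
    (by
      intro u hu
      rw [norm_mul, norm_neg]
      gcongr
      exact (norm_cpow_neg_le hu _ 2 (by simp; linarith)).trans (one_div_two_le hu)) (tendsto_F s hs) _ (hasSum_zeta s hs)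
  refine this.trans ?_
  have h1 : ∑ n ∈ range X, ‖((((n:ℝ)+1 : ℝ)) : ℂ) ^ (-s)‖ ≤ 1 + Real.log X := by
    refine (Finset.sum_le_sum ?_).trans (sum_inv_range X hX)
    intro n _
    exact norm_cpow_neg_le (by linarith [(Nat.cast_nonneg n : (0:ℝ) ≤ n)]) s 1 hs.le
  have h2 : ‖(((X:ℝ)):ℂ) ^ (-(s-1)) / (1 - s)‖ ≤ 1 := by
    rw [norm_div]
    apply div_le_one_of_le₀ _ (norm_nonneg _)
    refine le_trans ?_ hsn
    have := norm_cpow_neg_le (u := X) (by exact_mod_cast hX) (s-1) 0 (by simp; linarith)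
    simpa using this
  linarith

lemma cpow_sub_bound {u : ℝ} (hu : 1 ≤ u) (s : ℂ) (a : ℝ) (hs : a ≤ s.re) (η : ℝ) (hη : 0 ≤ η) :
    ‖(u:ℂ) ^ (-s) - (u:ℂ) ^ (-(s + η))‖ ≤ η * Real.log u * u ^ (-a) := by
  have h0 : (u:ℂ) ≠ 0 := by simp; linarith
  have : (u:ℂ) ^ (-s) - (u:ℂ) ^ (-(s + η)) = (u:ℂ) ^ (-s) * (((1 - u ^ (-η) : ℝ)) : ℂ) := by
    rw [neg_add, Complex.cpow_add _ _ h0]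
    push_cast
    rw [Complex.ofReal_cpow (by linarith)]
    push_cast; ring
  rw [this, norm_mul, Complex.norm_real, Real.norm_eq_abs, mul_comm]
  have hlog : 0 ≤ Real.log u := Real.log_nonneg hu
  gcongr
  · rw [abs_of_nonneg]
    · rw [Real.rpow_def_of_pos (by linarith)]
      have := Real.add_one_le_exp (Real.log u * -η)
      linarith
    · have := Real.rpow_le_one_of_one_le_of_nonpos hu (show -η ≤ 0 by linarith)
      linarith
  · exact norm_cpow_neg_le hu s a hs

lemma zeta_lip1 (s : ℂ) (hs : 1 < s.re) (ht : 1 ≤ |s.im|) (η : ℝ) (hη : 0 ≤ η) (X : ℕ) (hX : 1 ≤ X) :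
    ‖riemannZeta s - riemannZeta (s + η)‖ ≤
      η * ((1 + Real.log X) * Real.log X + Real.log X + 1 + (2 * ‖s‖ + 1) * (6 / √X)) := by
  have hX' : (1:ℝ) ≤ X := by exact_mod_cast hX
  have hlX : 0 ≤ Real.log X := Real.log_nonneg hX'
  have hs' : 1 < (s + η).re := by simp; linarith
  have ht' : 1 ≤ |(s + η).im| := by simpa using ht
  have hne1 : ∀ s : ℂ, 1 < s.re → s ≠ 1 := by rintro s hs rfl; simp at hs
  have hne0 : ∀ s : ℂ, 1 < s.re → s ≠ 0 := by rintro s hs rfl; simp at hs; linarith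
  have hsn : ∀ s : ℂ, 1 ≤ |s.im| → 1 ≤ ‖1 - s‖ := by
    intro s ht
    have := Complex.abs_im_le_norm (1 - s)
    simp at this; linarith
  have := em_limit (fun y : ℝ => (y:ℂ) ^ (-(s-1)) / (1 - s) - (y:ℂ) ^ (-((s+η)-1)) / (1 - (s+η)))
    (fun y : ℝ => (y:ℂ) ^ (-s) - (y:ℂ) ^ (-(s+η)))
    (fun u : ℝ => -s * (u:ℂ) ^ (-(s+1)) - -(s+η) * (u:ℂ) ^ (-((s+η)+1))) (η * (2 * ‖s‖ + 1)) (by positivity) X hX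
    (fun u hu => (hasDeriv_F s (hne1 s hs) u hu).sub (hasDeriv_F (s+η) (hne1 _ hs') u hu))
    (fun u hu => (hasDeriv_f s (hne0 s hs) u hu).sub (hasDeriv_f (s+η) (hne0 _ hs') u hu))
    (by
      intro u hu
      have hu0 : 0 < u := by linarith
      have e : -s * (u:ℂ) ^ (-(s+1)) - -(s+η) * (u:ℂ) ^ (-((s+η)+1))
        = -s * ((u:ℂ) ^ (-(s+1)) - (u:ℂ) ^ (-((s+1)+η))) + η * (u:ℂ) ^ (-((s+η)+1)) := by
        ring_nf
      rw [e]
      have b1 := cpow_sub_bound hu (s+1) 2 (by simp; linarith) η hη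
      have b2 := norm_cpow_neg_le hu (s+η+1) 2 (by simp; linarith)
      have b3 := one_div_two_le hu
      have b4 : Real.log u * u ^ (-2:ℝ) ≤ 2 * (1 / (u * √u)) := by
        have : Real.log u ≤ 2 * √u := by
          have := Real.log_le_rpow_div hu0.le (show (0:ℝ) < 1/2 by norm_num)
          rw [Real.sqrt_eq_rpow]; linarith
        have e2 : u ^ (-2:ℝ) = 1 / (u * √u * √u) := by
          rw [mul_assoc, Real.mul_self_sqrt hu0.le, Real.rpow_neg hu0.le]; norm_num; ring
        have h3 : 0 < √u := Real.sqrt_pos.mpr hu0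
        rw [e2]
        calc _ ≤ 2 * √u * (1 / (u * √u * √u)) := by gcongr
          _ = _ := by field_simp
      calc _ ≤ ‖s‖ * (η * Real.log u * u ^ (-2:ℝ)) + η * u ^ (-2:ℝ) := by
            refine (norm_add_le _ _).trans ?_
            rw [norm_mul, norm_neg, norm_mul, Complex.norm_real, Real.norm_of_nonneg hη]
            gcongr
        _ = ‖s‖ * η * (Real.log u * u ^ (-2:ℝ)) + η * u ^ (-2:ℝ) := by ring
        _ ≤ ‖s‖ * η * (2 * (1 / (u * √u))) + η * (1 / (u * √u)) := by gcongr
        _ = _ := by ring)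
    (by simpa using (tendsto_F s hs).sub (tendsto_F (s+η) hs')) _ ((hasSum_zeta s hs).sub (hasSum_zeta (s+η) hs'))
  refine this.trans ?_
  have h1 : ∑ n ∈ range X, ‖((((n:ℝ)+1 : ℝ)) : ℂ) ^ (-s) - ((((n:ℝ)+1 : ℝ)) : ℂ) ^ (-(s+η))‖ ≤ η * ((1 + Real.log X) * Real.log X) := by
    calc _ ≤ ∑ n ∈ range X, η * Real.log X * ((n:ℝ)+1) ^ (-1:ℝ) := by
          apply Finset.sum_le_sum
          intro n hn
          have hn0 : (0:ℝ) ≤ n := Nat.cast_nonneg n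
          refine (cpow_sub_bound (by linarith) s 1 hs.le η hη).trans ?_
          gcongr
          exact_mod_cast Finset.mem_range.mp hn
      _ = η * Real.log X * ∑ n ∈ range X, ((n:ℝ)+1) ^ (-1:ℝ) := by rw [Finset.mul_sum]
      _ ≤ η * Real.log X * (1 + Real.log X) := by gcongr; exact sum_inv_range X hX
      _ = _ := by ring
  have h2 : ‖(((X:ℝ)):ℂ) ^ (-(s-1)) / (1 - s) - (((X:ℝ)):ℂ) ^ (-((s+η)-1)) / (1 - (s+η))‖ ≤ η * (Real.log X + 1) := by
    have n1 := hsn s ht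
    have n2 := hsn _ ht'
    have m1 : 1 - s ≠ 0 := sub_ne_zero.mpr (hne1 s hs).symm
    have m2 : 1 - (s+η) ≠ 0 := sub_ne_zero.mpr (hne1 _ hs').symm
    have e : (((X:ℝ)):ℂ) ^ (-(s-1)) / (1 - s) - (((X:ℝ)):ℂ) ^ (-((s+η)-1)) / (1 - (s+η))
      = ((((X:ℝ)):ℂ) ^ (-(s-1)) - (((X:ℝ)):ℂ) ^ (-((s-1)+η))) / (1 - s) - (((X:ℝ)):ℂ) ^ (-((s+η)-1)) * (η / ((1 - s) * (1 - (s+η)))) := by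
      have : -((s-1)+η) = -((s+η)-1) := by ring
      rw [this]
      field_simp
      ring
    rw [e]
    have b1 := cpow_sub_bound hX' (s-1) 0 (by simp; linarith) η hη
    have b2 := norm_cpow_neg_le hX' (s+η-1) 0 (by simp; linarith)
    rw [neg_zero, Real.rpow_zero] at b1 b2
    calc _ ≤ η * Real.log X / 1 + 1 * (η / (1 * 1)) := by
          refine (norm_sub_le _ _).trans ?_
          rw [norm_div, norm_mul, norm_div, norm_mul, Complex.norm_real, Real.norm_of_nonneg hη]
          gcongr
          linarith
      _ = _ := by ring
  calc _ ≤ η * ((1 + Real.log X) * Real.log X) + η * (Real.log X + 1) + η * (2 * ‖s‖ + 1) * (6 / √X) := by linarith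
    _ = _ := by ring

/-- Final growth bounds. -/
lemma zeta_growth : ∃ C : ℝ, 1 ≤ C ∧ ∀ (x t : ℝ), 0 < x → x ≤ 1 → 1 ≤ |t| →
    ‖riemannZeta (1 + x + Complex.I * t)‖ ≤ C * |t| ^ (1/8:ℝ) ∧
    ∀ η : ℝ, 0 ≤ η → ‖riemannZeta (1 + x + Complex.I * t) - riemannZeta (1 + x + Complex.I * t + η)‖
      ≤ C * |t| ^ (1/8:ℝ) * η := by
  refine ⟨30000, by norm_num, ?_⟩
  intro x t hx hx1 ht
  set s : ℂ := 1 + x + Complex.I * t with hs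
  have hre : s.re = 1 + x := by simp [hs]
  have him : s.im = t := by simp [hs]
  have hT : 0 < |t| := by linarith
  set X : ℕ := ⌈t^2⌉₊ with hX
  have ht2 : 1 ≤ t^2 := by rw [← sq_abs]; nlinarith
  have hXge : t^2 ≤ X := Nat.le_ceil _
  have hX1 : 1 ≤ X := by exact_mod_cast ht2.trans hXge
  have hXle : (X:ℝ) ≤ 2 * t^2 := by
    have := Nat.ceil_lt_add_one (show 0 ≤ t^2 by positivity)
    linarith
  have hsq : |t| ≤ √X := by
    rw [← Real.sqrt_sq_eq_abs]; exact Real.sqrt_le_sqrt hXge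
  have hsn : ‖s‖ ≤ 3 * |t| := by
    have := Complex.norm_le_abs_re_add_abs_im s
    rw [hre, him, abs_of_pos (by linarith)] at this
    linarith
  have hlog : Real.log X ≤ 1 + 2 * Real.log |t| := by
    have hXpos : (0:ℝ) < X := by exact_mod_cast hX1
    calc Real.log X ≤ Real.log (2 * t^2) := Real.log_le_log hXpos hXle
      _ = Real.log 2 + 2 * Real.log |t| := by
        rw [Real.log_mul (by norm_num) (by positivity), ← sq_abs, Real.log_pow]; push_cast; ring
      _ ≤ _ := by linarith [Real.log_two_lt_d9]
  have hlog0 : 0 ≤ Real.log X := Real.log_nonneg (by exact_mod_cast hX1)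
  set y := |t| ^ (1/16:ℝ) with hy
  have hy1 : 1 ≤ y := Real.one_le_rpow ht (by norm_num)
  have hy2 : y^2 = |t| ^ (1/8:ℝ) := by
    rw [hy, ← Real.rpow_natCast, ← Real.rpow_mul hT.le]; norm_num
  have hly : Real.log X ≤ 33 * y := by
    have := Real.log_le_rpow_div hT.le (show (0:ℝ) < 1/16 by norm_num)
    rw [← hy] at this
    linarith
  have hq : (6:ℝ) / √X ≤ 6 / |t| := by gcongr
  have hq2 : ‖s‖ * (6 / √X) ≤ 18 := by
    calc _ ≤ 3 * |t| * (6 / |t|) := by gcongr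
      _ = 18 := by field_simp; norm_num
  have hq3 : 6 / √X ≤ 6 := by
    refine hq.trans ?_
    rw [div_le_iff₀ hT]; linarith
  constructor
  · have := zeta_bound1 s (by rw [hre]; linarith) (by rwa [him]) X hX1
    rw [← hy2]
    nlinarith
  · intro η hη
    have := zeta_lip1 s (by rw [hre]; linarith) (by rwa [him]) η hη X hX1
    refine this.trans ?_
    rw [mul_comm]
    gcongr
    rw [← hy2]
    nlinarith

end GPY
end

section

namespace GPY

lemma zeta1_bound : ∃ C : ℝ, 1 ≤ C ∧ ∀ s : ℂ, 0 ≤ s.re → s.re ≤ 1 → |s.im| ≤ 1 →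
    ‖riemannZeta₁ (1 + s)‖ ≤ C ∧ 1 / C ≤ ‖riemannZeta₁ (1 + s)‖ := by
  set K : Set ℂ := Set.Icc (0:ℝ) 1 ×ℂ Set.Icc (-1:ℝ) 1 with hK
  have hKc : IsCompact K := isCompact_Icc.reProdIm isCompact_Icc
  have hcont : Continuous (fun s : ℂ => ‖riemannZeta₁ (1 + s)‖) :=
    (differentiable_riemannZeta₁.continuous.comp (continuous_const.add continuous_id)).norm
  have hne : K.Nonempty := ⟨0, by simp [hK, Complex.mem_reProdIm]⟩
  obtain ⟨a, ha, hamax⟩ := hKc.exists_isMaxOn hne hcont.continuousOn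
  obtain ⟨b, hb, hbmin⟩ := hKc.exists_isMinOn hne hcont.continuousOn
  have hpos : 0 < ‖riemannZeta₁ (1 + b)‖ := by
    rw [norm_pos_iff]
    by_cases hb0 : b = 0
    · simp [hb0]
    · intro h
      have h1 : (1 + b) ≠ 1 := by simpa using hb0
      have := riemannZeta_eq_inv_sub_mul h1
      rw [h, mul_zero] at this
      refine riemannZeta_ne_zero_of_one_le_re ?_ this
      rw [hK, Complex.mem_reProdIm] at hb
      simp; exact hb.1.1
  refine ⟨max 1 (max ‖riemannZeta₁ (1 + a)‖ (1 / ‖riemannZeta₁ (1 + b)‖)), le_max_left _ _, ?_⟩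
  intro s h0 h1 h2
  have hs : s ∈ K := by
    rw [hK, Complex.mem_reProdIm]
    exact ⟨⟨h0, h1⟩, abs_le.mp h2⟩
  constructor
  · exact (hamax hs).trans ((le_max_left _ _).trans (le_max_right _ _))
  · refine le_trans ?_ (hbmin hs)
    rw [div_le_iff₀ (by positivity)]
    have : 1 / ‖riemannZeta₁ (1 + b)‖ ≤ max 1 (max ‖riemannZeta₁ (1 + a)‖ (1 / ‖riemannZeta₁ (1 + b)‖)) :=
      (le_max_right _ _).trans (le_max_right _ _)
    rw [div_le_iff₀ hpos] at this
    linarith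

lemma norm_zeta_le_re (s : ℂ) (hs : 0 < s.re) : ‖riemannZeta (1 + s)‖ ≤ ‖riemannZeta (1 + (s.re : ℂ))‖ := by
  have h1 : 1 < (1 + s).re := by simpa using hs
  have h2 : 1 < (1 + (s.re : ℂ)).re := by simpa using hs
  have a := hasSum_zeta _ h1
  have b := hasSum_zeta _ h2
  have hterm : ∀ n : ℕ, ‖((((n:ℝ)+1 : ℝ)) : ℂ) ^ (-(1+s))‖ = ((n:ℝ)+1) ^ (-(1 + s.re)) := by
    intro n
    rw [norm_cpow_neg (by linarith [(Nat.cast_nonneg n : (0:ℝ) ≤ n)])]; simp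
  have hterm2 : ∀ n : ℕ, ((((n:ℝ)+1 : ℝ)) : ℂ) ^ (-(1+(s.re:ℂ))) = (((((n:ℝ)+1) ^ (-(1 + s.re)) : ℝ)) : ℂ) := by
    intro n
    rw [Complex.ofReal_cpow (by positivity)]; push_cast; rfl
  have hs1 : Summable (fun n : ℕ => ((n:ℝ)+1) ^ (-(1 + s.re))) := by
    have := b.summable
    simp_rw [hterm2] at this
    exact_mod_cast Complex.summable_ofReal.mp this
  have hb : riemannZeta (1 + (s.re : ℂ)) = ((∑' n : ℕ, ((n:ℝ)+1) ^ (-(1 + s.re)) : ℝ) : ℂ) := by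
    rw [← b.tsum_eq, Complex.ofReal_tsum]
    exact tsum_congr hterm2
  rw [hb, Complex.norm_real, Real.norm_of_nonneg (tsum_nonneg fun n => by positivity), ← a.tsum_eq]
  refine (norm_tsum_le_tsum_norm ?_).trans_eq (tsum_congr hterm)
  exact hs1.congr (fun n => (hterm n).symm)

lemma zeta_upper : ∃ C : ℝ, 1 ≤ C ∧ ∀ s : ℂ, 0 < s.re → s.re ≤ 1 → ‖riemannZeta (1 + s)‖ ≤ C / s.re := by
  obtain ⟨C, hC1, hC⟩ := zeta1_bound
  refine ⟨C, hC1, ?_⟩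
  intro s h0 h1
  refine (norm_zeta_le_re s h0).trans ?_
  have hne : (1 + (s.re : ℂ)) ≠ 1 := by simp; exact h0.ne'
  rw [riemannZeta_eq_inv_sub_mul hne, norm_mul, add_sub_cancel_left, norm_inv, Complex.norm_real,
    Real.norm_of_nonneg h0.le, div_eq_inv_mul]
  gcongr
  exact (hC (s.re : ℂ) (by simpa using h0.le) (by simpa using h1) (by simp)).1

lemma zeta_341 (x t : ℝ) (hx : 0 < x) :
    1 ≤ ‖riemannZeta (1 + x)‖^3 * ‖riemannZeta (1 + x + Complex.I * t)‖^4 * ‖riemannZeta (1 + x + Complex.I * (2 * t : ℝ))‖ := by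
  have := DirichletCharacter.norm_LFunction_product_ge_one (1 : DirichletCharacter ℂ 1) hx t
  rw [DirichletCharacter.LFunctionTrivChar, DirichletCharacter.LFunction_modOne_eq, DirichletCharacter.LFunction_modOne_eq,
    norm_mul, norm_mul, norm_pow, norm_pow] at this
  convert this using 4
  push_cast; ring

lemma zeta_lower_far : ∃ c : ℝ, 0 < c ∧ ∀ x t : ℝ, 0 < x → x ≤ 1 → 1 ≤ |t| →
    c / |t| ≤ ‖riemannZeta (1 + x + Complex.I * t)‖ := by
  obtain ⟨C, hC1, hC⟩ := zeta_growth
  obtain ⟨D, hD1, hD⟩ := zeta_upper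
  set c1 : ℝ := 1 / (2 * C * D^3) with hc1
  have hc1p : 0 < c1 := by positivity
  have step : ∀ x t : ℝ, 0 < x → x ≤ 1 → 1 ≤ |t| →
      c1 * x^3 * |t| ^ (-(1/8):ℝ) ≤ ‖riemannZeta (1 + x + Complex.I * t)‖^4 := by
    intro x t hx hx1 ht
    have hT : 0 < |t| := by linarith
    have h := zeta_341 x t hx
    have h1 : ‖riemannZeta (1 + x)‖ ≤ D / x := by
      have := hD (x:ℂ) (by simpa using hx) (by simpa using hx1)
      simpa using this
    have h2 : ‖riemannZeta (1 + x + Complex.I * (2 * t : ℝ))‖ ≤ 2 * C * |t| ^ (1/8:ℝ) := by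
      have := (hC x (2*t) hx hx1 (by rw [abs_mul, abs_two]; linarith)).1
      refine this.trans ?_
      rw [abs_mul, abs_two, Real.mul_rpow (by norm_num) hT.le]
      have h3 : (2:ℝ) ^ (1/8:ℝ) ≤ 2 := by
        calc (2:ℝ) ^ (1/8:ℝ) ≤ 2 ^ (1:ℝ) := Real.rpow_le_rpow_of_exponent_le (by norm_num) (by norm_num)
          _ = 2 := by norm_num
      have : 0 ≤ |t| ^ (1/8:ℝ) := by positivity
      calc C * (2 ^ (1/8:ℝ) * |t| ^ (1/8:ℝ)) ≤ C * (2 * |t| ^ (1/8:ℝ)) := by gcongr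
        _ = _ := by ring
    set z := ‖riemannZeta (1 + x + Complex.I * t)‖ with hz
    have h3 : 1 ≤ (D / x)^3 * z^4 * (2 * C * |t| ^ (1/8:ℝ)) := by
      refine h.trans ?_
      gcongr
    rw [hc1, Real.rpow_neg hT.le]
    have hp : 0 < |t| ^ (1/8:ℝ) := by positivity
    calc 1 / (2 * C * D ^ 3) * x ^ 3 * (|t| ^ (1/8:ℝ))⁻¹
        ≤ 1 / (2 * C * D ^ 3) * x ^ 3 * (|t| ^ (1/8:ℝ))⁻¹ * ((D / x)^3 * z^4 * (2 * C * |t| ^ (1/8:ℝ))) :=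
          le_mul_of_one_le_right (by positivity) h3
      _ = z^4 := by field_simp
  -- choose the parameter
  set r : ℝ := min 1 (c1 / (2*C)^4) with hr
  have hr0 : 0 < r := by positivity
  have hr1 : r ≤ 1 := min_le_left _ _
  have hr2 : (2*C)^4 * r ≤ c1 := by
    have : r ≤ c1 / (2*C)^4 := min_le_right _ _
    rw [le_div_iff₀ (by positivity)] at this
    linarith
  refine ⟨C * r, by positivity, ?_⟩
  intro x t hx hx1 ht
  have hT : 0 < |t| := by linarith
  have main : ∀ x : ℝ, r / |t| ≤ x → x ≤ 1 → 2 * C * r * |t| ^ (-(7/8):ℝ) ≤ ‖riemannZeta (1 + x + Complex.I * t)‖ := by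
    intro x hx hx1
    have hx0 : 0 < x := lt_of_lt_of_le (by positivity) hx
    have := step x t hx0 hx1 ht
    refine le_of_pow_le_pow_left₀ (n := 4) (by norm_num) (norm_nonneg _) (le_trans ?_ this)
    have e1 : (|t| ^ (-(7/8):ℝ))^4 = |t| ^ (-(7/2):ℝ) := by
      rw [← Real.rpow_natCast, ← Real.rpow_mul hT.le]; norm_num
    have e2 : (r / |t|)^3 = r^3 * |t| ^ (-3:ℝ) := by
      rw [div_pow, Real.rpow_neg hT.le, div_eq_mul_inv]; norm_cast
    calc (2 * C * r * |t| ^ (-(7/8):ℝ))^4 = (2*C)^4 * r * r^3 * |t| ^ (-(7/2):ℝ) := by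
          rw [mul_pow, e1]; ring
      _ ≤ c1 * r^3 * |t| ^ (-(25/8):ℝ) := by
          have h7 := Real.rpow_le_rpow_of_exponent_le ht (by norm_num : -(7/2:ℝ) ≤ -(25/8))
          gcongr
      _ = c1 * (r / |t|)^3 * |t| ^ (-(1/8):ℝ) := by
          rw [e2, mul_assoc, mul_assoc, mul_assoc, ← Real.rpow_add hT]; norm_num
      _ ≤ _ := by gcongr
  have fin : ∀ a : ℝ, C * r * |t| ^ (-(7/8):ℝ) ≤ a → C * r / |t| ≤ a := by
    intro a ha
    refine le_trans ?_ ha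
    rw [div_eq_mul_inv, ← Real.rpow_neg_one]
    have h7 := Real.rpow_le_rpow_of_exponent_le ht (by norm_num : (-1:ℝ) ≤ -(7/8))
    gcongr
  apply fin
  by_cases hcase : r / |t| ≤ x
  · refine le_trans ?_ (main x hcase hx1)
    have : 0 ≤ C * r * |t| ^ (-(7/8):ℝ) := by positivity
    linarith
  · push Not at hcase
    set x0 := r / |t| with hx0
    have hx01 : x0 ≤ 1 := by rw [hx0, div_le_one hT]; linarith
    have h1 := main x0 le_rfl hx01
    have h2 := (hC x t hx hx1 ht).2 (x0 - x) (by linarith)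
    have e : (1 + (x:ℂ) + Complex.I * t + ((x0 - x : ℝ):ℂ)) = 1 + (x0:ℂ) + Complex.I * t := by
      push_cast; ring
    rw [e] at h2
    have h3 : C * |t| ^ (1/8:ℝ) * (x0 - x) ≤ C * r * |t| ^ (-(7/8):ℝ) := by
      calc C * |t| ^ (1/8:ℝ) * (x0 - x) ≤ C * |t| ^ (1/8:ℝ) * x0 := by gcongr; linarith
        _ = C * r * (|t| ^ (1/8:ℝ) * |t| ^ (-1:ℝ)) := by rw [hx0, Real.rpow_neg_one]; ring
        _ = _ := by rw [← Real.rpow_add hT]; norm_num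
    have h4 := norm_sub_norm_le (riemannZeta (1 + (x0:ℂ) + Complex.I * t)) (riemannZeta (1 + (x:ℂ) + Complex.I * t))
    rw [norm_sub_rev] at h4
    linarith

/-- The inverse of zeta to the right of the line `Re = 1`. -/
lemma zeta_inv_bound : ∃ C : ℝ, 1 ≤ C ∧ ∀ s : ℂ, 0 < s.re → s.re ≤ 1 →
    ‖(riemannZeta (1 + s))⁻¹‖ ≤ C * ‖s‖ := by
  obtain ⟨c, hc, hfar⟩ := zeta_lower_far
  obtain ⟨C, hC1, hC⟩ := zeta1_bound
  refine ⟨max C (1 / c), hC1.trans (le_max_left _ _), ?_⟩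
  intro s h0 h1
  have hs0 : s ≠ 0 := by rintro rfl; simp at h0
  by_cases ht : |s.im| ≤ 1
  · have h := (hC s h0.le h1 ht).2
    have hne : (1 + s) ≠ 1 := by simpa using hs0
    rw [riemannZeta_eq_inv_sub_mul hne, add_sub_cancel_left, mul_inv, inv_inv, norm_mul, norm_inv, mul_comm]
    gcongr
    refine le_trans ?_ (le_max_left _ _)
    rw [inv_le_comm₀ (lt_of_lt_of_le (by positivity) h) (by positivity)]
    simpa using h
  · push Not at ht
    have h := hfar s.re s.im h0 h1 ht.le
    have e : 1 + (s.re : ℂ) + Complex.I * s.im = 1 + s := by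
      rw [mul_comm, add_assoc, Complex.re_add_im]
    rw [e] at h
    have hT : 0 < |s.im| := by linarith
    rw [norm_inv]
    calc ‖riemannZeta (1 + s)‖⁻¹ ≤ (c / |s.im|)⁻¹ := by gcongr
      _ = 1 / c * |s.im| := by field_simp
      _ ≤ max C (1 / c) * ‖s‖ := by
        gcongr
        · exact le_max_right _ _
        · exact Complex.abs_im_le_norm s

end GPY
end

section
namespace GPY

lemma integrableOn_pow_exp (n : ℕ) {c : ℝ} (hc : 0 < c) :
    MeasureTheory.IntegrableOn (fun x : ℝ => x ^ n * Real.exp (-c * x)) (Set.Ioi 0) := by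
  have := integrableOn_rpow_mul_exp_neg_mul_rpow (p := 1) (s := n) (b := c)
    (by have : (0:ℝ) ≤ n := by positivity
        linarith) (by norm_num) hc
  simpa using this

lemma norm_pow_cexp (n : ℕ) (z : ℂ) {x : ℝ} (hx : 0 ≤ x) :
    ‖(x:ℂ) ^ n * Complex.exp (-z * x)‖ = x ^ n * Real.exp (-z.re * x) := by
  rw [norm_mul, norm_pow, Complex.norm_real, Complex.norm_exp, Real.norm_of_nonneg hx]
  simp

lemma integrableOn_pow_cexp (n : ℕ) {z : ℂ} (hz : 0 < z.re) :
    MeasureTheory.IntegrableOn (fun x : ℝ => (x:ℂ) ^ n * Complex.exp (-z * x)) (Set.Ioi 0) := by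
  refine MeasureTheory.Integrable.mono' (integrableOn_pow_exp n hz) ?_ ?_
  · exact Continuous.aestronglyMeasurable (by fun_prop)
  · filter_upwards [MeasureTheory.ae_restrict_mem measurableSet_Ioi] with x hx
    rw [norm_pow_cexp n z (le_of_lt hx)]

lemma integral_pow_cexp (n : ℕ) {z : ℂ} (hz : 0 < z.re) :
    ∫ x in Set.Ioi (0:ℝ), (x:ℂ) ^ n * Complex.exp (-z * x) = n.factorial / z ^ (n+1) := by
  have hz0 : z ≠ 0 := by rintro rfl; simp at hz
  induction n with
  | zero =>
    have := integral_exp_mul_complex_Ioi (a := -z) (by simpa using hz) 0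
    simp at this ⊢
    rw [this]
  | succ n ih =>
    have hd : ∀ x ∈ Set.Ici (0:ℝ), HasDerivAt (fun x : ℝ => (x:ℂ)^(n+1) * Complex.exp (-z * x))
        ((n+1) * ((x:ℂ)^n * Complex.exp (-z * x)) - z * ((x:ℂ)^(n+1) * Complex.exp (-z * x))) x := by
      intro x _
      have h1 : HasDerivAt (fun x : ℂ => x^(n+1) * Complex.exp (-z * x))
        ((n+1) * ((x:ℂ)^n * Complex.exp (-z * x)) - z * ((x:ℂ)^(n+1) * Complex.exp (-z * x))) (x:ℂ) := by
        have h2 := (hasDerivAt_pow (n+1) (x:ℂ)).mul (((hasDerivAt_id (x:ℂ)).const_mul (-z)).cexp)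
        refine h2.congr_deriv ?_
        simp only [id, Nat.add_sub_cancel]
        push_cast; ring
      exact h1.comp_ofReal
    have i1 := (integrableOn_pow_cexp n hz).const_mul ((n:ℂ)+1)
    have i2 := (integrableOn_pow_cexp (n+1) hz).const_mul z
    have hlim : Filter.Tendsto (fun x : ℝ => (x:ℂ)^(n+1) * Complex.exp (-z * x)) Filter.atTop (nhds 0) := by
      rw [tendsto_zero_iff_norm_tendsto_zero]
      have := tendsto_rpow_mul_exp_neg_mul_atTop_nhds_zero ((n+1:ℕ):ℝ) z.re hz
      refine this.congr' ?_
      filter_upwards [Filter.eventually_ge_atTop 0] with x hx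
      rw [norm_pow_cexp _ _ hx, Real.rpow_natCast]
    have := MeasureTheory.integral_Ioi_of_hasDerivAt_of_tendsto' hd (i1.sub i2) hlim
    rw [MeasureTheory.integral_sub i1 i2, MeasureTheory.integral_const_mul, MeasureTheory.integral_const_mul, ih] at this
    simp at this
    rw [Nat.factorial_succ, pow_succ z (n+1), eq_div_iff (by positivity)]
    push_cast
    have h3 : z ^ (n+1) ≠ 0 := pow_ne_zero _ hz0
    field_simp at this ⊢
    linear_combination -this

/-- the vertical line -/
noncomputable def zt (t : ℝ) : ℂ := 1 + t * Complex.I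

@[simp] lemma zt_re (t : ℝ) : (zt t).re = 1 := by simp [zt]
@[simp] lemma zt_im (t : ℝ) : (zt t).im = t := by simp [zt]
lemma zt_ne (t : ℝ) : zt t ≠ 0 := by
  intro h; have := congrArg Complex.re h; simp at this
lemma one_le_zt (t : ℝ) : 1 ≤ ‖zt t‖ := by
  have := Complex.abs_re_le_norm (zt t); simpa using this
lemma zt_sq (t : ℝ) : ‖zt t‖^2 = 1 + t^2 := by
  rw [← Complex.normSq_eq_norm_sq, Complex.normSq_apply]; simp; ring
@[fun_prop] lemma continuous_zt : Continuous zt := by unfold zt; fun_prop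

lemma integrable_zt (j : ℕ) (hj : 2 ≤ j) : MeasureTheory.Integrable (fun t : ℝ => (‖zt t‖ ^ j)⁻¹) := by
  refine MeasureTheory.Integrable.mono' integrable_inv_one_add_sq ?_ ?_
  · refine Continuous.aestronglyMeasurable ?_
    refine Continuous.inv₀ (by fun_prop) ?_
    intro t; exact pow_ne_zero _ (by have := one_le_zt t; linarith)
  · refine Filter.Eventually.of_forall ?_
    intro t
    have := one_le_zt t
    rw [Real.norm_of_nonneg (by positivity), ← zt_sq]
    apply inv_anti₀ (by positivity)
    exact pow_le_pow_right₀ this hj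

/-- truncated power -/
noncomputable def phi (m : ℕ) (u : ℝ) : ℝ := (max u 0) ^ m / m.factorial

noncomputable def wt (m : ℕ) (t : ℝ) : ℂ := Complex.exp (zt t) / (2 * Real.pi * zt t ^ (m+1))

@[fun_prop] lemma continuous_wt (m : ℕ) : Continuous (wt m) := by
  unfold wt
  refine Continuous.div (by fun_prop) (by fun_prop) ?_
  intro t
  have : (Real.pi : ℂ) ≠ 0 := by exact_mod_cast Real.pi_ne_zero
  exact mul_ne_zero (mul_ne_zero two_ne_zero this) (pow_ne_zero _ (zt_ne t))

lemma norm_wt_le (m : ℕ) (t : ℝ) : ‖wt m t‖ ≤ (‖zt t‖ ^ (m+1))⁻¹ := by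
  unfold wt
  rw [norm_div, Complex.norm_exp, norm_mul, norm_pow, zt_re]
  have h1 : ‖(2 * Real.pi : ℂ)‖ = 2 * Real.pi := by
    rw [norm_mul, Complex.norm_real, Real.norm_of_nonneg Real.pi_pos.le]; simp
  rw [h1, ← one_div]
  have := one_le_zt t
  have h3 := Real.pi_gt_three
  have h4 := Real.exp_one_lt_d9
  rw [div_le_div_iff₀ (by positivity) (by positivity)]
  nlinarith [show 0 < ‖zt t‖ ^ (m+1) by positivity]

lemma integrable_wt (m : ℕ) (hm : 1 ≤ m) : MeasureTheory.Integrable (wt m) := by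
  refine MeasureTheory.Integrable.mono' (integrable_zt (m+1) (by omega)) ?_ ?_
  · exact Continuous.aestronglyMeasurable (by fun_prop)
  · exact Filter.Eventually.of_forall (norm_wt_le m)

noncomputable def ff (m : ℕ) (u : ℝ) : ℂ := ((phi m u * Real.exp (-u) : ℝ) : ℂ)

lemma fourier_ff (m : ℕ) (hm : 1 ≤ m) (ξ : ℝ) :
    FourierTransform.fourier (ff m) ξ = 1 / (zt (2 * Real.pi * ξ)) ^ (m+1) := by
  rw [Real.fourier_eq']
  have h0 : ∀ v : ℝ, Complex.exp (((-2 * Real.pi * inner ℝ v ξ : ℝ) : ℂ) * Complex.I) • ff m v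
      = Set.indicator (Set.Ioi 0) (fun v : ℝ => (1 / (m.factorial : ℂ)) * ((v:ℂ)^m * Complex.exp (-(zt (2 * Real.pi * ξ)) * v))) v := by
    intro v
    by_cases hv : 0 < v
    · rw [Set.indicator_of_mem (by simpa using hv)]
      simp only [ff, phi, max_eq_left hv.le, smul_eq_mul, zt]
      push_cast
      have : -(1 + 2 * (Real.pi:ℂ) * ξ * Complex.I) * v = (-2 * (Real.pi:ℂ) * (inner ℝ v ξ : ℝ)) * Complex.I + -v := by
        simp; ring
      rw [this, Complex.exp_add]
      ring
    · rw [Set.indicator_of_notMem (by simpa using hv)]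
      simp only [ff, phi, max_eq_right (not_lt.mp hv)]
      simp [show m ≠ 0 by omega]
  simp_rw [h0]
  rw [MeasureTheory.integral_indicator measurableSet_Ioi, MeasureTheory.integral_const_mul,
    integral_pow_cexp m (by simp)]
  have : (m.factorial : ℂ) ≠ 0 := by exact_mod_cast m.factorial_ne_zero
  field_simp

lemma continuous_phi (m : ℕ) : Continuous (phi m) := by unfold phi; fun_prop

lemma integrable_ff (m : ℕ) (hm : 1 ≤ m) : MeasureTheory.Integrable (ff m) := by
  have h1 : MeasureTheory.IntegrableOn (ff m) (Set.Ioi 0) := by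
    have := ((integrableOn_pow_exp m one_pos).const_mul (1 / (m.factorial : ℝ))).ofReal (𝕜 := ℂ)
    refine MeasureTheory.IntegrableOn.congr_fun this ?_ measurableSet_Ioi
    intro x hx
    simp only [ff, phi, max_eq_left (le_of_lt (Set.mem_Ioi.mp hx))]
    simp; ring
  have h2 : ff m = Set.indicator (Set.Ioi 0) (ff m) := by
    funext x
    by_cases hx : 0 < x
    · rw [Set.indicator_of_mem (by simpa using hx)]
    · rw [Set.indicator_of_notMem (by simpa using hx)]
      simp only [ff, phi, max_eq_right (not_lt.mp hx)]
      simp [show m ≠ 0 by omega]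
  rw [h2]
  exact h1.integrable_indicator measurableSet_Ioi

lemma perron (m : ℕ) (hm : 1 ≤ m) (x : ℝ) :
    ((phi m (1 - x) : ℝ) : ℂ) = ∫ t : ℝ, Complex.exp (-x * zt t) * wt m t := by
  have hc : Continuous (ff m) := by
    unfold ff
    have := continuous_phi m
    fun_prop
  have hF : FourierTransform.fourier (ff m) = fun ξ => 1 / (zt (2 * Real.pi * ξ)) ^ (m+1) := by
    funext ξ; exact fourier_ff m hm ξ
  have hpi : (2 * Real.pi) ≠ 0 := by positivity
  have hi : MeasureTheory.Integrable (FourierTransform.fourier (ff m)) := by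
    rw [hF]
    have h1 : MeasureTheory.Integrable (fun t : ℝ => 1 / (zt t)^(m+1)) := by
      refine MeasureTheory.Integrable.mono' (integrable_zt (m+1) (by omega)) ?_ ?_
      · refine Continuous.aestronglyMeasurable ?_
        refine Continuous.div (by fun_prop) (by fun_prop) ?_
        intro t; exact pow_ne_zero _ (zt_ne t)
      · refine Filter.Eventually.of_forall ?_
        intro t; simp
    exact h1.comp_mul_left' hpi
  have h := congrFun (Continuous.fourierInv_fourier_eq hc (integrable_ff m hm) hi) (1 - x)
  rw [hF, Real.fourierInv_eq'] at h
  have h2 : ∀ v : ℝ, Complex.exp (((2 * Real.pi * inner ℝ v (1 - x) : ℝ):ℂ) * Complex.I) • (1 / (zt (2 * Real.pi * v)) ^ (m+1))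
    = (fun t : ℝ => Complex.exp ((t * (1 - x)) * Complex.I) * (1 / (zt t)^(m+1))) (2 * Real.pi * v) := by
    intro v
    simp only [smul_eq_mul]
    congr 2
    simp; ring
  rw [MeasureTheory.integral_congr_ae (Filter.Eventually.of_forall h2),
    MeasureTheory.Measure.integral_comp_mul_left
      (fun t : ℝ => Complex.exp ((t * (1 - x)) * Complex.I) * (1 / (zt t)^(m+1)))] at h
  have h3 : ((phi m (1-x) : ℝ):ℂ) = Complex.exp ((1 - x : ℝ)) * ff m (1 - x) := by
    simp only [ff]
    push_cast
    rw [mul_left_comm, ← Complex.exp_add]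
    simp
  rw [h3, ← h, abs_of_pos (by positivity), ← MeasureTheory.integral_smul, ← MeasureTheory.integral_const_mul]
  congr 1
  funext t
  simp only [wt, Complex.real_smul]
  have e1 : -(x:ℂ) * zt t = (1 - x : ℝ) + (t * (1 - x)) * Complex.I + - zt t := by
    unfold zt; push_cast; ring
  rw [e1, Complex.exp_add, Complex.exp_add, Complex.exp_neg]
  have := Complex.exp_ne_zero (zt t)
  have := zt_ne t
  have hp : (Real.pi:ℂ) ≠ 0 := by exact_mod_cast Real.pi_ne_zero
  push_cast
  field_simp

end GPY
end

section
namespace GPY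
open MeasureTheory

noncomputable def FG (l : ℕ) (G : ℝ → ℂ) (x : ℝ) : ℂ := ∫ t : ℝ, Complex.exp (-x * zt t) * (G t * wt l t)

lemma norm_exp_zt_le {x : ℝ} (_hx : 0 ≤ x) (t : ℝ) : ‖Complex.exp (-x * zt t)‖ = Real.exp (-x) := by
  rw [Complex.norm_exp]; simp

lemma double_integral (k l : ℕ) (hk : 1 ≤ k) (hl : 1 ≤ l) (G : ℝ → ℂ) (hG : Continuous G)
    (hb : ∀ t, ‖G t‖ ≤ 2) :
    ∫ p : ℝ × ℝ, G p.1 * wt l p.1 * (G p.2 * wt l p.2) * (1 / (zt p.1 + zt p.2) ^ k) =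
    ∫ x in Set.Ioi (0:ℝ), ((x:ℂ)^(k-1) / (k-1).factorial) * (FG l G x)^2 := by
  have hGw : Integrable (fun t => G t * wt l t) := by
    refine Integrable.bdd_mul (c := 2) (integrable_wt l hl) hG.aestronglyMeasurable (Filter.Eventually.of_forall hb)
  have hGG : Integrable (fun p : ℝ × ℝ => G p.1 * wt l p.1 * (G p.2 * wt l p.2)) (volume.prod volume) :=
    Integrable.mul_prod hGw hGw
  have h1 : ∀ p : ℝ × ℝ, G p.1 * wt l p.1 * (G p.2 * wt l p.2) * (1 / (zt p.1 + zt p.2) ^ k) =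
      ∫ x in Set.Ioi (0:ℝ), G p.1 * wt l p.1 * (G p.2 * wt l p.2) *
        ((x:ℂ)^(k-1) / (k-1).factorial * Complex.exp (-(zt p.1 + zt p.2) * x)) := by
    intro p
    rw [integral_const_mul]
    congr 1
    have := integral_pow_cexp (k-1) (z := zt p.1 + zt p.2) (by simp)
    simp_rw [div_mul_eq_mul_div, integral_div]
    rw [this, Nat.sub_add_cancel hk]
    have : ((k-1).factorial : ℂ) ≠ 0 := by exact_mod_cast (k-1).factorial_ne_zero
    field_simp
  simp_rw [h1]
  rw [integral_integral_swap]
  · refine setIntegral_congr_fun measurableSet_Ioi ?_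
    intro x hx
    simp only
    have : ∀ p : ℝ × ℝ, G p.1 * wt l p.1 * (G p.2 * wt l p.2) *
        ((x:ℂ)^(k-1) / (k-1).factorial * Complex.exp (-(zt p.1 + zt p.2) * x)) =
        ((x:ℂ)^(k-1) / (k-1).factorial) * ((Complex.exp (-x * zt p.1) * (G p.1 * wt l p.1)) *
          (Complex.exp (-x * zt p.2) * (G p.2 * wt l p.2))) := by
      intro p
      have : -(zt p.1 + zt p.2) * x = -x * zt p.1 + -x * zt p.2 := by ring
      rw [this, Complex.exp_add]; ring
    simp_rw [this]
    rw [integral_const_mul]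
    congr 1
    have h2 := integral_prod_mul (μ := volume) (ν := volume) (fun t : ℝ => Complex.exp (-x * zt t) * (G t * wt l t))
      (fun t : ℝ => Complex.exp (-x * zt t) * (G t * wt l t))
    rw [Measure.volume_eq_prod, h2, FG, sq]
  · have h3 : Integrable (fun x : ℝ => x^(k-1) * Real.exp (-2 * x)) (volume.restrict (Set.Ioi 0)) :=
      integrableOn_pow_exp (k-1) two_pos
    have h4 := Integrable.mul_prod hGG.norm h3
    refine Integrable.mono' h4 ?_ ?_
    · refine Continuous.aestronglyMeasurable ?_
      unfold Function.uncurry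
      fun_prop
    · have : ∀ᵐ q : (ℝ × ℝ) × ℝ ∂((volume.prod volume).prod (volume.restrict (Set.Ioi 0))), 0 < q.2 :=
        Measure.quasiMeasurePreserving_snd.ae (p := fun x : ℝ => 0 < x) (ae_restrict_mem measurableSet_Ioi)
      filter_upwards [this] with q hq
      simp only [Function.uncurry]
      rw [norm_mul]
      gcongr
      rw [norm_mul, norm_div, norm_pow, Complex.norm_real, Real.norm_of_nonneg hq.le, Complex.norm_exp]
      gcongr
      · apply div_le_self (by positivity)
        simp
        exact_mod_cast Nat.succ_le_of_lt (Nat.factorial_pos _)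
      · simp; norm_num

lemma FG_one (l : ℕ) (hl : 1 ≤ l) (x : ℝ) : FG l (fun _ => 1) x = ((phi l (1 - x) : ℝ) : ℂ) := by
  rw [perron l hl]; simp [FG]

lemma integrable_exp_wt (l : ℕ) (hl : 1 ≤ l) (x : ℝ) : Integrable (fun t => Complex.exp (-x * zt t) * wt l t) := by
  refine Integrable.bdd_mul (c := Real.exp (-x)) (integrable_wt l hl) (Continuous.aestronglyMeasurable (by fun_prop)) (Filter.Eventually.of_forall ?_)
  intro t
  rw [Complex.norm_exp]; simp

lemma FG_sub (l : ℕ) (hl : 1 ≤ l) (η x : ℝ) : FG l (fun t => 1 - Complex.exp (-η * zt t)) x =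
    ((phi l (1 - x) - phi l (1 - (x + η)) : ℝ) : ℂ) := by
  push_cast
  rw [perron l hl, perron l hl, FG, ← integral_sub (integrable_exp_wt l hl x) (integrable_exp_wt l hl _)]
  congr 1
  funext t
  have : -((x + η : ℝ) : ℂ) * zt t = -x * zt t + -η * zt t := by push_cast; ring
  rw [this, Complex.exp_add]; ring

lemma phi_nonneg (m : ℕ) (u : ℝ) : 0 ≤ phi m u := by unfold phi; positivity

lemma phi_diff (l : ℕ) (hl : 1 ≤ l) (η u : ℝ) (hη : 0 ≤ η) :
    0 ≤ phi l u - phi l (u - η) ∧ phi l u - phi l (u - η) ≤ η * phi (l-1) u := by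
  have h0 : max (u - η) 0 ≤ max u 0 := max_le_max (by linarith) le_rfl
  have h1 : max u 0 - max (u - η) 0 ≤ η := by
    rcases le_total u 0 with h | h
    · rw [max_eq_right h]; have := le_max_right (u-η) 0; linarith
    · rw [max_eq_left h]; have := le_max_left (u-η) 0; linarith
  set a := max u 0 with ha
  set b := max (u - η) 0 with hb
  have hb0 : 0 ≤ b := le_max_right _ _
  have ha0 : 0 ≤ a := le_max_right _ _
  have e : (l.factorial : ℝ) = l * (l-1).factorial := by
    exact_mod_cast (Nat.mul_factorial_pred (by omega)).symm
  have hl' : (0:ℝ) < l := by exact_mod_cast hl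
  unfold phi
  rw [← ha, ← hb]
  constructor
  · rw [sub_nonneg]; gcongr
  · have h2 : a^l - b^l ≤ l * a^(l-1) * (a - b) := by
      have hgen : ∀ n : ℕ, a^(n+1) - b^(n+1) ≤ (n+1) * a^n * (a - b) := by
        intro n
        induction n with
        | zero => simp
        | succ n ih =>
          have h5 : b^(n+1) ≤ a^(n+1) := by gcongr
          have h6 : a^(n+2) - b^(n+2) = a * (a^(n+1) - b^(n+1)) + b^(n+1) * (a - b) := by ring
          have h7 : a * (a^(n+1) - b^(n+1)) ≤ a * ((n+1) * a^n * (a - b)) := by gcongr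
          have h8 : b^(n+1) * (a - b) ≤ a^(n+1) * (a - b) := by
            apply mul_le_mul_of_nonneg_right h5; linarith
          push_cast
          have h9 : (n + 1 + 1) * a^(n+1) * (a - b) = a * ((n+1) * a^n * (a - b)) + a^(n+1) * (a - b) := by ring
          rw [h9, show n + 1 + 1 = n + 2 by rfl, h6]; linarith
      obtain ⟨n, rfl⟩ : ∃ n, l = n + 1 := ⟨l - 1, by omega⟩
      have := hgen n
      push_cast; simpa using this
    have h3 : l * a^(l-1) * (a - b) ≤ l * a^(l-1) * η := by gcongr
    rw [← sub_div, e, ← mul_div_assoc, div_le_div_iff₀ (by positivity) (by positivity)]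
    have : 0 < ((l-1).factorial : ℝ) := by positivity
    nlinarith

end GPY
end

section
namespace GPY
open MeasureTheory

lemma beta_int (b : ℕ) : ∀ a : ℕ, ∫ x in (0:ℝ)..1, x^a * (1-x)^b = (a.factorial * b.factorial : ℝ) / (a+b+1).factorial := by
  induction b with
  | zero =>
    intro a
    simp only [pow_zero, mul_one, integral_pow, Nat.factorial_zero, Nat.cast_one, add_zero]
    rw [Nat.factorial_succ]; push_cast
    have : (0:ℝ) < a.factorial := by positivity
    field_simp; simp
  | succ b ih =>
    intro a
    have hd : ∀ x ∈ Set.uIcc (0:ℝ) 1, HasDerivAt (fun x : ℝ => x^(a+1) * (1-x)^(b+1))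
        ((a+1) * (x^a * (1-x)^(b+1)) - (b+1) * (x^(a+1) * (1-x)^b)) x := by
      intro x _
      have h1 := (hasDerivAt_pow (a+1) x).mul (((hasDerivAt_id x).const_sub 1).pow (b+1))
      refine h1.congr_deriv ?_
      simp only [id, Nat.add_sub_cancel, Pi.pow_apply]
      push_cast; ring
    have c1 : ∀ c d : ℕ, IntervalIntegrable (fun x : ℝ => x^c * (1-x)^d) volume 0 1 := by
      intro c d; exact Continuous.intervalIntegrable (by fun_prop) _ _
    have h := intervalIntegral.integral_eq_sub_of_hasDerivAt hd
      (Continuous.intervalIntegrable (by fun_prop) _ _)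
    rw [intervalIntegral.integral_sub ((c1 _ _).const_mul _) ((c1 _ _).const_mul _),
      intervalIntegral.integral_const_mul, intervalIntegral.integral_const_mul, ih (a+1)] at h
    simp only [one_pow, sub_self, ne_eq, Nat.add_eq_zero_iff, one_ne_zero, and_false, not_false_eq_true, zero_pow, mul_zero, zero_mul] at h
    have e : a + 1 + b + 1 = a + (b+1) + 1 := by ring
    rw [e, Nat.factorial_succ a] at h
    rw [Nat.factorial_succ b]
    push_cast at h ⊢
    have ha : (0:ℝ) < a + 1 := by positivity
    have hf : (0:ℝ) < (a+(b+1)+1).factorial := by positivity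
    rw [eq_div_iff hf.ne']
    field_simp at h
    apply mul_left_cancel₀ ha.ne'
    linear_combination h

noncomputable def I0 (k l : ℕ) : ℝ := (2*l).factorial / ((l.factorial:ℝ)^2 * (k+2*l).factorial)

lemma I0_pos (k l : ℕ) : 0 < I0 k l := by unfold I0; positivity

lemma phi_integrand (k l : ℕ) (hl : 1 ≤ l) :
    (fun x : ℝ => x^(k-1) / (k-1).factorial * (phi l (1-x))^2) =ᵐ[volume.restrict (Set.Ioi 0)]
    Set.indicator (Set.Ioc 0 1) (fun x : ℝ => (1 / ((k-1).factorial * (l.factorial:ℝ)^2)) * (x^(k-1) * (1-x)^(2*l))) := by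
  filter_upwards [ae_restrict_mem measurableSet_Ioi] with x hx
  by_cases h : x ≤ 1
  · rw [Set.indicator_of_mem (show x ∈ Set.Ioc (0:ℝ) 1 from ⟨hx, h⟩), phi, max_eq_left (by linarith), div_pow, ← pow_mul, mul_comm l 2]
    field_simp
  · rw [Set.indicator_of_notMem (by simp; intro _; linarith), phi, max_eq_right (by linarith)]
    simp [show l ≠ 0 by omega]

lemma phi_int (k l : ℕ) (hk : 1 ≤ k) (hl : 1 ≤ l) :
    IntegrableOn (fun x : ℝ => x^(k-1) / (k-1).factorial * (phi l (1-x))^2) (Set.Ioi 0) ∧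
    ∫ x in Set.Ioi (0:ℝ), x^(k-1) / (k-1).factorial * (phi l (1-x))^2 = I0 k l := by
  have hres : (volume.restrict (Set.Ioi (0:ℝ))).restrict (Set.Ioc 0 1) = volume.restrict (Set.Ioc 0 1) := by
    rw [Measure.restrict_restrict measurableSet_Ioc]
    congr 1; ext x; simp
  constructor
  · refine Integrable.congr ?_ (phi_integrand k l hl).symm
    apply IntegrableOn.integrable_indicator _ measurableSet_Ioc
    rw [IntegrableOn, hres]
    have : IntervalIntegrable (fun x : ℝ => (1 / ((k-1).factorial * (l.factorial:ℝ)^2)) * (x^(k-1) * (1-x)^(2*l))) volume 0 1 :=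
      Continuous.intervalIntegrable (by fun_prop) _ _
    rwa [intervalIntegrable_iff_integrableOn_Ioc_of_le zero_le_one] at this
  · rw [integral_congr_ae (phi_integrand k l hl), integral_indicator measurableSet_Ioc, hres,
      ← intervalIntegral.integral_of_le zero_le_one, intervalIntegral.integral_const_mul, beta_int, I0]
    rw [show k - 1 + 2 * l + 1 = k + 2 * l by omega]
    have : (0:ℝ) < (k-1).factorial := by positivity
    field_simp

lemma main0 (k l : ℕ) (hk : 1 ≤ k) (hl : 1 ≤ l) :
    ∫ p : ℝ × ℝ, wt l p.1 * wt l p.2 * (1 / (zt p.1 + zt p.2) ^ k) = ((I0 k l : ℝ) : ℂ) := by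
  have h := double_integral k l hk hl (fun _ => 1) continuous_const (by simp)
  simp only [one_mul] at h
  rw [h]
  simp_rw [FG_one l hl]
  rw [← (phi_int k l hk hl).2, ← integral_complex_ofReal]
  congr 1; funext x; simp

lemma norm_one_sub_exp_le (η t : ℝ) (hη : 0 ≤ η) : ‖1 - Complex.exp (-η * zt t)‖ ≤ 2 := by
  refine (norm_sub_le _ _).trans ?_
  rw [norm_exp_zt_le hη]
  have : Real.exp (-η) ≤ 1 := Real.exp_le_one_iff.mpr (by linarith)
  simp; linarith

lemma main1 (k l : ℕ) (hk : 1 ≤ k) (hl : 2 ≤ l) (η : ℝ) (hη : 0 ≤ η) :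
    ∃ r : ℝ, r ≤ η^2 * I0 k (l-1) ∧
    ∫ p : ℝ × ℝ, (1 - Complex.exp (-η * zt p.1)) * wt l p.1 * ((1 - Complex.exp (-η * zt p.2)) * wt l p.2)
      * (1 / (zt p.1 + zt p.2) ^ k) = (r : ℂ) := by
  have h := double_integral k l hk (by omega) (fun t => 1 - Complex.exp (-η * zt t)) (by fun_prop)
    (fun t => norm_one_sub_exp_le η t hη)
  simp_rw [FG_sub l (show 1 ≤ l by omega)] at h
  refine ⟨∫ x in Set.Ioi (0:ℝ), x^(k-1) / (k-1).factorial * (phi l (1 - x) - phi l (1 - (x + η)))^2, ?_, ?_⟩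
  · have := phi_int k (l-1) hk (by omega)
    rw [← this.2, ← integral_const_mul]
    refine integral_mono_of_nonneg ?_ (this.1.const_mul _) ?_
    · filter_upwards [ae_restrict_mem measurableSet_Ioi] with x hx
      have : 0 < x := hx
      positivity
    · filter_upwards [ae_restrict_mem measurableSet_Ioi] with x hx
      have hx : 0 < x := hx
      have h1 := phi_diff l (by omega) η (1 - x) hη
      rw [sub_sub] at h1
      calc _ ≤ x^(k-1) / (k-1).factorial * (η * phi (l-1) (1-x))^2 := by
            gcongr
            · exact h1.1
            · exact h1.2
        _ = _ := by ring
  · rw [h, ← integral_complex_ofReal]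
    congr 1; funext x; push_cast; rfl

end GPY
end

section
namespace GPY

lemma pow_lin (v : ℂ) (hv : ‖v‖ ≤ 8) (k : ℕ) : ‖(1 - v)^k - 1‖ ≤ k * 9^k * ‖v‖ := by
  have h9 : ‖1 - v‖ ≤ 9 := (norm_sub_le _ _).trans (by simp; linarith)
  induction k with
  | zero => simp
  | succ k ih =>
    have e : (1 - v)^(k+1) - 1 = ((1 - v)^k - 1) * (1 - v) - v := by ring
    rw [e]
    refine (norm_sub_le _ _).trans ?_
    rw [norm_mul]
    have h1 : ‖(1 - v)^k - 1‖ * ‖1 - v‖ ≤ k * 9^k * ‖v‖ * 9 := by gcongr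
    have h2 : (1:ℝ) ≤ 9^(k+1) := one_le_pow₀ (by norm_num)
    have h3 : ‖v‖ ≤ 9^(k+1) * ‖v‖ := le_mul_of_one_le_left (norm_nonneg _) h2
    push_cast
    calc _ ≤ k * 9^k * ‖v‖ * 9 + 9^(k+1) * ‖v‖ := by linarith
      _ = _ := by ring

lemma pow_quad (v : ℂ) (hv : ‖v‖ ≤ 8) (k : ℕ) : ‖(1 - v)^k - 1 + k * v‖ ≤ k^2 * 9^k * ‖v‖^2 := by
  induction k with
  | zero => simp
  | succ k ih =>
    have e : (1 - v)^(k+1) - 1 + (k+1 : ℕ) * v = ((1 - v)^k - 1 + k * v) - v * ((1-v)^k - 1) := by push_cast; ring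
    rw [e]
    refine (norm_sub_le _ _).trans ?_
    rw [norm_mul]
    have h0 := pow_lin v hv k
    have h1 : ‖v‖ * ‖(1 - v)^k - 1‖ ≤ ‖v‖ * (k * 9^k * ‖v‖) := by gcongr
    push_cast
    calc _ ≤ (k:ℝ)^2 * 9^k * ‖v‖^2 + ‖v‖ * (k * 9^k * ‖v‖) := by linarith
      _ = ((k:ℝ)^2 + k) * 9^k * ‖v‖^2 := by ring
      _ ≤ (k+1:ℝ)^2 * 9^(k+1) * ‖v‖^2 := by
        gcongr
        · nlinarith [show (0:ℝ) ≤ k by positivity]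
        · norm_num
        · omega

noncomputable def uu (a b : ℂ) : ℂ := (1 - a) * (1 - b)
noncomputable def vv (q : ℕ) (a b : ℂ) : ℂ := (uu a b / q) / ((1 - a/q) * (1 - b/q))

lemma norm_uu_le {a b : ℂ} (ha : ‖a‖ ≤ 1) (hb : ‖b‖ ≤ 1) : ‖uu a b‖ ≤ 2 * ‖1 - a‖ ∧ ‖uu a b‖ ≤ 4 := by
  have h1 : ‖1 - a‖ ≤ 2 := (norm_sub_le _ _).trans (by simp; linarith)
  have h2 : ‖1 - b‖ ≤ 2 := (norm_sub_le _ _).trans (by simp; linarith)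
  unfold uu; rw [norm_mul]
  constructor <;> nlinarith [norm_nonneg (1-a), norm_nonneg (1-b)]

lemma norm_one_sub_div {a : ℂ} (ha : ‖a‖ ≤ 1) {q : ℕ} (hq : 2 ≤ q) : 1/2 ≤ ‖1 - a/q‖ := by
  have hq' : (2:ℝ) ≤ q := by exact_mod_cast hq
  have h1 : ‖a/q‖ ≤ 1/2 := by
    rw [norm_div, Complex.norm_natCast, div_le_div_iff₀ (by positivity) (by norm_num)]; linarith
  have := norm_sub_norm_le (1:ℂ) (a/q)
  simp only [norm_one] at this; linarith

lemma local_factor (k : ℕ) (C0 : ℝ) (hC0 : 0 ≤ C0) : ∃ C : ℝ, 0 ≤ C ∧ ∀ (q : ℕ) (a b : ℂ) (h : ℝ), 2 ≤ q → ‖a‖ ≤ 1 → ‖b‖ ≤ 1 →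
    0 ≤ h → h ≤ C0 / q →
    ‖(1 + h * uu a b) * (1 - vv q a b)^k - 1‖ ≤ C * ‖uu a b‖ * (|h - k/q| + 1/(q:ℝ)^2) := by
  refine ⟨1 + 12 * k + 64 * (k^2 * 9^k) + 16 * C0 * (k * 9^k), by positivity, ?_⟩
  intro q a b h hq ha hb hh hhC
  have hq' : (2:ℝ) ≤ q := by exact_mod_cast hq
  have hqc : (q:ℂ) ≠ 0 := by exact_mod_cast (show q ≠ 0 by omega)
  set u := uu a b with hu
  set v := vv q a b with hv
  have hu4 : ‖u‖ ≤ 4 := (norm_uu_le ha hb).2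
  have hDa := norm_one_sub_div ha hq
  have hDb := norm_one_sub_div hb hq
  set D := (1 - a/q) * (1 - b/q) with hD
  have hDn : 1/4 ≤ ‖D‖ := by rw [hD, norm_mul]; nlinarith
  have hD0 : D ≠ 0 := by intro h; rw [h] at hDn; norm_num at hDn
  have hv1 : ‖v‖ ≤ 4 * ‖u‖ / q := by
    rw [hv, vv, norm_div, norm_div, Complex.norm_natCast, div_le_iff₀ (by linarith)]
    have : ‖u‖ / q * 1 ≤ ‖u‖ / q * (4 * ‖D‖) := by gcongr; linarith
    calc _ = ‖u‖ / q * 1 := by rw [mul_one]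
      _ ≤ _ := this
      _ = _ := by ring
  have hv8 : ‖v‖ ≤ 8 := by
    refine hv1.trans ?_
    rw [div_le_iff₀ (by linarith)]; nlinarith
  have h1D : ‖1 - D‖ ≤ 3 / q := by
    have : 1 - D = (a + b - a * b / q) / q := by rw [hD]; field_simp; ring
    rw [this, norm_div, Complex.norm_natCast]
    gcongr
    have h1 : ‖a * b / q‖ ≤ 1 := by
      rw [norm_div, norm_mul, Complex.norm_natCast, div_le_one (by linarith)]
      nlinarith [norm_nonneg a, norm_nonneg b]
    calc _ ≤ ‖a + b‖ + ‖a * b / q‖ := norm_sub_le _ _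
      _ ≤ ‖a‖ + ‖b‖ + 1 := by linarith [norm_add_le a b]
      _ ≤ 3 := by linarith
  have hvu : ‖v - u/q‖ ≤ 12 * ‖u‖ / (q:ℝ)^2 := by
    have : v - u/q = u/q * (1 - D) / D := by rw [hv, vv, ← hu, ← hD]; field_simp
    rw [this, norm_div, norm_mul, norm_div, Complex.norm_natCast, div_le_iff₀ (by linarith)]
    calc ‖u‖ / q * ‖1 - D‖ ≤ ‖u‖ / q * (3 / q) := by gcongr
      _ = 12 * ‖u‖ / (q:ℝ)^2 * (1/4) := by ring
      _ ≤ _ := by gcongr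
  have e : (1 + h * u) * (1 - v)^k - 1 = ((h - k/q : ℝ):ℂ) * u - k * (v - u/q) + ((1-v)^k - 1 + k * v) + h * u * ((1-v)^k - 1) := by
    push_cast; field_simp; ring
  rw [e]
  have t1 : ‖((h - k/q : ℝ):ℂ) * u‖ = |h - k/q| * ‖u‖ := by rw [norm_mul, Complex.norm_real, Real.norm_eq_abs]
  have t2 : ‖(k:ℂ) * (v - u/q)‖ ≤ k * (12 * ‖u‖ / (q:ℝ)^2) := by
    rw [norm_mul, Complex.norm_natCast]; gcongr
  have t3 : ‖(1-v)^k - 1 + k * v‖ ≤ 64 * (k^2 * 9^k) * ‖u‖ / (q:ℝ)^2 := by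
    refine (pow_quad v hv8 k).trans ?_
    calc (k:ℝ)^2 * 9^k * ‖v‖^2 ≤ (k:ℝ)^2 * 9^k * (4 * ‖u‖ / q)^2 := by gcongr
      _ = 16 * ((k:ℝ)^2 * 9^k) * (‖u‖ * ‖u‖) / (q:ℝ)^2 := by ring
      _ ≤ 16 * ((k:ℝ)^2 * 9^k) * (‖u‖ * 4) / (q:ℝ)^2 := by gcongr
      _ = _ := by ring
  have t4 : ‖h * u * ((1-v)^k - 1)‖ ≤ 16 * C0 * (k * 9^k) * ‖u‖ / (q:ℝ)^2 := by
    rw [norm_mul, norm_mul, Complex.norm_real, Real.norm_of_nonneg hh]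
    calc h * ‖u‖ * ‖(1-v)^k - 1‖ ≤ C0 / q * ‖u‖ * (k * 9^k * ‖v‖) := by
          gcongr; exact pow_lin v hv8 k
      _ ≤ C0 / q * ‖u‖ * (k * 9^k * (4 * 4 / q)) := by
          gcongr; refine hv1.trans ?_; gcongr
      _ = _ := by ring
  calc _ ≤ |h - k/q| * ‖u‖ + k * (12 * ‖u‖ / (q:ℝ)^2) + 64 * (k^2 * 9^k) * ‖u‖ / (q:ℝ)^2 + 16 * C0 * (k * 9^k) * ‖u‖ / (q:ℝ)^2 := by
        refine (norm_add_le _ _).trans ?_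
        refine add_le_add ((norm_add_le _ _).trans ?_) t4
        refine add_le_add ((norm_sub_le _ _).trans ?_) t3
        rw [t1]; linarith
    _ = ‖u‖ * (|h - k/q| * 1 + (12 * k + 64 * (k^2 * 9^k) + 16 * C0 * (k * 9^k)) * (1 / (q:ℝ)^2)) := by ring
    _ ≤ ‖u‖ * (|h - k/q| * (1 + 12 * k + 64 * (k^2 * 9^k) + 16 * C0 * (k * 9^k)) + (1 + 12 * k + 64 * (k^2 * 9^k) + 16 * C0 * (k * 9^k)) * (1 / (q:ℝ)^2)) := by
        gcongr
        · have : (0:ℝ) ≤ 12 * k + 64 * (k^2 * 9^k) + 16 * C0 * (k * 9^k) := by positivity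
          linarith
        · linarith
    _ = _ := by ring

/-- `q^{-z/L}` on the line. -/
noncomputable def qs (L : ℝ) (q : ℕ) (t : ℝ) : ℂ := Complex.exp (-((Real.log q / L : ℝ) : ℂ) * zt t)

@[fun_prop] lemma continuous_qs (L : ℝ) (q : ℕ) : Continuous (qs L q) := by unfold qs; fun_prop

lemma norm_qs_le {L : ℝ} (hL : 0 < L) {q : ℕ} (t : ℝ) : ‖qs L q t‖ ≤ 1 := by
  unfold qs
  rw [Complex.norm_exp, Real.exp_le_one_iff]
  have : 0 ≤ Real.log q / L := div_nonneg (Real.log_natCast_nonneg q) hL.le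
  simp only [Complex.mul_re, zt_re, Complex.neg_re, Complex.ofReal_re, Complex.neg_im, Complex.ofReal_im]
  linarith

lemma norm_one_sub_exp {w : ℂ} (hw : 0 ≤ w.re) : ‖1 - Complex.exp (-w)‖ ≤ ‖w‖ := by
  have h := Convex.norm_image_sub_le_of_norm_hasDerivWithin_le (f := fun x : ℝ => Complex.exp (-(x:ℂ) * w))
    (f' := fun x : ℝ => -w * Complex.exp (-(x:ℂ) * w)) (s := Set.Icc 0 1) (C := ‖w‖) (x := 0) (y := 1) ?_ ?_ (convex_Icc 0 1) (by simp) (by simp)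
  · simp at h
    rw [norm_sub_rev]; simpa using h
  · intro x _
    have h1 : HasDerivAt (fun x : ℂ => Complex.exp (-x * w)) (-w * Complex.exp (-(x:ℂ) * w)) (x:ℂ) := by
      have := ((hasDerivAt_id (x:ℂ)).neg.mul_const w).cexp
      refine this.congr_deriv ?_
      simp; ring
    exact h1.comp_ofReal.hasDerivWithinAt
  · intro x hx
    rw [norm_mul, norm_neg, Complex.norm_exp]
    have : Real.exp ((-(x:ℂ) * w).re) ≤ 1 := by
      rw [Real.exp_le_one_iff]
      simp
      exact mul_nonneg hx.1 hw
    calc _ ≤ ‖w‖ * 1 := by gcongr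
      _ = _ := mul_one _

lemma norm_one_sub_expz {η : ℝ} (hη : 0 ≤ η) (t : ℝ) : ‖1 - Complex.exp (-(η:ℂ) * zt t)‖ ≤ η * ‖zt t‖ := by
  have := norm_one_sub_exp (w := η * zt t) (by simpa using hη)
  rw [norm_mul, Complex.norm_real, Real.norm_of_nonneg hη] at this
  rwa [neg_mul]

lemma norm_one_sub_qs {L : ℝ} (hL : 0 < L) (q : ℕ) (t : ℝ) : ‖1 - qs L q t‖ ≤ Real.log q / L * ‖zt t‖ :=
  norm_one_sub_expz (div_nonneg (Real.log_natCast_nonneg q) hL.le) t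

noncomputable def KK (k : ℕ) (L : ℝ) (Y : ℕ) (h : ℕ → ℝ) (p : ℝ × ℝ) : ℂ :=
  ∏ q ∈ Nat.primesBelow Y, ((1 + h q * uu (qs L q p.1) (qs L q p.2)) * (1 - vv q (qs L q p.1) (qs L q p.2))^k)

lemma KK_bound (k : ℕ) (C0 : ℝ) (hC0 : 0 ≤ C0) : ∃ C : ℝ, 0 ≤ C ∧ ∀ (L : ℝ) (Y : ℕ) (h : ℕ → ℝ) (B1 B2 : ℝ), 0 < L →
    (∀ q ∈ Nat.primesBelow Y, 0 ≤ h q ∧ h q ≤ C0 / q) →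
    ∑ q ∈ Nat.primesBelow Y, (|h q - k/q| + 1/(q:ℝ)^2) ≤ B1 →
    ∑ q ∈ Nat.primesBelow Y, (|h q - k/q| + 1/(q:ℝ)^2) * Real.log q ≤ B2 →
    ∀ p, ‖KK k L Y h p - 1‖ ≤ C * B2 / L * Real.exp (C * B1) * ‖zt p.1‖ := by
  obtain ⟨C, hC, hloc⟩ := local_factor k C0 hC0
  refine ⟨4 * C, by positivity, ?_⟩
  intro L Y h B1 B2 hL hh hB1 hB2 p
  set f : ℕ → ℂ := fun q => ((1 + h q * uu (qs L q p.1) (qs L q p.2)) * (1 - vv q (qs L q p.1) (qs L q p.2))^k) - 1 with hf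
  set x := ∑ q ∈ Nat.primesBelow Y, ‖f q‖ with hx
  have hx0 : 0 ≤ x := Finset.sum_nonneg (fun _ _ => norm_nonneg _)
  have hKK : KK k L Y h p = ∏ q ∈ Nat.primesBelow Y, (1 + f q) := by
    unfold KK; apply Finset.prod_congr rfl; intro q _; simp [hf]
  have h1 := Finset.norm_prod_one_add_sub_one_le (Nat.primesBelow Y) f
  rw [← hKK, ← hx] at h1
  have hloc' : ∀ q ∈ Nat.primesBelow Y, ‖f q‖ ≤ C * ‖uu (qs L q p.1) (qs L q p.2)‖ * (|h q - k/q| + 1/(q:ℝ)^2) := by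
    intro q hq
    exact hloc q _ _ (h q) (Nat.prime_of_mem_primesBelow hq).two_le (norm_qs_le hL _) (norm_qs_le hL _) (hh q hq).1 (hh q hq).2
  have hx1 : x ≤ 4 * C * B1 := by
    calc x ≤ ∑ q ∈ Nat.primesBelow Y, 4 * C * (|h q - k/q| + 1/(q:ℝ)^2) := by
          apply Finset.sum_le_sum
          intro q hq
          refine (hloc' q hq).trans ?_
          have := (norm_uu_le (norm_qs_le hL (q := q) p.1) (norm_qs_le hL (q := q) p.2)).2
          rw [mul_comm 4 C]; gcongr
      _ ≤ _ := by rw [← Finset.mul_sum]; gcongr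
  have hx2 : x ≤ 2 * C * B2 / L * ‖zt p.1‖ := by
    calc x ≤ ∑ q ∈ Nat.primesBelow Y, 2 * C / L * ‖zt p.1‖ * ((|h q - k/q| + 1/(q:ℝ)^2) * Real.log q) := by
          apply Finset.sum_le_sum
          intro q hq
          refine (hloc' q hq).trans ?_
          have h2 := (norm_uu_le (norm_qs_le hL (q := q) p.1) (norm_qs_le hL (q := q) p.2)).1
          have h3 := norm_one_sub_qs hL q p.1
          calc C * ‖uu (qs L q p.1) (qs L q p.2)‖ * (|h q - k/q| + 1/(q:ℝ)^2) ≤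
              C * (2 * (Real.log q / L * ‖zt p.1‖)) * (|h q - k/q| + 1/(q:ℝ)^2) := by
                gcongr; linarith
            _ = _ := by ring
      _ ≤ 2 * C / L * ‖zt p.1‖ * B2 := by rw [← Finset.mul_sum]; gcongr
      _ = _ := by ring
  have h4 : Real.exp x - 1 ≤ x * Real.exp x := by
    have := Real.add_one_le_exp (-x)
    have h5 := Real.exp_pos x
    have : (-x + 1) * Real.exp x ≤ Real.exp (-x) * Real.exp x := by gcongr
    rw [← Real.exp_add] at this; simp at this; linarith
  calc _ ≤ x * Real.exp x := h1.trans h4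
    _ ≤ (4 * C * B2 / L * ‖zt p.1‖) * Real.exp (4 * C * B1) := by
      have : 0 ≤ 2 * C * B2 / L * ‖zt p.1‖ := hx0.trans hx2
      have h6 : x ≤ 4 * C * B2 / L * ‖zt p.1‖ := by
        have : 4 * C * B2 / L * ‖zt p.1‖ = 2 * (2 * C * B2 / L * ‖zt p.1‖) := by ring
        linarith
      have := Real.exp_le_exp.mpr hx1
      exact mul_le_mul h6 this (Real.exp_pos _).le (hx0.trans h6)
    _ = _ := by ring

end GPY
end

section
namespace GPY
open MeasureTheory

noncomputable def EP (Y : ℕ) (s : ℂ) : ℂ := ∏ q ∈ Nat.primesBelow Y, (1 - (q:ℂ)^(-s))⁻¹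

lemma cpow_qs {L : ℝ} {q : ℕ} (hq : 2 ≤ q) (z : ℂ) :
    (q:ℂ)^(-(1 + z / L)) = Complex.exp (-((Real.log q / L : ℝ) : ℂ) * z) / q := by
  have hq0 : (q:ℂ) ≠ 0 := by exact_mod_cast (show q ≠ 0 by omega)
  rw [neg_add, Complex.cpow_add _ _ hq0, Complex.cpow_neg_one, Complex.cpow_def_of_ne_zero hq0,
    ← Complex.natCast_log]
  push_cast
  rw [div_eq_inv_mul _ (q:ℂ)]
  congr 2
  ring

noncomputable def sz (L : ℝ) (t : ℝ) : ℂ := 1 + zt t / L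
noncomputable def szz (L : ℝ) (p : ℝ × ℝ) : ℂ := 1 + (zt p.1 + zt p.2) / L

noncomputable def MY (k : ℕ) (L : ℝ) (Y : ℕ) (p : ℝ × ℝ) : ℂ :=
  (L * EP Y (szz L p) / (EP Y (sz L p.1) * EP Y (sz L p.2)))^k
noncomputable def ML (k : ℕ) (L : ℝ) (p : ℝ × ℝ) : ℂ :=
  (L * riemannZeta (szz L p) / (riemannZeta (sz L p.1) * riemannZeta (sz L p.2)))^k
noncomputable def Minf (k : ℕ) (p : ℝ × ℝ) : ℂ := (zt p.1 * zt p.2 / (zt p.1 + zt p.2))^k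

lemma euler_factorization (k : ℕ) {L : ℝ} (hL : 0 < L) (Y : ℕ) (h : ℕ → ℝ) (p : ℝ × ℝ) :
    ∏ q ∈ Nat.primesBelow Y, (1 + h q * uu (qs L q p.1) (qs L q p.2)) =
    (∏ q ∈ Nat.primesBelow Y, (1 - 1 / (q:ℂ))⁻¹)^k * ((L:ℂ)^k)⁻¹ * (MY k L Y p * KK k L Y h p) := by
  have hLc : (L:ℂ) ≠ 0 := by exact_mod_cast hL.ne'
  have e1 : MY k L Y p = (L:ℂ)^k * ∏ q ∈ Nat.primesBelow Y,
      ((1 - qs L q p.1 * qs L q p.2 / q)⁻¹ / ((1 - qs L q p.1 / q)⁻¹ * (1 - qs L q p.2 / q)⁻¹))^k := by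
    unfold MY EP
    rw [mul_div_assoc, mul_pow, Finset.prod_pow, Finset.prod_div_distrib, Finset.prod_mul_distrib]
    congr 3
    · apply Finset.prod_congr rfl
      intro q hq
      have h2 := (Nat.prime_of_mem_primesBelow hq).two_le
      rw [szz, cpow_qs h2, mul_add, Complex.exp_add]; rfl
    · congr 1
      · apply Finset.prod_congr rfl
        intro q hq
        have h2 := (Nat.prime_of_mem_primesBelow hq).two_le
        rw [sz, cpow_qs h2]; rfl
      · apply Finset.prod_congr rfl
        intro q hq
        have h2 := (Nat.prime_of_mem_primesBelow hq).two_le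
        rw [sz, cpow_qs h2]; rfl
  rw [e1, KK]
  have e2 : ∀ A B C : ℂ, A * ((L:ℂ)^k)⁻¹ * ((L:ℂ)^k * B * C) = A * B * C := by
    intro A B C
    have := pow_ne_zero k hLc
    field_simp
  rw [e2, ← Finset.prod_pow, ← Finset.prod_mul_distrib, ← Finset.prod_mul_distrib]
  apply Finset.prod_congr rfl
  intro q hq
  have h2 := (Nat.prime_of_mem_primesBelow hq).two_le
  have hq0 : (q:ℂ) ≠ 0 := by exact_mod_cast (show q ≠ 0 by omega)
  have ha := norm_qs_le hL (q := q) p.1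
  have hb := norm_qs_le hL (q := q) p.2
  set a := qs L q p.1
  set b := qs L q p.2
  have nz : ∀ c : ℂ, ‖c‖ ≤ 1 → 1 - c / q ≠ 0 := by
    intro c hc h0
    have := norm_one_sub_div hc h2
    rw [h0] at this; norm_num at this
  have n1 := nz a ha
  have n2 := nz b hb
  have n3 := nz (a*b) (by rw [norm_mul]; nlinarith [norm_nonneg a, norm_nonneg b])
  have n4 := nz 1 (by simp)
  have hv : 1 - vv q a b = (1 - a*b/q) * (1 - 1/q) / ((1 - a/q) * (1 - b/q)) := by
    rw [vv, eq_div_iff (mul_ne_zero n1 n2), sub_mul, div_mul_cancel₀ _ (mul_ne_zero n1 n2), uu]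
    field_simp; ring
  rw [hv]
  have : (1 - 1/(q:ℂ))⁻¹ ^ k * ((1 - a * b / q)⁻¹ / ((1 - a / q)⁻¹ * (1 - b / q)⁻¹))^k *
      ((1 + h q * uu a b) * ((1 - a*b/q) * (1 - 1/q) / ((1 - a/q) * (1 - b/q)))^k) =
      (1 + h q * uu a b) * ((1 - 1/(q:ℂ))⁻¹ * ((1 - a * b / q)⁻¹ / ((1 - a / q)⁻¹ * (1 - b / q)⁻¹)) *
       ((1 - a*b/q) * (1 - 1/q) / ((1 - a/q) * (1 - b/q))))^k := by
    rw [mul_pow, mul_pow]; ring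
  rw [this]
  have : (1 - 1/(q:ℂ))⁻¹ * ((1 - a * b / q)⁻¹ / ((1 - a / q)⁻¹ * (1 - b / q)⁻¹)) *
       ((1 - a*b/q) * (1 - 1/q) / ((1 - a/q) * (1 - b/q))) = 1 := by
    generalize 1 - a/q = A at *
    generalize 1 - b/q = B at *
    generalize 1 - a*b/q = D at *
    generalize 1 - 1/(q:ℂ) = E at *
    field_simp
  rw [this]; simp

lemma sz_re {L : ℝ} (t : ℝ) : (sz L t).re = 1 + 1 / L := by
  simp [sz, Complex.div_ofReal_re]
lemma szz_re {L : ℝ} (p : ℝ × ℝ) : (szz L p).re = 1 + 2 / L := by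
  simp [szz, Complex.div_ofReal_re]; norm_num

lemma sz_gt {L : ℝ} (hL : 0 < L) (t : ℝ) : 1 < (sz L t).re := by
  rw [sz_re]; have : 0 < 1/L := by positivity
  linarith
lemma szz_gt {L : ℝ} (hL : 0 < L) (p : ℝ × ℝ) : 1 < (szz L p).re := by
  rw [szz_re]; have : 0 < 2/L := by positivity
  linarith

lemma EP_tendsto {s : ℂ} (hs : 1 < s.re) : Filter.Tendsto (fun Y => EP Y s) Filter.atTop (nhds (riemannZeta s)) :=
  riemannZeta_eulerProduct hs

lemma cpow_norm_lt {s : ℂ} (hs : 1 < s.re) {q : ℕ} (hq : 2 ≤ q) : ‖(q:ℂ)^(-s)‖ < 1 := by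
  rw [Complex.norm_natCast_cpow_of_pos (by omega)]
  apply Real.rpow_lt_one_of_one_lt_of_neg
  · exact_mod_cast hq
  · simp; linarith

lemma EP_ne {s : ℂ} (hs : 1 < s.re) (Y : ℕ) : EP Y s ≠ 0 := by
  unfold EP
  rw [Finset.prod_ne_zero_iff]
  intro q hq
  apply inv_ne_zero
  intro h
  have h1 := cpow_norm_lt hs (Nat.prime_of_mem_primesBelow hq).two_le
  rw [← sub_eq_zero.mp h] at h1
  simp at h1

lemma EP_real (σ : ℝ) (Y : ℕ) : EP Y (σ:ℂ) = ((∏ q ∈ Nat.primesBelow Y, (1 - (q:ℝ)^(-σ))⁻¹ : ℝ) : ℂ) := by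
  unfold EP
  push_cast
  apply Finset.prod_congr rfl
  intro q hq
  rw [Complex.ofReal_cpow (by positivity)]; simp

lemma EP_norm {s : ℂ} (hs : 1 < s.re) (Y : ℕ) : ‖EP Y s‖ ≤ ‖EP Y (s.re : ℂ)‖ ∧ ‖(EP Y s)⁻¹‖ ≤ ‖EP Y (s.re : ℂ)‖ := by
  have hb : ∀ q ∈ Nat.primesBelow Y, 0 < (1 - (q:ℝ)^(-s.re)) ∧ ‖(1 - (q:ℂ)^(-s))⁻¹‖ ≤ (1 - (q:ℝ)^(-s.re))⁻¹ ∧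
      ‖1 - (q:ℂ)^(-s)‖ ≤ (1 - (q:ℝ)^(-s.re))⁻¹ := by
    intro q hq
    have h2 := (Nat.prime_of_mem_primesBelow hq).two_le
    have h1 := cpow_norm_lt hs h2
    have e : ‖(q:ℂ)^(-s)‖ = (q:ℝ)^(-s.re) := by
      rw [Complex.norm_natCast_cpow_of_pos (by omega)]; simp
    have h0 := norm_nonneg ((q:ℂ)^(-s))
    rw [e] at h1 h0
    set x := (q:ℝ)^(-s.re)
    have hx : 0 < 1 - x := by linarith
    refine ⟨hx, ?_, ?_⟩
    · rw [norm_inv]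
      apply inv_anti₀ hx
      have := norm_sub_norm_le (1:ℂ) ((q:ℂ)^(-s))
      rw [e] at this; simpa using this
    · refine (norm_sub_le _ _).trans ?_
      rw [e, norm_one, le_inv_comm₀ (by linarith) hx, ← one_div, le_div_iff₀ (by linarith)]
      nlinarith
  rw [EP_real, Complex.norm_real, Real.norm_of_nonneg (Finset.prod_nonneg (fun q hq => (inv_pos.mpr (hb q hq).1).le))]
  unfold EP
  constructor
  · rw [norm_prod]
    exact Finset.prod_le_prod (fun _ _ => norm_nonneg _) (fun q hq => (hb q hq).2.1)
  · rw [← Finset.prod_inv_distrib, norm_prod]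
    refine Finset.prod_le_prod (fun _ _ => norm_nonneg _) (fun q hq => ?_)
    rw [inv_inv]
    exact (hb q hq).2.2

lemma EP_bdd (σ : ℝ) (hσ : 1 < σ) : ∃ B : ℝ, 1 ≤ B ∧ ∀ (Y : ℕ) (s : ℂ), s.re = σ → ‖EP Y s‖ ≤ B ∧ ‖(EP Y s)⁻¹‖ ≤ B := by
  have h := (EP_tendsto (s := (σ:ℂ)) (by simpa using hσ)).norm.bddAbove_range
  obtain ⟨B, hB⟩ := h
  refine ⟨max B 1, le_max_right _ _, ?_⟩
  intro Y s hs
  have h1 := EP_norm (s := s) (by rw [hs]; exact hσ) Y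
  rw [hs] at h1
  have h2 : ‖EP Y (σ:ℂ)‖ ≤ B := hB ⟨Y, rfl⟩
  have := le_max_left B 1
  exact ⟨by linarith, by linarith⟩

lemma MY_tendsto (k : ℕ) {L : ℝ} (hL : 0 < L) (p : ℝ × ℝ) :
    Filter.Tendsto (fun Y => MY k L Y p) Filter.atTop (nhds (ML k L p)) := by
  unfold MY ML
  refine Filter.Tendsto.pow (Filter.Tendsto.div ((EP_tendsto (szz_gt hL p)).const_mul _)
    ((EP_tendsto (sz_gt hL p.1)).mul (EP_tendsto (sz_gt hL p.2))) ?_) k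
  exact mul_ne_zero (riemannZeta_ne_zero_of_one_lt_re (sz_gt hL p.1)) (riemannZeta_ne_zero_of_one_lt_re (sz_gt hL p.2))

lemma MY_bdd (k : ℕ) {L : ℝ} (hL : 0 < L) : ∃ B : ℝ, 0 ≤ B ∧ ∀ Y p, ‖MY k L Y p‖ ≤ B := by
  obtain ⟨B1, h1, hB1⟩ := EP_bdd (1 + 1/L) (by have : 0 < 1/L := by positivity
                                               linarith)
  obtain ⟨B2, h2, hB2⟩ := EP_bdd (1 + 2/L) (by have : 0 < 2/L := by positivity
                                               linarith)
  refine ⟨(L * B2 * (B1 * B1))^k, by positivity, ?_⟩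
  intro Y p
  unfold MY
  rw [norm_pow]
  gcongr
  rw [div_eq_mul_inv, mul_inv, norm_mul, norm_mul, norm_mul, Complex.norm_real, Real.norm_of_nonneg hL.le]
  gcongr
  · exact (hB2 Y _ (szz_re p)).1
  · exact (hB1 Y _ (sz_re p.1)).2
  · exact (hB1 Y _ (sz_re p.2)).2

@[fun_prop] lemma continuous_sz (L : ℝ) : Continuous (sz L) := by unfold sz; fun_prop
@[fun_prop] lemma continuous_szz (L : ℝ) : Continuous (szz L) := by unfold szz; fun_prop

lemma continuous_EP_comp {X : Type*} [TopologicalSpace X] (Y : ℕ) (f : X → ℂ) (hf : Continuous f) (h1 : ∀ x, 1 < (f x).re) :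
    Continuous (fun x => EP Y (f x)) := by
  unfold EP
  refine continuous_finsetProd _ ?_
  intro q hq
  have h2 := (Nat.prime_of_mem_primesBelow hq).two_le
  refine Continuous.inv₀ ?_ ?_
  · refine continuous_const.sub ?_
    refine Continuous.const_cpow (by fun_prop) (Or.inl ?_)
    exact_mod_cast (show q ≠ 0 by omega)
  · intro x h
    have h3 := cpow_norm_lt (h1 x) h2
    rw [← sub_eq_zero.mp h] at h3
    simp at h3

lemma continuous_MY (k : ℕ) {L : ℝ} (hL : 0 < L) (Y : ℕ) : Continuous (MY k L Y) := by
  unfold MY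
  refine Continuous.pow (Continuous.div ?_ ?_ ?_) k
  · exact continuous_const.mul (continuous_EP_comp Y (szz L) (continuous_szz L) (szz_gt hL))
  · exact (continuous_EP_comp Y (fun p : ℝ × ℝ => sz L p.1) ((continuous_sz L).comp continuous_fst)
        (fun p => sz_gt hL p.1)).mul
      (continuous_EP_comp Y (fun p : ℝ × ℝ => sz L p.2) ((continuous_sz L).comp continuous_snd)
        (fun p => sz_gt hL p.2))
  · intro p
    exact mul_ne_zero (EP_ne (sz_gt hL p.1) Y) (EP_ne (sz_gt hL p.2) Y)

lemma aesm_ML (k : ℕ) {L : ℝ} (hL : 0 < L) : AEStronglyMeasurable (ML k L) (volume : Measure (ℝ × ℝ)) :=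
  aestronglyMeasurable_of_tendsto_ae Filter.atTop (fun Y => (continuous_MY k hL Y).aestronglyMeasurable)
    (Filter.Eventually.of_forall (MY_tendsto k hL))

lemma norm_zz (p : ℝ × ℝ) : 2 ≤ ‖zt p.1 + zt p.2‖ := by
  have := Complex.abs_re_le_norm (zt p.1 + zt p.2)
  simp at this; norm_num at this; exact this

lemma ML_bound (k : ℕ) : ∃ C : ℝ, 1 ≤ C ∧ ∀ L : ℝ, 2 ≤ L → ∀ p, ‖ML k L p‖ ≤ C * (‖zt p.1‖ * ‖zt p.2‖)^k := by
  obtain ⟨C1, h1, hC1⟩ := zeta_upper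
  obtain ⟨C2, h2, hC2⟩ := zeta_inv_bound
  refine ⟨(C1 * (C2 * C2))^k, one_le_pow₀ ?_, ?_⟩
  · nlinarith [mul_le_mul h2 h2 zero_le_one (by linarith : 0 ≤ C2)]
  intro L hL p
  have hL0 : 0 < L := by linarith
  unfold ML
  rw [norm_pow, ← mul_pow]
  gcongr
  have a1 := hC1 ((zt p.1 + zt p.2)/L) (by simp [Complex.div_ofReal_re]; positivity)
    (by simp [Complex.div_ofReal_re]; norm_num; rw [div_le_one hL0]; exact hL)
  have a2 : ∀ t, ‖(riemannZeta (sz L t))⁻¹‖ ≤ C2 * ‖zt t‖ / L := by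
    intro t
    have := hC2 (zt t / L) (by simp [Complex.div_ofReal_re]; positivity)
      (by simp [Complex.div_ofReal_re]; apply inv_le_one_of_one_le₀; linarith)
    rw [norm_div, Complex.norm_real, Real.norm_of_nonneg hL0.le] at this
    rw [sz, mul_div_assoc]; exact this
  have a3 : ‖riemannZeta (szz L p)‖ ≤ C1 * L := by
    rw [szz]; refine a1.trans ?_
    have : ((zt p.1 + zt p.2)/L).re = 2 / L := by simp [Complex.div_ofReal_re]; norm_num
    rw [this, div_div_eq_mul_div]
    have : 0 ≤ C1 * L := by positivity
    linarith
  rw [div_eq_mul_inv, mul_inv, norm_mul, norm_mul, norm_mul, Complex.norm_real, Real.norm_of_nonneg hL0.le]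
  calc L * ‖riemannZeta (szz L p)‖ * (‖(riemannZeta (sz L p.1))⁻¹‖ * ‖(riemannZeta (sz L p.2))⁻¹‖) ≤
      L * (C1 * L) * ((C2 * ‖zt p.1‖ / L) * (C2 * ‖zt p.2‖ / L)) := by
        gcongr
        · exact a2 _
        · exact a2 _
    _ = _ := by field_simp

lemma zeta_resid (z : ℂ) (hz : z ≠ 0) :
    Filter.Tendsto (fun L : ℝ => (z / L) * riemannZeta (1 + z / L)) Filter.atTop (nhds 1) := by
  have h1 : Filter.Tendsto (fun L : ℝ => 1 + z / L) Filter.atTop (nhdsWithin 1 {1}ᶜ) := by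
    rw [tendsto_nhdsWithin_iff]
    constructor
    · have : Filter.Tendsto (fun L : ℝ => ((L⁻¹ : ℝ) : ℂ)) Filter.atTop (nhds ((0:ℝ):ℂ)) :=
        (Complex.continuous_ofReal.tendsto 0).comp tendsto_inv_atTop_zero
      have h2 := (this.const_mul z).const_add 1
      simp only [Complex.ofReal_zero, mul_zero, add_zero] at h2
      refine h2.congr ?_
      intro L; push_cast; rw [div_eq_mul_inv]
    · filter_upwards [Filter.eventually_gt_atTop 0] with L hL
      have : (L:ℂ) ≠ 0 := by exact_mod_cast hL.ne'
      simp [hz, hL.ne']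
  have := riemannZeta_residue_one.comp h1
  refine this.congr ?_
  intro L
  simp

lemma ML_tendsto (k : ℕ) (p : ℝ × ℝ) : Filter.Tendsto (fun L => ML k L p) Filter.atTop (nhds (Minf k p)) := by
  have hz1 := zt_ne p.1
  have hz2 := zt_ne p.2
  have hz : zt p.1 + zt p.2 ≠ 0 := by
    intro h; have := norm_zz p; rw [h] at this; norm_num at this
  have h := ((zeta_resid _ hz).div ((zeta_resid _ hz1).mul (zeta_resid _ hz2)) (by norm_num))
  have h2 := (h.const_mul (zt p.1 * zt p.2 / (zt p.1 + zt p.2))).pow k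
  simp only [mul_one, div_one] at h2
  refine h2.congr' ?_
  filter_upwards [Filter.eventually_gt_atTop 0] with L hL
  have hL' : (L:ℂ) ≠ 0 := by exact_mod_cast hL.ne'
  unfold ML sz szz
  congr 1
  have n1 := riemannZeta_ne_zero_of_one_lt_re (sz_gt hL p.1)
  have n2 := riemannZeta_ne_zero_of_one_lt_re (sz_gt hL p.2)
  rw [sz] at n1 n2
  simp only [Pi.div_apply]
  generalize riemannZeta (1 + zt p.1 / L) = A at *
  generalize riemannZeta (1 + zt p.2 / L) = B at *
  generalize riemannZeta (1 + (zt p.1 + zt p.2) / L) = D at *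
  field_simp

end GPY
end

section
namespace GPY
open MeasureTheory

noncomputable def om (k l : ℕ) (p : ℝ × ℝ) : ℝ := ‖zt p.1‖^2 * ‖zt p.2‖ * (‖wt (k+l) p.1‖ * ‖wt (k+l) p.2‖)
noncomputable def rho (l : ℕ) (p : ℝ × ℝ) : ℝ := (‖zt p.1‖^(l-1))⁻¹ * (‖zt p.2‖^(l-1))⁻¹

lemma om_nonneg (k l : ℕ) (p : ℝ × ℝ) : 0 ≤ om k l p := by unfold om; positivity
lemma continuous_om (k l : ℕ) : Continuous (om k l) := by
  unfold om; fun_prop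

lemma om_le (k l : ℕ) (hl : 3 ≤ l) (p : ℝ × ℝ) : (‖zt p.1‖ * ‖zt p.2‖)^k * om k l p ≤ rho l p := by
  have h1 := one_le_zt p.1
  have h2 := one_le_zt p.2
  have w1 := norm_wt_le (k+l) p.1
  have w2 := norm_wt_le (k+l) p.2
  unfold om rho
  calc _ ≤ (‖zt p.1‖ * ‖zt p.2‖)^k * (‖zt p.1‖^2 * ‖zt p.2‖^2 * ((‖zt p.1‖^(k+l+1))⁻¹ * (‖zt p.2‖^(k+l+1))⁻¹)) := by
        gcongr
        exact le_self_pow₀ h2 (by norm_num)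
    _ = _ := by
        obtain ⟨j, rfl⟩ : ∃ j, l = j + 1 := ⟨l - 1, by omega⟩
        rw [show k + (j+1) + 1 = k + 2 + j by ring, Nat.add_sub_cancel]
        have : ‖zt p.1‖ ≠ 0 := by positivity
        have : ‖zt p.2‖ ≠ 0 := by positivity
        rw [pow_add, pow_add, pow_add, pow_add, mul_pow]
        field_simp

lemma integrable_rho (l : ℕ) (hl : 3 ≤ l) : Integrable (rho l) :=
  Integrable.mul_prod (integrable_zt (l-1) (by omega)) (integrable_zt (l-1) (by omega))

lemma om_le_rho (k l : ℕ) (hl : 3 ≤ l) (p : ℝ × ℝ) : om k l p ≤ rho l p := by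
  refine le_trans ?_ (om_le k l hl p)
  have h1 := one_le_zt p.1
  have h2 := one_le_zt p.2
  have : 1 ≤ (‖zt p.1‖ * ‖zt p.2‖)^k := one_le_pow₀ (by nlinarith)
  exact le_mul_of_one_le_left (om_nonneg _ _ _) this

lemma norm_Minf_le (k : ℕ) (p : ℝ × ℝ) : ‖Minf k p‖ ≤ (‖zt p.1‖ * ‖zt p.2‖)^k := by
  unfold Minf
  rw [norm_pow, norm_div, norm_mul]
  gcongr
  apply div_le_self (by positivity)
  have := norm_zz p
  linarith

lemma continuous_Minf (k : ℕ) : Continuous (Minf k) := by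
  unfold Minf
  refine Continuous.pow (Continuous.div (by fun_prop) (by fun_prop) ?_) k
  intro p h
  have := norm_zz p; rw [h] at this; norm_num at this

lemma AL1 (k l : ℕ) (hl : 3 ≤ l) {L : ℝ} (hL : 2 ≤ L) :
    (∀ Y, Integrable (fun p => ‖MY k L Y p - ML k L p‖ * om k l p)) ∧
    Filter.Tendsto (fun Y => ∫ p : ℝ × ℝ, ‖MY k L Y p - ML k L p‖ * om k l p) Filter.atTop (nhds 0) := by
  have hL0 : 0 < L := by linarith
  obtain ⟨B, hB0, hB⟩ := MY_bdd k hL0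
  obtain ⟨C, hC1, hC⟩ := ML_bound k
  have hm : ∀ Y, AEStronglyMeasurable (fun p => ‖MY k L Y p - ML k L p‖ * om k l p) (volume : Measure (ℝ × ℝ)) := by
    intro Y
    exact (((continuous_MY k hL0 Y).aestronglyMeasurable.sub (aesm_ML k hL0)).norm).mul (continuous_om k l).aestronglyMeasurable
  have hb : ∀ Y, ∀ p, ‖‖MY k L Y p - ML k L p‖ * om k l p‖ ≤ (B + C) * rho l p := by
    intro Y p
    have h0 := om_nonneg k l p
    rw [Real.norm_of_nonneg (by positivity)]
    have h1 : ‖MY k L Y p - ML k L p‖ ≤ B + C * (‖zt p.1‖ * ‖zt p.2‖)^k :=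
      (norm_sub_le _ _).trans (add_le_add (hB Y p) (hC L hL p))
    have h2 := om_le k l hl p
    have h3 := om_le_rho k l hl p
    calc _ ≤ (B + C * (‖zt p.1‖ * ‖zt p.2‖)^k) * om k l p := by gcongr
      _ = B * om k l p + C * ((‖zt p.1‖ * ‖zt p.2‖)^k * om k l p) := by ring
      _ ≤ B * rho l p + C * rho l p := by gcongr
      _ = _ := by ring
  have hi := (integrable_rho l hl).const_mul (B + C)
  refine ⟨fun Y => Integrable.mono' hi (hm Y) (Filter.Eventually.of_forall (hb Y)), ?_⟩
  have := tendsto_integral_filter_of_dominated_convergence (f := fun _ : ℝ × ℝ => (0:ℝ)) (μ := volume) (l := Filter.atTop)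
    (F := fun Y p => ‖MY k L Y p - ML k L p‖ * om k l p) _
    (Filter.Eventually.of_forall hm) (Filter.Eventually.of_forall fun Y => Filter.Eventually.of_forall (hb Y)) hi
    (Filter.Eventually.of_forall ?_)
  · simpa using this
  · intro p
    have h1 := ((MY_tendsto k hL0 p).sub_const (ML k L p)).norm.mul_const (om k l p)
    simpa using h1

lemma AL2 (k l : ℕ) (hl : 3 ≤ l) :
    (∀ L : ℝ, 2 ≤ L → Integrable (fun p => ‖ML k L p - Minf k p‖ * om k l p)) ∧
    Filter.Tendsto (fun L => ∫ p : ℝ × ℝ, ‖ML k L p - Minf k p‖ * om k l p) Filter.atTop (nhds 0) := by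
  obtain ⟨C, hC1, hC⟩ := ML_bound k
  have hm : ∀ L : ℝ, 2 ≤ L → AEStronglyMeasurable (fun p => ‖ML k L p - Minf k p‖ * om k l p) (volume : Measure (ℝ × ℝ)) := by
    intro L hL
    exact (((aesm_ML k (by linarith)).sub (continuous_Minf k).aestronglyMeasurable).norm).mul (continuous_om k l).aestronglyMeasurable
  have hb : ∀ L : ℝ, 2 ≤ L → ∀ p, ‖‖ML k L p - Minf k p‖ * om k l p‖ ≤ (C + 1) * rho l p := by
    intro L hL p
    have h0 := om_nonneg k l p
    rw [Real.norm_of_nonneg (by positivity)]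
    have h1 : ‖ML k L p - Minf k p‖ ≤ C * (‖zt p.1‖ * ‖zt p.2‖)^k + (‖zt p.1‖ * ‖zt p.2‖)^k :=
      (norm_sub_le _ _).trans (add_le_add (hC L hL p) (norm_Minf_le k p))
    have h2 := om_le k l hl p
    calc _ ≤ (C * (‖zt p.1‖ * ‖zt p.2‖)^k + (‖zt p.1‖ * ‖zt p.2‖)^k) * om k l p := by gcongr
      _ = (C + 1) * ((‖zt p.1‖ * ‖zt p.2‖)^k * om k l p) := by ring
      _ ≤ _ := by gcongr
  have hi := (integrable_rho l hl).const_mul (C + 1)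
  refine ⟨fun L hL => Integrable.mono' hi (hm L hL) (Filter.Eventually.of_forall (hb L hL)), ?_⟩
  have h2 : ∀ᶠ L : ℝ in Filter.atTop, 2 ≤ L := Filter.eventually_ge_atTop 2
  have := tendsto_integral_filter_of_dominated_convergence (f := fun _ : ℝ × ℝ => (0:ℝ)) (μ := volume) (l := Filter.atTop)
    (F := fun L p => ‖ML k L p - Minf k p‖ * om k l p) _
    (h2.mono hm) (h2.mono fun L hL => Filter.Eventually.of_forall (hb L hL)) hi
    (Filter.Eventually.of_forall ?_)
  · simpa using this
  · intro p
    have h1 := ((ML_tendsto k p).sub_const (Minf k p)).norm.mul_const (om k l p)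
    simpa using h1

lemma AL3 (k l : ℕ) (hl : 3 ≤ l) : ∃ C : ℝ, 0 ≤ C ∧ ∀ L : ℝ, 2 ≤ L →
    Integrable (fun p => ‖ML k L p‖ * om k l p) ∧ ∫ p : ℝ × ℝ, ‖ML k L p‖ * om k l p ≤ C := by
  obtain ⟨C, hC1, hC⟩ := ML_bound k
  have hi := (integrable_rho l hl).const_mul C
  have hr : ∀ p, 0 ≤ rho l p := fun p => by unfold rho; positivity
  refine ⟨∫ p : ℝ × ℝ, C * rho l p, integral_nonneg (fun p => mul_nonneg (by linarith) (hr p)), ?_⟩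
  intro L hL
  have hb : ∀ p, ‖ML k L p‖ * om k l p ≤ C * rho l p := by
    intro p
    have h0 := om_nonneg k l p
    have h2 := om_le k l hl p
    calc _ ≤ (C * (‖zt p.1‖ * ‖zt p.2‖)^k) * om k l p := by gcongr; exact hC L hL p
      _ = C * ((‖zt p.1‖ * ‖zt p.2‖)^k * om k l p) := by ring
      _ ≤ _ := by gcongr
  have hintg : Integrable (fun p => ‖ML k L p‖ * om k l p) := by
    refine Integrable.mono' hi ?_ (Filter.Eventually.of_forall ?_)
    · exact (aesm_ML k (by linarith)).norm.mul (continuous_om k l).aestronglyMeasurable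
    · intro p
      have h0 := om_nonneg k l p
      rw [Real.norm_of_nonneg (by positivity)]
      exact hb p
  exact ⟨hintg, integral_mono hintg hi hb⟩

/-- the main analytic estimate -/
lemma AL (k l : ℕ) (hl : 3 ≤ l) (ε : ℝ) (hε : 0 < ε) : ∃ κ : ℝ, 0 < κ ∧ ∃ L0 : ℝ, 2 ≤ L0 ∧ ∀ L : ℝ, L0 ≤ L →
    ∃ Y0 : ℕ, ∀ Y, Y0 ≤ Y → ∀ K : ℝ × ℝ → ℂ, (∀ p, ‖K p - 1‖ ≤ κ * ‖zt p.1‖) →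
    ∫ p : ℝ × ℝ, ‖MY k L Y p * K p - Minf k p‖ * (‖zt p.1‖ * ‖zt p.2‖ * (‖wt (k+l) p.1‖ * ‖wt (k+l) p.2‖)) ≤ ε := by
  obtain ⟨C, hC0, hC⟩ := AL3 k l hl
  obtain ⟨i2, t2⟩ := AL2 k l hl
  set κ := min 1 (ε / (3 * (C + 1))) with hκ
  have hκ0 : 0 < κ := by rw [hκ]; positivity
  have hκ1 : κ ≤ 1 := min_le_left _ _
  have hκC : κ * C ≤ ε / 3 := by
    calc κ * C ≤ ε / (3 * (C+1)) * (C + 1) := by gcongr; exact min_le_right _ _; linarith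
      _ = ε / 3 := by field_simp
  refine ⟨κ, hκ0, ?_⟩
  have e2 := (t2.eventually (ge_mem_nhds (show 0 < ε/3 by positivity)))
  obtain ⟨L1, hL1⟩ := Filter.eventually_atTop.mp e2
  refine ⟨max L1 2, le_max_right _ _, ?_⟩
  intro L hL
  have hL2 : 2 ≤ L := (le_max_right _ _).trans hL
  obtain ⟨i1, t1⟩ := AL1 k l hl hL2
  have e1 := (t1.eventually (ge_mem_nhds (show 0 < ε/6 by positivity)))
  obtain ⟨Y0, hY0⟩ := Filter.eventually_atTop.mp e1
  refine ⟨Y0, ?_⟩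
  intro Y hY K hK
  have h1 := hY0 Y hY
  have h2 := hL1 L ((le_max_left _ _).trans hL)
  have h3 := hC L hL2
  have hintg := (((i1 Y).const_mul 2).add (h3.1.const_mul κ)).add (i2 L hL2)
  calc _ ≤ ∫ p : ℝ × ℝ, (2 * (‖MY k L Y p - ML k L p‖ * om k l p) + κ * (‖ML k L p‖ * om k l p)) + ‖ML k L p - Minf k p‖ * om k l p := by
        refine integral_mono_of_nonneg (Filter.Eventually.of_forall fun p => ?_) hintg (Filter.Eventually.of_forall fun p => ?_)
        · simp only [Pi.zero_apply]; positivity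
        · simp only
          have hz := one_le_zt p.1
          set W := ‖zt p.1‖ * ‖zt p.2‖ * (‖wt (k+l) p.1‖ * ‖wt (k+l) p.2‖) with hW
          have hW0 : 0 ≤ W := by positivity
          have hom : om k l p = ‖zt p.1‖ * W := by rw [hW, om]; ring
          have e : MY k L Y p * K p - Minf k p = (MY k L Y p - ML k L p) + (MY k L Y p - ML k L p) * (K p - 1)
            + ML k L p * (K p - 1) + (ML k L p - Minf k p) := by ring
          have hK1 : ‖K p - 1‖ ≤ ‖zt p.1‖ := (hK p).trans (by nlinarith)
          have b : ‖MY k L Y p * K p - Minf k p‖ ≤ ‖MY k L Y p - ML k L p‖ * ‖zt p.1‖ + ‖MY k L Y p - ML k L p‖ * ‖zt p.1‖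
              + ‖ML k L p‖ * (κ * ‖zt p.1‖) + ‖ML k L p - Minf k p‖ * ‖zt p.1‖ := by
            rw [e]
            refine (norm_add_le _ _).trans (add_le_add ((norm_add_le _ _).trans (add_le_add ((norm_add_le _ _).trans (add_le_add ?_ ?_)) ?_)) ?_)
            · exact le_mul_of_one_le_right (norm_nonneg _) hz
            · rw [norm_mul]; gcongr
            · rw [norm_mul]; gcongr; exact hK p
            · exact le_mul_of_one_le_right (norm_nonneg _) hz
          rw [hom]
          calc _ ≤ (‖MY k L Y p - ML k L p‖ * ‖zt p.1‖ + ‖MY k L Y p - ML k L p‖ * ‖zt p.1‖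
              + ‖ML k L p‖ * (κ * ‖zt p.1‖) + ‖ML k L p - Minf k p‖ * ‖zt p.1‖) * W := by gcongr
            _ = _ := by ring
    _ = 2 * (∫ p : ℝ × ℝ, ‖MY k L Y p - ML k L p‖ * om k l p) + κ * (∫ p : ℝ × ℝ, ‖ML k L p‖ * om k l p) + ∫ p : ℝ × ℝ, ‖ML k L p - Minf k p‖ * om k l p := by
        have hA : Integrable (fun p : ℝ × ℝ => 2 * (‖MY k L Y p - ML k L p‖ * om k l p) + κ * (‖ML k L p‖ * om k l p)) :=
          ((i1 Y).const_mul 2).add (h3.1.const_mul κ)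
        rw [integral_add hA (i2 L hL2), integral_add ((i1 Y).const_mul 2) (h3.1.const_mul κ),
          integral_const_mul, integral_const_mul]
    _ ≤ 2 * (ε/6) + κ * C + ε/3 := by
        have := mul_le_mul_of_nonneg_left h3.2 hκ0.le
        linarith
    _ ≤ ε := by linarith

end GPY
end

section
namespace GPY

lemma rankin : ∃ C : ℝ, 1 ≤ C ∧ ∀ σ : ℝ, 0 < σ → σ ≤ 1 → ∀ Y : ℕ,
    ∏ q ∈ Nat.primesBelow Y, (1 + (q:ℝ)^(-(1+σ))) ≤ C / σ := by
  obtain ⟨C, hC, h⟩ := zeta_upper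
  refine ⟨C, hC, ?_⟩
  intro σ h0 h1 Y
  have hfac : ∀ q : ℕ, 2 ≤ q → 0 < (q:ℝ)^(-(1+σ)) ∧ (q:ℝ)^(-(1+σ)) < 1 := by
    intro q hq
    have hq' : (1:ℝ) < q := by exact_mod_cast hq
    exact ⟨by positivity, Real.rpow_lt_one_of_one_lt_of_neg hq' (by linarith)⟩
  have hone : ∀ q : ℕ, 2 ≤ q → 1 + (q:ℝ)^(-(1+σ)) ≤ (1 - (q:ℝ)^(-(1+σ)))⁻¹ := by
    intro q hq
    obtain ⟨a, b⟩ := hfac q hq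
    rw [le_inv_comm₀ (by linarith) (by linarith), inv_eq_one_div, le_div_iff₀ (by linarith)]
    nlinarith
  have hmono : Monotone (fun Y : ℕ => ∏ q ∈ Nat.primesBelow Y, (1 - (q:ℝ)^(-(1+σ)))⁻¹) := by
    intro Y1 Y2 hY
    have hsub := Nat.primesBelow_mono hY
    have hpos : ∀ q ∈ Nat.primesBelow Y2, 1 ≤ (1 - (q:ℝ)^(-(1+σ)))⁻¹ := by
      intro q hq
      have := hfac q (Nat.prime_of_mem_primesBelow hq).two_le
      have := hone q (Nat.prime_of_mem_primesBelow hq).two_le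
      linarith
    simp only
    rw [← Finset.prod_sdiff hsub]
    refine le_mul_of_one_le_left (Finset.prod_nonneg fun q hq => ?_) (Finset.one_le_prod fun q hq => ?_)
    · linarith [hpos q (hsub hq)]
    · exact hpos q (Finset.mem_sdiff.mp hq).1
  have ht : Filter.Tendsto (fun Y : ℕ => ∏ q ∈ Nat.primesBelow Y, (1 - (q:ℝ)^(-(1+σ)))⁻¹) Filter.atTop (nhds ‖riemannZeta (((1+σ:ℝ)):ℂ)‖) := by
    have := (EP_tendsto (s := ((1+σ:ℝ):ℂ)) (by simpa using h0)).norm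
    refine this.congr ?_
    intro Y
    rw [EP_real, Complex.norm_real, Real.norm_of_nonneg]
    refine Finset.prod_nonneg ?_
    intro q hq
    have := hfac q (Nat.prime_of_mem_primesBelow hq).two_le
    have : 0 < 1 - (q:ℝ)^(-(1+σ)) := by linarith
    positivity
  calc _ ≤ ∏ q ∈ Nat.primesBelow Y, (1 - (q:ℝ)^(-(1+σ)))⁻¹ := by
        refine Finset.prod_le_prod ?_ ?_
        · intro q hq; positivity
        · intro q hq; exact hone q (Nat.prime_of_mem_primesBelow hq).two_le
    _ ≤ ‖riemannZeta (((1+σ:ℝ)):ℂ)‖ := hmono.ge_of_tendsto ht Y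
    _ ≤ C / σ := by
      have := h (σ:ℂ) (by simpa using h0) (by simpa using h1)
      simpa using this

lemma sum_inv_primes : ∃ C : ℝ, 1 ≤ C ∧ ∀ x : ℝ, 1 ≤ Real.log x → ∀ Y : ℕ,
    ∑ q ∈ (Nat.primesBelow Y).filter (fun q : ℕ => (q:ℝ) ≤ x), 1/(q:ℝ) ≤ 6 * Real.log (C * Real.log x) := by
  obtain ⟨C, hC, h⟩ := rankin
  refine ⟨C, hC, ?_⟩
  intro x hx Y
  set σ := 1 / Real.log x with hσ
  have hσ0 : 0 < σ := by positivity
  have hσ1 : σ ≤ 1 := by rw [hσ, div_le_one (by linarith)]; exact hx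
  have h1 := h σ hσ0 hσ1 Y
  have h2 : C / σ = C * Real.log x := by rw [hσ]; field_simp
  have hpos : 0 < C * Real.log x := by positivity
  rw [h2] at h1
  have h3 := Real.log_le_log (Finset.prod_pos (fun q _ => by positivity)) h1
  rw [Real.log_prod (fun q _ => by positivity)] at h3
  have hy : ∀ y : ℝ, 0 ≤ y → y ≤ 1 → y ≤ 2 * Real.log (1 + y) := by
    intro y hy0 hy1
    have := Real.one_sub_inv_le_log_of_pos (show 0 < 1 + y by linarith)
    have h5 : y / 2 ≤ 1 - (1+y)⁻¹ := by
      have : 1 - (1+y)⁻¹ = y / (1+y) := by field_simp; ring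
      rw [this]; gcongr; linarith
    linarith
  calc ∑ q ∈ (Nat.primesBelow Y).filter (fun q : ℕ => (q:ℝ) ≤ x), 1/(q:ℝ) ≤ ∑ q ∈ (Nat.primesBelow Y).filter (fun q : ℕ => (q:ℝ) ≤ x), 3 * (2 * Real.log (1 + (q:ℝ)^(-(1+σ)))) := by
        apply Finset.sum_le_sum
        intro q hq
        rw [Finset.mem_filter] at hq
        have hq2 := (Nat.prime_of_mem_primesBelow hq.1).two_le
        have hq' : (1:ℝ) ≤ q := by exact_mod_cast (by omega : 1 ≤ q)
        refine le_trans ?_ (mul_le_mul_of_nonneg_left (hy ((q:ℝ)^(-(1+σ))) (by positivity) ?_) (by norm_num))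
        · have e : (q:ℝ)^(-(1+σ)) = 1/q * (q:ℝ)^(-σ) := by
            rw [neg_add, Real.rpow_add (by linarith), Real.rpow_neg_one, one_div]
          rw [e]
          have h6 : Real.exp (-1) ≤ (q:ℝ)^(-σ) := by
            rw [Real.rpow_def_of_pos (by linarith)]
            apply Real.exp_le_exp.mpr
            have : Real.log q ≤ Real.log x := Real.log_le_log (by linarith) hq.2
            have : Real.log q * σ ≤ Real.log x * σ := by gcongr
            have h7 : Real.log x * σ = 1 := by rw [hσ]; field_simp
            linarith
          have h8 : (1:ℝ)/3 ≤ Real.exp (-1) := by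
            rw [Real.exp_neg, one_div]
            apply inv_anti₀ (Real.exp_pos _)
            have := Real.exp_one_lt_d9; linarith
          have h9 : 0 < 1/(q:ℝ) := by positivity
          nlinarith
        · apply Real.rpow_le_one_of_one_le_of_nonpos hq'; linarith
    _ ≤ ∑ q ∈ Nat.primesBelow Y, 3 * (2 * Real.log (1 + (q:ℝ)^(-(1+σ)))) := by
        refine Finset.sum_le_sum_of_subset_of_nonneg (Finset.filter_subset _ _) ?_
        intro q _ _
        have : 0 ≤ Real.log (1 + (q:ℝ)^(-(1+σ))) := Real.log_nonneg (by
          have : (0:ℝ) ≤ (q:ℝ)^(-(1+σ)) := by positivity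
          linarith)
        positivity
    _ = 6 * ∑ q ∈ Nat.primesBelow Y, Real.log (1 + (q:ℝ)^(-(1+σ))) := by
        rw [Finset.mul_sum]; apply Finset.sum_congr rfl; intro q _; ring
    _ ≤ _ := by gcongr

lemma sum_log_sq : ∃ S : ℝ, 1 ≤ S ∧ ∀ T : Finset ℕ, (∀ q ∈ T, 2 ≤ q) → ∑ q ∈ T, 1/(q:ℝ)^2 ≤ S ∧ ∑ q ∈ T, 1/(q:ℝ)^2 * Real.log q ≤ S
    ∧ ∑ q ∈ T, 1/(q:ℝ)^2 * Real.log q^2 ≤ S := by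
  have hs : Summable (fun n : ℕ => 16 * (1 / (n:ℝ)^(3/2:ℝ))) := (Real.summable_one_div_nat_rpow.mpr (by norm_num)).mul_left 16
  refine ⟨max 1 (∑' n : ℕ, 16 * (1 / (n:ℝ)^(3/2:ℝ))), le_max_left _ _, ?_⟩
  intro T hT
  have hb : ∀ q ∈ T, 1/(q:ℝ)^2 ≤ 16 * (1 / (q:ℝ)^(3/2:ℝ)) ∧ 1/(q:ℝ)^2 * Real.log q ≤ 16 * (1 / (q:ℝ)^(3/2:ℝ)) ∧ 1/(q:ℝ)^2 * Real.log q^2 ≤ 16 * (1 / (q:ℝ)^(3/2:ℝ)) := by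
    intro q hq
    have h2 := hT q hq
    have hq1 : (1:ℝ) ≤ q := by exact_mod_cast (by omega : 1 ≤ q)
    have e : (q:ℝ)^(2:ℕ) = (q:ℝ)^(3/2:ℝ) * (q:ℝ)^(1/2:ℝ) := by
      rw [← Real.rpow_add (by linarith)]; norm_num
    have e4 : (q:ℝ)^(1/2:ℝ) = ((q:ℝ)^(1/4:ℝ))^2 := by
      rw [← Real.rpow_natCast, ← Real.rpow_mul (by linarith)]; norm_num
    have h4 : Real.log q ≤ 4 * (q:ℝ)^(1/4:ℝ) := by
      have := Real.log_le_rpow_div (show (0:ℝ) ≤ q by linarith) (show (0:ℝ) < 1/4 by norm_num)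
      linarith
    have hr : 1 ≤ (q:ℝ)^(1/4:ℝ) := Real.one_le_rpow hq1 (by norm_num)
    have hl := Real.log_nonneg hq1
    set r := (q:ℝ)^(1/4:ℝ)
    have hA : 0 < (q:ℝ)^(3/2:ℝ) := by positivity
    rw [e, e4]
    have aux : ∀ t : ℝ, t ≤ 16 * r^2 → 1 / ((q:ℝ)^(3/2:ℝ) * r^2) * t ≤ 16 * (1 / (q:ℝ)^(3/2:ℝ)) := by
      intro t ht
      calc _ ≤ 1 / ((q:ℝ)^(3/2:ℝ) * r^2) * (16 * r^2) := by gcongr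
        _ = _ := by field_simp
    refine ⟨by simpa using aux 1 (by nlinarith), aux _ (by nlinarith), aux _ (by nlinarith)⟩
  have hsum : ∑ q ∈ T, 16 * (1 / (q:ℝ)^(3/2:ℝ)) ≤ ∑' n : ℕ, 16 * (1 / (n:ℝ)^(3/2:ℝ)) :=
    hs.sum_le_tsum T (fun n _ => by positivity)
  refine ⟨?_, ?_, ?_⟩
  · exact (Finset.sum_le_sum (fun q hq => (hb q hq).1)).trans (hsum.trans (le_max_right _ _))
  · exact (Finset.sum_le_sum (fun q hq => (hb q hq).2.1)).trans (hsum.trans (le_max_right _ _))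
  · exact (Finset.sum_le_sum (fun q hq => (hb q hq).2.2)).trans (hsum.trans (le_max_right _ _))

/-- error shape -/
noncomputable def esh (A w : ℝ) (p q : ℕ) : ℝ := A * (1/(q:ℝ)^2) + (if (q:ℝ) ≤ w then A * (1/(q:ℝ)) else 0) + (if q = p then A * (1/(q:ℝ)) else 0)

lemma esh_sums : ∃ S : ℝ, 1 ≤ S ∧ ∀ A w : ℝ, 0 ≤ A → 1 ≤ Real.log w → ∀ p Y : ℕ,
    ∑ q ∈ Nat.primesBelow Y, esh A w p q ≤ A * (S + 1 + 6 * Real.log (S * Real.log w)) ∧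
    ∑ q ∈ Nat.primesBelow Y, esh A w p q * Real.log q ≤ A * (S + 1 + Real.log w * (6 * Real.log (S * Real.log w))) := by
  obtain ⟨S1, hS1, h1⟩ := sum_log_sq
  obtain ⟨C, hC, h2⟩ := sum_inv_primes
  refine ⟨max S1 C, hS1.trans (le_max_left _ _), ?_⟩
  intro A w hA hw p Y
  set S := max S1 C
  have hSS : S1 ≤ S := le_max_left _ _
  have hSC : C ≤ S := le_max_right _ _
  obtain ⟨a1, a2, -⟩ := h1 (Nat.primesBelow Y) (fun q hq => (Nat.prime_of_mem_primesBelow hq).two_le)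
  have b := h2 w hw Y
  have hlog : Real.log (C * Real.log w) ≤ Real.log (S * Real.log w) := by
    apply Real.log_le_log (by positivity); gcongr
  have c1 : ∑ q ∈ Nat.primesBelow Y, (if (q:ℝ) ≤ w then A * (1/(q:ℝ)) else 0) ≤ A * (6 * Real.log (S * Real.log w)) := by
    rw [← Finset.sum_filter, ← Finset.mul_sum]
    gcongr; linarith
  have c2 : ∑ q ∈ Nat.primesBelow Y, (if (q:ℝ) ≤ w then A * (1/(q:ℝ)) else 0) * Real.log q ≤ A * (Real.log w * (6 * Real.log (S * Real.log w))) := by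
    calc _ ≤ ∑ q ∈ Nat.primesBelow Y, (if (q:ℝ) ≤ w then A * (1/(q:ℝ)) else 0) * Real.log w := by
          apply Finset.sum_le_sum
          intro q hq
          split_ifs with hqw
          · have hq2 := (Nat.prime_of_mem_primesBelow hq).pos
            have : Real.log q ≤ Real.log w := Real.log_le_log (by exact_mod_cast hq2) hqw
            gcongr
          · simp
      _ ≤ A * (6 * Real.log (S * Real.log w)) * Real.log w := by
          rw [← Finset.sum_mul]; gcongr
      _ = _ := by ring
  have d1 : ∑ q ∈ Nat.primesBelow Y, (if q = p then A * (1/(q:ℝ)) else 0) ≤ A * 1 := by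
    rw [← Finset.sum_filter, Finset.filter_eq']
    split_ifs with hp
    · have : (1:ℝ) ≤ p := by exact_mod_cast (Nat.prime_of_mem_primesBelow hp).one_lt.le
      simp only [Finset.sum_singleton]
      gcongr
      rw [div_le_one (by linarith)]; exact this
    · simp [hA]
  have d2 : ∑ q ∈ Nat.primesBelow Y, (if q = p then A * (1/(q:ℝ)) else 0) * Real.log q ≤ A * 1 := by
    simp only [ite_mul, zero_mul]
    rw [← Finset.sum_filter, Finset.filter_eq']
    split_ifs with hp
    · have : (1:ℝ) ≤ p := by exact_mod_cast (Nat.prime_of_mem_primesBelow hp).one_lt.le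
      simp only [Finset.sum_singleton]
      rw [mul_assoc]
      gcongr
      rw [one_div_mul_eq_div, div_le_one (by linarith)]
      exact (Real.log_le_sub_one_of_pos (by linarith)).trans (by linarith)
    · simp [hA]
  constructor
  · unfold esh
    rw [Finset.sum_add_distrib, Finset.sum_add_distrib, ← Finset.mul_sum]
    have : A * ∑ q ∈ Nat.primesBelow Y, 1/(q:ℝ)^2 ≤ A * S := by gcongr; linarith
    linarith
  · unfold esh
    simp only [add_mul]
    rw [Finset.sum_add_distrib, Finset.sum_add_distrib]
    have : ∑ q ∈ Nat.primesBelow Y, A * (1/(q:ℝ)^2) * Real.log q ≤ A * S := by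
      simp only [mul_assoc]; rw [← Finset.mul_sum]; gcongr; linarith
    linarith

end GPY
end

section
namespace GPY

lemma KK_small (k : ℕ) (A Ch κ : ℝ) (hA : 1 ≤ A) (hCh : 0 < Ch) (hκ : 0 < κ) : ∃ L1 : ℝ, ∀ L, L1 ≤ L → ∀ (Y p : ℕ) (h : ℕ → ℝ),
    (∀ q ∈ Nat.primesBelow Y, 0 ≤ h q ∧ h q ≤ A / q) →
    (∀ q ∈ Nat.primesBelow Y, |h q - k/q| + 1/(q:ℝ)^2 ≤ esh A (Ch * L) p q) →
    ∀ t, ‖KK k L Y h t - 1‖ ≤ κ * ‖zt t.1‖ := by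
  obtain ⟨C, hC, hK⟩ := KK_bound k A (by linarith)
  obtain ⟨S, hS, hs⟩ := esh_sums
  obtain ⟨n, hn⟩ := exists_nat_ge (C * A * 6)
  -- with u = log (Ch L)
  have hlim : Filter.Tendsto (fun L : ℝ => (C * A * (S + 1 + 6 * S) * Ch * Real.exp (C * A * (S+1)) * S^n) * ((Real.log (Ch * L))^(n+2) * Real.exp (-(Real.log (Ch * L)))))
      Filter.atTop (nhds 0) := by
    rw [← mul_zero (C * A * (S + 1 + 6 * S) * Ch * Real.exp (C * A * (S+1)) * S^n)]
    refine Filter.Tendsto.const_mul _ ?_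
    exact (Real.tendsto_pow_mul_exp_neg_atTop_nhds_zero (n+2)).comp
      (Real.tendsto_log_atTop.comp (Filter.tendsto_id.const_mul_atTop hCh))
  have hl2 : Filter.Tendsto (fun L : ℝ => Real.log (Ch * L)) Filter.atTop Filter.atTop :=
    Real.tendsto_log_atTop.comp (Filter.tendsto_id.const_mul_atTop hCh)
  obtain ⟨L1, hL1⟩ := Filter.eventually_atTop.mp ((hlim.eventually (ge_mem_nhds hκ)).and
    ((hl2.eventually_ge_atTop 1).and (Filter.eventually_gt_atTop 0)))
  refine ⟨L1, ?_⟩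
  intro L hL Y p h hh he t
  obtain ⟨g1, g2, g3⟩ := hL1 L hL
  obtain ⟨s1, s2⟩ := hs A (Ch * L) (by linarith) g2 p Y
  set u := Real.log (Ch * L) with hu
  have e : Real.exp (-u) = 1 / (Ch * L) := by
    rw [Real.exp_neg, hu, Real.exp_log (by positivity), one_div]
  have := hK L Y h _ _ g3 hh ((Finset.sum_le_sum he).trans s1)
    ((Finset.sum_le_sum (fun q hq => mul_le_mul_of_nonneg_right (he q hq) (Real.log_natCast_nonneg q))).trans s2) t
  refine this.trans ?_
  refine mul_le_mul_of_nonneg_right ?_ (norm_nonneg _)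
  refine le_trans ?_ g1
  have hSu : 1 ≤ S * u := by nlinarith
  have hlog : Real.log (S * u) ≤ S * u := by
    have := Real.log_le_sub_one_of_pos (show 0 < S * u by linarith); linarith
  have hlog0 : 0 ≤ Real.log (S * u) := Real.log_nonneg hSu
  have hexp : Real.exp (C * (A * (S + 1 + 6 * Real.log (S * u)))) ≤ Real.exp (C * A * (S+1)) * (S*u)^n := by
    have : (S*u)^n = Real.exp (Real.log (S * u) * n) := by
      rw [← Real.rpow_natCast, Real.rpow_def_of_pos (by linarith)]
    rw [this, ← Real.exp_add]
    apply Real.exp_le_exp.mpr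
    nlinarith
  have hB2 : A * (S + 1 + u * (6 * Real.log (S * u))) ≤ A * ((S + 1 + 6 * S) * u^2) := by
    gcongr
    have : u * (6 * Real.log (S * u)) ≤ u * (6 * (S * u)) := by gcongr
    have h3 : S + 1 ≤ (S+1) * u^2 := le_mul_of_one_le_right (by linarith) (one_le_pow₀ g2)
    nlinarith
  calc C * (A * (S + 1 + u * (6 * Real.log (S * u)))) / L * Real.exp (C * (A * (S + 1 + 6 * Real.log (S * u))))
      ≤ C * (A * ((S + 1 + 6 * S) * u^2)) / L * (Real.exp (C * A * (S+1)) * (S*u)^n) := by gcongr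
    _ = _ := by rw [e]; field_simp; ring
end GPY
end

section
namespace GPY

lemma log_fact_eq (n : ℕ) : Real.log (n.factorial : ℝ) = ∑ p ∈ Nat.primesBelow (n+1), (n.factorial.factorization p : ℝ) * Real.log p := by
  rw [Real.log_nat_eq_sum_factorization, Finsupp.sum]
  refine Finset.sum_subset ?_ ?_
  · intro p hp
    rw [Nat.support_factorization, Nat.mem_primeFactors] at hp
    rw [Nat.mem_primesBelow]
    exact ⟨Nat.lt_succ_of_le ((hp.1.dvd_factorial).mp hp.2.1), hp.1⟩
  · intro p _ hp
    rw [Finsupp.notMem_support_iff.mp hp]; simp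

lemma log_fact_bounds (n : ℕ) (hn : 1 ≤ n) : n * Real.log n - n ≤ Real.log (n.factorial : ℝ) ∧ Real.log (n.factorial : ℝ) ≤ n * Real.log n := by
  have hn' : (0:ℝ) < n := by exact_mod_cast hn
  have hf : (0:ℝ) < n.factorial := by exact_mod_cast n.factorial_pos
  constructor
  · have := Real.pow_div_factorial_le_exp (x := n) hn'.le n
    have h2 := Real.log_le_log (by positivity) this
    rw [Real.log_div (by positivity) (by positivity), Real.log_pow, Real.log_exp] at h2
    linarith
  · have : (n.factorial : ℝ) ≤ (n:ℝ)^n := by exact_mod_cast Nat.factorial_le_pow n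
    have h2 := Real.log_le_log hf this
    rwa [Real.log_pow] at h2

lemma fact_val_le (n p : ℕ) (hp : p.Prime) : (n.factorial.factorization p : ℝ) ≤ n / (p - 1) := by
  haveI := Fact.mk hp
  have h := sub_one_mul_padicValNat_factorial (p := p) n
  rw [← Nat.factorization_def _ hp] at h
  have h2 : (p - 1) * n.factorial.factorization p ≤ n := by omega
  have hp1 : (1:ℝ) < p := by exact_mod_cast hp.one_lt
  rw [le_div_iff₀ (by linarith)]
  have h3 : (((p - 1) * n.factorial.factorization p : ℕ) : ℝ) ≤ n := by exact_mod_cast h2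
  rw [Nat.cast_mul, Nat.cast_sub hp.one_lt.le] at h3
  push_cast at h3; linarith

lemma fact_val_ge (n p : ℕ) (hp : p.Prime) : (n:ℝ) / p - 1 ≤ (n.factorial.factorization p : ℝ) := by
  have h := Nat.factorization_factorial hp (n := n) (b := Nat.log p n + 2) (by omega)
  have h1 : n / p ≤ n.factorial.factorization p := by
    rw [h]
    have := Finset.single_le_sum (f := fun i => n / p^i) (s := Finset.Ico 1 (Nat.log p n + 2)) (fun i _ => Nat.zero_le _) (a := 1) (by simp)
    simpa using this
  have h2 : (n:ℝ)/p - 1 ≤ ((n/p : ℕ) : ℝ) := by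
    have := Nat.lt_floor_add_one ((n:ℝ)/p)
    rw [Nat.floor_div_eq_div] at this
    linarith
  have h3 : ((n/p:ℕ):ℝ) ≤ (n.factorial.factorization p : ℝ) := by exact_mod_cast h1
  linarith

noncomputable def mA (n : ℕ) : ℝ := ∑ p ∈ Nat.primesBelow (n+1), Real.log p / p

lemma mertens : ∃ C : ℝ, 1 ≤ C ∧ ∀ n : ℕ, 1 ≤ n → Real.log n - C ≤ mA n ∧ mA n ≤ Real.log n + C := by
  obtain ⟨S, hS, hs⟩ := sum_log_sq
  refine ⟨max (1 + 2 * S) (Real.log 4 + 1), le_max_of_le_left (by linarith), ?_⟩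
  intro n hn
  have hn' : (0:ℝ) < n := by exact_mod_cast hn
  obtain ⟨l1, l2⟩ := log_fact_bounds n hn
  rw [log_fact_eq] at l1 l2
  have s2 := (hs (Nat.primesBelow (n+1)) (fun q hq => (Nat.prime_of_mem_primesBelow hq).two_le)).2.1
  constructor
  · have : ∑ p ∈ Nat.primesBelow (n+1), (n.factorial.factorization p : ℝ) * Real.log p ≤ n * (mA n + 2 * S) := by
      calc _ ≤ ∑ p ∈ Nat.primesBelow (n+1), n * (Real.log p / p + 2 * (1/(p:ℝ)^2 * Real.log p)) := by
            apply Finset.sum_le_sum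
            intro p hp
            have hpp := Nat.prime_of_mem_primesBelow hp
            have h2 : (2:ℝ) ≤ p := by exact_mod_cast hpp.two_le
            have hl := Real.log_natCast_nonneg p
            have e : (1:ℝ)/(p-1) ≤ 1/p + 2 * (1/(p:ℝ)^2) := by
              have : (1:ℝ)/p + 2 * (1/(p:ℝ)^2) = (p+2)/p^2 := by field_simp
              rw [this, div_le_div_iff₀ (by linarith) (by positivity)]; nlinarith
            calc _ ≤ n / (p - 1) * Real.log p := by gcongr; exact fact_val_le n p hpp
              _ = n * ((1:ℝ)/(p-1) * Real.log p) := by ring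
              _ ≤ n * ((1/p + 2 * (1/(p:ℝ)^2)) * Real.log p) := by gcongr
              _ = _ := by ring
        _ = n * (mA n + 2 * ∑ p ∈ Nat.primesBelow (n+1), (1/(p:ℝ)^2 * Real.log p)) := by
            rw [← Finset.mul_sum, Finset.sum_add_distrib, ← Finset.mul_sum, mA]
        _ ≤ _ := by gcongr
    have h3 : n * (Real.log n - 1) ≤ n * (mA n + 2 * S) := by linarith
    have h4 := le_of_mul_le_mul_left h3 hn'
    have := le_max_left (1 + 2 * S) (Real.log 4 + 1)
    linarith
  · have hth : ∑ p ∈ Nat.primesBelow (n+1), Real.log p ≤ Real.log 4 * n := by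
      have := Chebyshev.theta_le_log4_mul_x (x := n) hn'.le
      rw [Chebyshev.theta_eq_sum_Icc, Nat.floor_natCast] at this
      refine le_trans (le_of_eq ?_) this
      apply Finset.sum_congr _ (fun _ _ => rfl)
      ext p; simp [Nat.mem_primesBelow, Nat.lt_succ_iff]
    have : n * mA n - ∑ p ∈ Nat.primesBelow (n+1), Real.log p ≤ ∑ p ∈ Nat.primesBelow (n+1), (n.factorial.factorization p : ℝ) * Real.log p := by
      rw [mA, Finset.mul_sum, ← Finset.sum_sub_distrib]
      apply Finset.sum_le_sum
      intro p hp
      have hpp := Nat.prime_of_mem_primesBelow hp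
      have hl := Real.log_natCast_nonneg p
      calc _ = (n / p - 1) * Real.log p := by ring
        _ ≤ _ := by gcongr; exact fact_val_ge n p hpp
    have h3 : n * mA n ≤ n * (Real.log n + Real.log 4) := by linarith
    have h4 := le_of_mul_le_mul_left h3 hn'
    have := le_max_right (1 + 2 * S) (Real.log 4 + 1)
    linarith

lemma sum_log2 : ∃ C : ℝ, 1 ≤ C ∧ ∀ x : ℝ, 1 ≤ x → 
    ∑ p ∈ Nat.primesBelow (⌊x⌋₊+1), Real.log p^2 / p ≤ 3/4 * Real.log x^2 + C * Real.log x := by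
  obtain ⟨C, hC, h⟩ := mertens
  refine ⟨2 * C + 1, by linarith, ?_⟩
  intro x hx
  set n := ⌊x⌋₊ with hn
  set m := ⌊√x⌋₊ with hm
  have hsx : 1 ≤ √x := Real.one_le_sqrt.mpr hx
  have hn1 : 1 ≤ n := Nat.le_floor (by simpa using hx)
  have hm1 : 1 ≤ m := Nat.le_floor (by simpa using hsx)
  have hsx' : √x ≤ x := by
    rw [Real.sqrt_le_left (by linarith)]; nlinarith
  have hmn : m ≤ n := Nat.floor_le_floor hsx'
  have hlx : 0 ≤ Real.log x := Real.log_nonneg hx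
  have hnx : (n:ℝ) ≤ x := Nat.floor_le (by linarith)
  have hmx : (m:ℝ) ≤ √x := Nat.floor_le (by linarith)
  have a1 := (h n hn1).2
  have a2 := (h m hm1).1
  have b1 : Real.log n ≤ Real.log x := Real.log_le_log (by exact_mod_cast hn1) hnx
  have b2 : Real.log x / 2 - Real.log 2 ≤ Real.log m := by
    have : √x / 2 ≤ m := by
      have := Nat.lt_floor_add_one (√x)
      have h3 : (1:ℝ) ≤ m := by exact_mod_cast hm1
      rw [← hm] at this; linarith
    have h3 := Real.log_le_log (by positivity) this
    rw [Real.log_div (by positivity) (by norm_num), Real.log_sqrt (by linarith)] at h3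
    exact h3
  have hsub : Nat.primesBelow (m+1) ⊆ Nat.primesBelow (n+1) := Nat.primesBelow_mono (by omega)
  have key : ∑ p ∈ Nat.primesBelow (n+1), Real.log p^2 / p ≤ Real.log x * (mA n - mA m) + Real.log x / 2 * mA m := by
    rw [mA, mA, ← Finset.sum_sdiff hsub, ← Finset.sum_sdiff hsub (f := fun p : ℕ => Real.log p / p), add_sub_cancel_right]
    rw [Finset.mul_sum, Finset.mul_sum]
    refine add_le_add (Finset.sum_le_sum ?_) (Finset.sum_le_sum ?_)
    · intro p hp
      rw [Finset.mem_sdiff, Nat.mem_primesBelow] at hp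
      have hp0 : (0:ℝ) < p := by exact_mod_cast hp.1.2.pos
      have hl := Real.log_natCast_nonneg p
      have : Real.log p ≤ Real.log x := Real.log_le_log hp0 (le_trans (by exact_mod_cast (by omega : p ≤ n)) hnx)
      calc _ = Real.log p * (Real.log p / p) := by ring
        _ ≤ _ := by gcongr
    · intro p hp
      rw [Nat.mem_primesBelow] at hp
      have hp0 : (0:ℝ) < p := by exact_mod_cast hp.2.pos
      have hl := Real.log_natCast_nonneg p
      have : Real.log p ≤ Real.log x / 2 := by
        rw [← Real.log_sqrt (by linarith)]
        exact Real.log_le_log hp0 (le_trans (by exact_mod_cast (by omega : p ≤ m)) hmx)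
      calc _ = Real.log p * (Real.log p / p) := by ring
        _ ≤ _ := by gcongr
  have hl2 : Real.log 2 ≤ 1 := by have := Real.log_two_lt_d9; linarith
  have c1 : Real.log x * mA n ≤ Real.log x * (Real.log x + C) := by gcongr; linarith
  have c2 : Real.log x / 2 * (Real.log x / 2 - 1 - C) ≤ Real.log x / 2 * mA m := by gcongr; linarith
  nlinarith
end GPY
end

section
namespace GPY

noncomputable def gg (H : Finset ℕ) (q : ℕ) : ℝ := (nuP q H : ℝ) / q
noncomputable def hh (H : Finset ℕ) (q : ℕ) : ℝ := (nuP q H : ℝ) / ((q:ℝ) - nuP q H)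

lemma nuP_le (H : Finset ℕ) (q : ℕ) : nuP q H ≤ H.card := Finset.card_image_le
lemma nuP_pos {H : Finset ℕ} (hk : 1 ≤ H.card) (q : ℕ) : 1 ≤ nuP q H := by
  unfold nuP
  rw [Nat.succ_le_iff, Finset.card_pos]
  exact (Finset.card_pos.mp hk).image _
lemma nuP_eq {H : Finset ℕ} {q : ℕ} (h : ∀ a ∈ H, a < q) : nuP q H = H.card := by
  unfold nuP
  apply Finset.card_image_of_injOn
  intro a ha b hb hab
  simp only at hab
  rwa [Nat.mod_eq_of_lt (h a ha), Nat.mod_eq_of_lt (h b hb)] at hab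

lemma gg_lt {H : Finset ℕ} (hA : Admissible H) {q : ℕ} (hq : q.Prime) : 0 ≤ gg H q ∧ gg H q < 1 ∧ 1/(q:ℝ) ≤ 1 - gg H q := by
  have h := hA q hq
  have hq0 : (0:ℝ) < q := by exact_mod_cast hq.pos
  have h' : (nuP q H : ℝ) + 1 ≤ q := by exact_mod_cast h
  have e : 1 / (q:ℝ) ≤ 1 - gg H q := by
    unfold gg
    rw [le_sub_iff_add_le, ← add_div, div_le_one hq0]; linarith
  have : 0 < 1/(q:ℝ) := by positivity
  exact ⟨by unfold gg; positivity, by linarith, e⟩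

lemma gg_eq {H : Finset ℕ} (hA : Admissible H) {q : ℕ} (hq : q.Prime) : gg H q = (1 - gg H q) * hh H q := by
  have h := hA q hq
  have hq0 : (0:ℝ) < q := by exact_mod_cast hq.pos
  have h' : (nuP q H : ℝ) + 1 ≤ q := by exact_mod_cast h
  have : (q:ℝ) - nuP q H ≠ 0 := by linarith
  unfold gg hh
  field_simp

lemma hh_nonneg {H : Finset ℕ} (hA : Admissible H) {q : ℕ} (hq : q.Prime) : 0 ≤ hh H q := by
  have h := hA q hq
  have h' : (nuP q H : ℝ) + 1 ≤ q := by exact_mod_cast h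
  unfold hh
  exact div_nonneg (by positivity) (by linarith)

lemma hh_le {H : Finset ℕ} (hk : 1 ≤ H.card) (hA : Admissible H) {q : ℕ} (hq : q.Prime) : hh H q ≤ 2 * (H.card:ℝ)^2 / q := by
  have h := hA q hq
  have hq0 : (0:ℝ) < q := by exact_mod_cast hq.pos
  have h' : (nuP q H : ℝ) + 1 ≤ q := by exact_mod_cast h
  have hn : (nuP q H : ℝ) ≤ H.card := by exact_mod_cast nuP_le H q
  have hk' : (1:ℝ) ≤ H.card := by exact_mod_cast hk
  have hn0 : (0:ℝ) ≤ nuP q H := by positivity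
  set k : ℝ := (H.card : ℝ)
  unfold hh
  rw [div_le_div_iff₀ (by linarith) hq0]
  by_cases hc : (q:ℝ) ≤ 2 * k
  · calc (nuP q H : ℝ) * q ≤ k * (2 * k) := by gcongr
      _ = 2 * k^2 * 1 := by ring
      _ ≤ _ := by gcongr; linarith
  · push Not at hc
    have : (q:ℝ)/2 ≤ q - nuP q H := by linarith
    calc (nuP q H : ℝ) * q ≤ k * q := by gcongr
      _ ≤ k^2 * q := by gcongr; nlinarith
      _ = 2 * k^2 * (q/2) := by ring
      _ ≤ _ := by gcongr

lemma hh_sub {H : Finset ℕ} (hk : 1 ≤ H.card) (hA : Admissible H) {q : ℕ} (hq : q.Prime) (w : ℝ) (hw : ∀ a ∈ H, (a:ℝ) ≤ w) (p : ℕ) :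
    |hh H q - H.card/q| + 1/(q:ℝ)^2 ≤ esh (4 * (H.card:ℝ)^3 + 1) w p q ∧ 
    |(if q = p then 0 else hh H q) - H.card/q| + 1/(q:ℝ)^2 ≤ esh (4 * (H.card:ℝ)^3 + 1) w p q := by
  have h0 := hh_nonneg hA hq
  have h1 := hh_le hk hA hq
  have h := hA q hq
  have hq0 : (0:ℝ) < q := by exact_mod_cast hq.pos
  have h' : (nuP q H : ℝ) + 1 ≤ q := by exact_mod_cast h
  have hk' : (1:ℝ) ≤ H.card := by exact_mod_cast hk
  have hne : q ≤ w ∨ hh H q = H.card/((q:ℝ) - H.card) := by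
    by_cases hc : q ≤ w
    · exact Or.inl hc
    · right
      push Not at hc
      have : nuP q H = H.card := nuP_eq (fun a ha => by exact_mod_cast (hw a ha).trans_lt hc)
      unfold hh; rw [this]
  have hkq : H.card / (q:ℝ) ≤ 2 * (H.card:ℝ)^2 / q := by gcongr; nlinarith
  have hn : (w < q) → (nuP q H : ℝ) = H.card := fun hc => by
    have : nuP q H = H.card := nuP_eq (fun a ha => by exact_mod_cast (hw a ha).trans_lt hc)
    rw [this]
  set k : ℝ := (H.card : ℝ)
  have hkq0 : 0 ≤ k / q := by positivity
  have hA1 : 2 * k^2 / q ≤ (4 * k^3+1) * (1/(q:ℝ)) := by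
    rw [mul_one_div]; gcongr; nlinarith [sq_nonneg k, mul_nonneg (sq_nonneg k) (by linarith : 0 ≤ k - 1)]
  have hpos : 0 ≤ (4 * k^3+1) * (1/(q:ℝ)) := by positivity
  have hpos2 : 0 ≤ 4 * k^3 * (1/(q:ℝ)^2) := by positivity
  have key : |hh H q - k/q| ≤ 4 * k^3 * (1/(q:ℝ)^2) + (if (q:ℝ) ≤ w then (4 * k^3+1) * (1/(q:ℝ)) else 0) := by
    split_ifs with hc
    · rw [abs_le]; constructor <;> linarith
    · push Not at hc
      have hh1 := hne.resolve_left (by linarith)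
      have hn' := hn hc
      rw [add_zero]
      by_cases hc2 : (q:ℝ) ≤ 2 * k
      · have : 2 * k^2 / q ≤ 4 * k^3 * (1/(q:ℝ)^2) := by
          rw [mul_one_div, div_le_div_iff₀ hq0 (by positivity)]
          calc 2 * k^2 * (q:ℝ)^2 = 2 * k^2 * q * q := by ring
            _ ≤ 2 * k^2 * (2 * k) * q := by gcongr
            _ = _ := by ring
        rw [abs_le]; constructor <;> linarith
      · push Not at hc2
        have e : hh H q - k/q = k^2 / (q * (q - k)) := by
          rw [hh1]
          have : (q:ℝ) - k ≠ 0 := by linarith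
          field_simp; ring
        rw [e, abs_of_nonneg (div_nonneg (by positivity) (mul_nonneg hq0.le (by linarith))), mul_one_div,
          div_le_div_iff₀ (mul_pos hq0 (by linarith)) (by positivity)]
        calc k^2 * (q:ℝ)^2 = k^2 * 2 * (q * (q/2)) := by ring
          _ ≤ k^2 * (4 * k) * (q * (q - k)) := by gcongr <;> linarith
          _ = _ := by ring
  have hite : 0 ≤ (if (q:ℝ) ≤ w then (4 * k^3+1) * (1/(q:ℝ)) else 0) := by split_ifs <;> linarith
  have hA' : |hh H q - k/q| + 1/(q:ℝ)^2 ≤ esh (4 * k^3 + 1) w p q := by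
    unfold esh
    have : 0 ≤ (if q = p then (4 * k^3+1) * (1/(q:ℝ)) else 0) := by split_ifs <;> linarith
    linarith
  refine ⟨hA', ?_⟩
  by_cases hp : q = p
  · rw [if_pos hp, zero_sub, abs_neg, abs_of_nonneg hkq0]
    unfold esh
    rw [if_pos hp]
    linarith
  · rw [if_neg hp]; exact hA'

noncomputable def SY (H : Finset ℕ) (Y : ℕ) : ℝ := (∏ q ∈ Nat.primesBelow Y, (1 - gg H q)) * (∏ q ∈ Nat.primesBelow Y, (1 - 1/(q:ℝ))⁻¹)^H.card

lemma SY_lower (k : ℕ) : ∃ c : ℝ, 0 < c ∧ ∀ H : Finset ℕ, H.card = k → Admissible H → ∀ Y, c ≤ SY H Y := by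
  obtain ⟨S, hS, hs⟩ := sum_log_sq
  refine ⟨(∏ q ∈ Nat.primesBelow (2*k^2+1), 1/(q:ℝ)) * Real.exp (-(2 * k^2 * S)), ?_, ?_⟩
  · apply mul_pos _ (Real.exp_pos _)
    apply Finset.prod_pos
    intro q hq
    have : (0:ℝ) < q := by exact_mod_cast (Nat.prime_of_mem_primesBelow hq).pos
    positivity
  intro H hHk hA Y
  set m : ℕ → ℝ := fun q => if q ≤ 2 * k^2 then 1/(q:ℝ) else 1 with hm
  have hm1 : ∏ q ∈ Nat.primesBelow (2*k^2+1), 1/(q:ℝ) ≤ ∏ q ∈ Nat.primesBelow Y, m q := by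
    rw [hm, ← Finset.prod_filter]
    apply Finset.prod_le_prod_of_subset_of_le_one
    · intro q hq
      rw [Finset.mem_filter, Nat.mem_primesBelow] at hq
      rw [Nat.mem_primesBelow]
      exact ⟨by omega, hq.1.2⟩
    · intro q hq; positivity
    · intro q hq _
      have : (1:ℝ) ≤ q := by exact_mod_cast (Nat.prime_of_mem_primesBelow hq).one_lt.le
      rw [div_le_one (by linarith)]; exact this
  have he : Real.exp (-(2 * k^2 * S)) ≤ ∏ q ∈ Nat.primesBelow Y, Real.exp (-(2 * k^2 * (1/(q:ℝ)^2))) := by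
    rw [← Real.exp_sum, Finset.sum_neg_distrib, ← Finset.mul_sum]
    apply Real.exp_le_exp.mpr
    have := (hs (Nat.primesBelow Y) (fun q hq => (Nat.prime_of_mem_primesBelow hq).two_le)).1
    have : 2 * (k:ℝ)^2 * ∑ q ∈ Nat.primesBelow Y, 1/(q:ℝ)^2 ≤ 2 * k^2 * S := by gcongr
    linarith
  calc _ ≤ (∏ q ∈ Nat.primesBelow Y, m q) * ∏ q ∈ Nat.primesBelow Y, Real.exp (-(2 * k^2 * (1/(q:ℝ)^2))) := by
        apply mul_le_mul hm1 he (Real.exp_pos _).le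
        apply Finset.prod_nonneg
        intro q _; simp only [hm]; split_ifs <;> positivity
    _ ≤ SY H Y := by
        unfold SY
        rw [← Finset.prod_pow, ← Finset.prod_mul_distrib, ← Finset.prod_mul_distrib]
        apply Finset.prod_le_prod
        · intro q _
          refine mul_nonneg ?_ (Real.exp_pos _).le
          simp only [hm]; split_ifs <;> positivity
        intro q hq
        have hqp := Nat.prime_of_mem_primesBelow hq
        obtain ⟨g0, g1, g2⟩ := gg_lt hA hqp
        have hq2 : (2:ℝ) ≤ q := by exact_mod_cast hqp.two_le
        have hinv : 1 + 1/(q:ℝ) ≤ (1 - 1/(q:ℝ))⁻¹ := by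
          have : 1/(q:ℝ) ≤ 1/2 := by gcongr
          have h0 : 0 < 1/(q:ℝ) := by positivity
          rw [le_inv_comm₀ (by linarith) (by linarith), inv_eq_one_div, le_div_iff₀ (by linarith)]
          nlinarith
        have hpow : 1 + k * (1/(q:ℝ)) ≤ ((1 - 1/(q:ℝ))⁻¹)^H.card := by
          rw [hHk]
          refine le_trans (one_add_mul_le_pow ?_ k) (pow_le_pow_left₀ (by positivity) hinv k)
          have : 0 < 1/(q:ℝ) := by positivity
          linarith
        have hexp1 : Real.exp (-(2 * k^2 * (1/(q:ℝ)^2))) ≤ 1 := by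
          rw [Real.exp_le_one_iff]
          have : 0 ≤ 2 * (k:ℝ)^2 * (1/(q:ℝ)^2) := by positivity
          linarith
        simp only [hm]
        split_ifs with hc
        · apply mul_le_mul g2 (hexp1.trans (le_trans ?_ hpow)) (Real.exp_pos _).le (by linarith)
          have : 0 ≤ k * (1/(q:ℝ)) := by positivity
          linarith
        · rw [one_mul]
          push Not at hc
          have hc' : 2 * (k:ℝ)^2 < q := by exact_mod_cast hc
          have hgk : gg H q ≤ k * (1/(q:ℝ)) := by
            unfold gg
            rw [mul_one_div]
            gcongr
            rw [← hHk]; exact nuP_le H q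
          set x := 1/(q:ℝ) with hx
          have hx0 : 0 < x := by positivity
          have hy : (k:ℝ)^2 * x^2 ≤ 1/2 := by
            rw [hx, one_div, inv_pow, mul_inv_le_iff₀ (by positivity)]; nlinarith
          have hkx : k * x ≤ 1 := by nlinarith [show 0 ≤ k * x by positivity]
          have hlog : Real.exp (-(2 * (k^2 * x^2))) ≤ 1 - k^2 * x^2 := by
            set y := (k:ℝ)^2 * x^2
            have hy0 : 0 ≤ y := by positivity
            rw [← Real.le_log_iff_exp_le (by linarith)]
            have := Real.one_sub_inv_le_log_of_pos (show 0 < 1 - y by linarith)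
            refine le_trans ?_ this
            have : 1 - (1-y)⁻¹ = - (y / (1-y)) := by
              have : 1 - y ≠ 0 := by linarith
              field_simp; ring
            rw [this, neg_le_neg_iff, div_le_iff₀ (by linarith)]; nlinarith
          calc _ = Real.exp (-(2 * (k^2 * x^2))) := by rw [hx]; congr 1; ring
            _ ≤ 1 - k^2 * x^2 := hlog
            _ = (1 - k * x) * (1 + k * x) := by ring
            _ ≤ _ := by
              apply mul_le_mul _ hpow (by positivity) (by linarith)
              linarith
end GPY
end

section
namespace GPY
open MeasureTheory

lemma alg_sum (P : Finset ℕ) (F : ℕ → Bool → Bool → ℂ) :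
    ∑ D1 ∈ P.powerset, ∑ D2 ∈ P.powerset, ∏ q ∈ P, F q (decide (q ∈ D1)) (decide (q ∈ D2)) =
    ∏ q ∈ P, (F q false false + F q true false + F q false true + F q true true) := by
  induction P using Finset.induction_on with
  | empty => simp
  | insert a P ha ih =>
    rw [Finset.prod_insert ha, ← ih]
    have key : ∀ D1 ∈ P.powerset, ∀ D2 ∈ P.powerset,
        (∏ q ∈ insert a P, F q (decide (q ∈ D1)) (decide (q ∈ D2)) = F a false false * ∏ q ∈ P, F q (decide (q ∈ D1)) (decide (q ∈ D2))) ∧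
        (∏ q ∈ insert a P, F q (decide (q ∈ insert a D1)) (decide (q ∈ D2)) = F a true false * ∏ q ∈ P, F q (decide (q ∈ D1)) (decide (q ∈ D2))) ∧
        (∏ q ∈ insert a P, F q (decide (q ∈ D1)) (decide (q ∈ insert a D2)) = F a false true * ∏ q ∈ P, F q (decide (q ∈ D1)) (decide (q ∈ D2))) ∧
        (∏ q ∈ insert a P, F q (decide (q ∈ insert a D1)) (decide (q ∈ insert a D2)) = F a true true * ∏ q ∈ P, F q (decide (q ∈ D1)) (decide (q ∈ D2))) := by
      intro D1 h1 D2 h2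
      rw [Finset.mem_powerset] at h1 h2
      have a1 : a ∉ D1 := fun h => ha (h1 h)
      have a2 : a ∉ D2 := fun h => ha (h2 h)
      have hne : ∀ q ∈ P, q ≠ a := fun q hq h => ha (h ▸ hq)
      refine ⟨?_, ?_, ?_, ?_⟩ <;> rw [Finset.prod_insert ha] <;> congr 1 <;> first
        | simp [a1, a2]; done
        | (apply Finset.prod_congr rfl; intro q hq; simp [hne q hq])
    rw [Finset.sum_powerset_insert ha, ← Finset.sum_add_distrib, Finset.mul_sum]
    apply Finset.sum_congr rfl
    intro D1 h1
    rw [Finset.sum_powerset_insert ha, Finset.sum_powerset_insert ha, ← Finset.sum_add_distrib, ← Finset.sum_add_distrib, ← Finset.sum_add_distrib, Finset.mul_sum]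
    apply Finset.sum_congr rfl
    intro D2 h2
    obtain ⟨e1, e2, e3, e4⟩ := key D1 h1 D2 h2
    rw [e1, e2, e3, e4]; ring

lemma alg_main (P E : Finset ℕ) (hE : E ⊆ P) (a b g : ℕ → ℂ) :
    ∑ D1 ∈ P.powerset, ∑ D2 ∈ P.powerset, (∏ q ∈ D1, (-a q)) * (∏ q ∈ D2, (-b q)) * ∏ q ∈ D1 ∪ D2 ∪ E, g q =
    ∏ q ∈ P, (if q ∈ E then g q * ((1 - a q) * (1 - b q)) else 1 - g q * (a q + b q - a q * b q)) := by
  have h := alg_sum P (fun q b1 b2 => (if b1 then -a q else 1) * (if b2 then -b q else 1) * (if b1 ∨ b2 ∨ q ∈ E then g q else 1))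
  refine Eq.trans ?_ (h.trans ?_)
  rotate_left 1
  · apply Finset.prod_congr rfl
    intro q _
    by_cases hq : q ∈ E
    · simp [hq]; ring
    · simp [hq]; ring
  apply Finset.sum_congr rfl
  intro D1 h1
  apply Finset.sum_congr rfl
  intro D2 h2
  rw [Finset.mem_powerset] at h1 h2
  rw [Finset.prod_mul_distrib, Finset.prod_mul_distrib]
  have aux : ∀ (D : Finset ℕ) (hD : D ⊆ P) (f : ℕ → ℂ), ∏ q ∈ P, (if q ∈ D then f q else 1) = ∏ q ∈ D, f q := by
    intro D hD f
    rw [← Finset.prod_filter, Finset.filter_mem_eq_inter, Finset.inter_eq_right.mpr hD]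
  rw [← aux D1 h1 (fun q => -a q), ← aux D2 h2 (fun q => -b q), ← aux (D1 ∪ D2 ∪ E) (Finset.union_subset (Finset.union_subset h1 h2) hE) g]
  simp [or_assoc]

noncomputable def sD (L : ℝ) (D : Finset ℕ) : ℝ := ∑ q ∈ D, Real.log q / L
noncomputable def cD (m : ℕ) (L : ℝ) (D : Finset ℕ) : ℝ := (-1)^D.card * phi m (1 - sD L D)

noncomputable def QQ (g : ℕ → ℝ) (m : ℕ) (L : ℝ) (P E : Finset ℕ) : ℝ :=
  ∑ D1 ∈ P.powerset, ∑ D2 ∈ P.powerset, cD m L D1 * cD m L D2 * ∏ q ∈ D1 ∪ D2 ∪ E, g q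

lemma exp_sD (L : ℝ) (D : Finset ℕ) (t : ℝ) : Complex.exp (-(sD L D : ℂ) * zt t) = ∏ q ∈ D, qs L q t := by
  unfold sD qs
  rw [← Complex.exp_sum]
  congr 1
  rw [← Finset.sum_mul, Finset.sum_neg_distrib]; push_cast; rfl

lemma QQ_integral (g : ℕ → ℝ) (m : ℕ) (hm : 1 ≤ m) (L : ℝ) (P E : Finset ℕ) (hE : E ⊆ P) :
    (QQ g m L P E : ℂ) = ∫ p : ℝ × ℝ, wt m p.1 * wt m p.2 *
      ∏ q ∈ P, (if q ∈ E then g q * ((1 - qs L q p.1) * (1 - qs L q p.2)) else 1 - g q * (qs L q p.1 + qs L q p.2 - qs L q p.1 * qs L q p.2)) := by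
  have hF : ∀ p : ℝ × ℝ, wt m p.1 * wt m p.2 *
      ∏ q ∈ P, (if q ∈ E then (g q : ℂ) * ((1 - qs L q p.1) * (1 - qs L q p.2)) else 1 - g q * (qs L q p.1 + qs L q p.2 - qs L q p.1 * qs L q p.2))
      = ∑ D1 ∈ P.powerset, ∑ D2 ∈ P.powerset, (((-1:ℂ)^D1.card * (-1)^D2.card) * ∏ q ∈ D1 ∪ D2 ∪ E, (g q : ℂ)) *
        ((Complex.exp (-(sD L D1 : ℂ) * zt p.1) * wt m p.1) * (Complex.exp (-(sD L D2 : ℂ) * zt p.2) * wt m p.2)) := by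
    intro p
    rw [← alg_main P E hE (fun q => qs L q p.1) (fun q => qs L q p.2) (fun q => (g q : ℂ)), Finset.mul_sum]
    apply Finset.sum_congr rfl
    intro D1 _
    rw [Finset.mul_sum]
    apply Finset.sum_congr rfl
    intro D2 _
    rw [exp_sD, exp_sD, Finset.prod_neg, Finset.prod_neg]; ring
  simp_rw [hF]
  have hintg : ∀ D1 D2, Integrable (fun p : ℝ × ℝ => (((-1:ℂ)^D1.card * (-1)^D2.card) * ∏ q ∈ D1 ∪ D2 ∪ E, (g q : ℂ)) *
        ((Complex.exp (-(sD L D1 : ℂ) * zt p.1) * wt m p.1) * (Complex.exp (-(sD L D2 : ℂ) * zt p.2) * wt m p.2))) := by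
    intro D1 D2
    refine Integrable.const_mul ?_ _
    exact (integrable_exp_wt m hm _).mul_prod (integrable_exp_wt m hm _)
  rw [integral_finsetSum _ (fun D1 _ => integrable_finsetSum _ (fun D2 _ => hintg D1 D2))]
  unfold QQ
  push_cast
  apply Finset.sum_congr rfl
  intro D1 _
  rw [integral_finsetSum _ (fun D2 _ => hintg D1 D2)]
  apply Finset.sum_congr rfl
  intro D2 _
  rw [integral_const_mul]
  have := integral_prod_mul (μ := (volume : Measure ℝ)) (ν := (volume : Measure ℝ)) (fun t => Complex.exp (-(sD L D1 : ℂ) * zt t) * wt m t) (fun t => Complex.exp (-(sD L D2 : ℂ) * zt t) * wt m t)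
  rw [← perron m hm, ← perron m hm] at this
  rw [Measure.volume_eq_prod, this]
  unfold cD
  push_cast
  ring
end GPY
end

section
namespace GPY
open MeasureTheory

lemma wt_Minf (k l : ℕ) (p : ℝ × ℝ) : wt (k+l) p.1 * wt (k+l) p.2 * Minf k p = wt l p.1 * wt l p.2 * (1 / (zt p.1 + zt p.2)^k) := by
  unfold wt Minf
  have h1 := zt_ne p.1
  have h2 := zt_ne p.2
  have : (Real.pi : ℂ) ≠ 0 := by exact_mod_cast Real.pi_ne_zero
  have h3 : zt p.1 + zt p.2 ≠ 0 := by
    intro h; have := norm_zz p; rw [h] at this; norm_num at this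
  rw [div_pow, mul_pow, add_assoc k l 1, pow_add, pow_add]
  field_simp
  ring

lemma int_wtZ (k l : ℕ) (hl : 3 ≤ l) (Z : ℝ × ℝ → ℂ) (hZ : Continuous Z) (B : ℝ) (hB : 0 ≤ B) (hb : ∀ p, ‖Z p‖ ≤ B * (‖zt p.1‖ * ‖zt p.2‖)^k) :
    Integrable (fun p : ℝ × ℝ => wt (k+l) p.1 * wt (k+l) p.2 * Z p) ∧
    Integrable (fun p : ℝ × ℝ => ‖Z p‖ * (‖zt p.1‖ * ‖zt p.2‖ * (‖wt (k+l) p.1‖ * ‖wt (k+l) p.2‖))) := by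
  have hw : ∀ p : ℝ × ℝ, ‖zt p.1‖ * ‖zt p.2‖ * (‖wt (k+l) p.1‖ * ‖wt (k+l) p.2‖) ≤ om k l p := by
    intro p
    unfold om
    gcongr
    exact le_self_pow₀ (one_le_zt _) (by norm_num)
  have hbound : ∀ p : ℝ × ℝ, ‖Z p‖ * (‖zt p.1‖ * ‖zt p.2‖ * (‖wt (k+l) p.1‖ * ‖wt (k+l) p.2‖)) ≤ B * rho l p := by
    intro p
    have h0 := om_nonneg k l p
    calc _ ≤ (B * (‖zt p.1‖ * ‖zt p.2‖)^k) * om k l p := by gcongr; exact hb p; exact hw p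
      _ = B * ((‖zt p.1‖ * ‖zt p.2‖)^k * om k l p) := by ring
      _ ≤ _ := by gcongr; exact om_le k l hl p
  constructor
  · refine Integrable.mono' ((integrable_rho l hl).const_mul B) (Continuous.aestronglyMeasurable (by fun_prop)) (Filter.Eventually.of_forall fun p => ?_)
    refine le_trans ?_ (hbound p)
    rw [norm_mul, norm_mul]
    have h1 := one_le_zt p.1
    have h2 := one_le_zt p.2
    calc ‖wt (k+l) p.1‖ * ‖wt (k+l) p.2‖ * ‖Z p‖ = ‖Z p‖ * (‖wt (k+l) p.1‖ * ‖wt (k+l) p.2‖) := by ring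
      _ ≤ _ := mul_le_mul_of_nonneg_left (le_mul_of_one_le_left (by positivity) (by nlinarith)) (norm_nonneg _)
  · refine Integrable.mono' ((integrable_rho l hl).const_mul B) (Continuous.aestronglyMeasurable (by fun_prop)) (Filter.Eventually.of_forall fun p => ?_)
    rw [Real.norm_of_nonneg (by positivity)]
    exact hbound p

lemma compare (k l : ℕ) (hl : 3 ≤ l) (U X : ℝ × ℝ → ℂ) (hU : Continuous U) (hX : Continuous X) (B η ε : ℝ) (hB : 0 ≤ B)
    (hU4 : ∀ p, ‖U p‖ ≤ 4) (hUe : ∀ p, ‖U p‖ ≤ η * (‖zt p.1‖ * ‖zt p.2‖)) (hXB : ∀ p, ‖X p‖ ≤ B) (hη : 0 ≤ η)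
    (hAL : ∫ p : ℝ × ℝ, ‖X p - Minf k p‖ * (‖zt p.1‖ * ‖zt p.2‖ * (‖wt (k+l) p.1‖ * ‖wt (k+l) p.2‖)) ≤ ε) :
    ‖(∫ p : ℝ × ℝ, wt (k+l) p.1 * wt (k+l) p.2 * (U p * X p)) - ∫ p : ℝ × ℝ, wt (k+l) p.1 * wt (k+l) p.2 * (U p * Minf k p)‖ ≤ η * ε := by
  have hone : ∀ p : ℝ × ℝ, 1 ≤ (‖zt p.1‖ * ‖zt p.2‖)^k := by
    intro p
    have h1 := one_le_zt p.1
    have h2 := one_le_zt p.2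
    exact one_le_pow₀ (by nlinarith)
  have hM := continuous_Minf k
  have i1 := (int_wtZ k l hl (fun p => U p * X p) (by fun_prop) (4 * B) (by positivity) (fun p => by
    rw [norm_mul]
    calc _ ≤ 4 * B := by gcongr; exact hU4 p; exact hXB p
      _ ≤ _ := le_mul_of_one_le_right (by positivity) (hone p))).1
  have i2 := (int_wtZ k l hl (fun p => U p * Minf k p) (by fun_prop) 4 (by positivity) (fun p => by
    rw [norm_mul]
    gcongr
    · exact hU4 p
    · exact norm_Minf_le k p)).1
  have i3 := (int_wtZ k l hl (fun p => X p - Minf k p) (by fun_prop) (B+1) (by positivity) (fun p => by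
    refine (norm_sub_le _ _).trans ?_
    have h1 := hXB p
    have h2 := norm_Minf_le k p
    have h3 := hone p
    nlinarith)).2
  rw [← integral_sub i1 i2]
  refine (norm_integral_le_integral_norm _).trans ?_
  calc _ ≤ ∫ p : ℝ × ℝ, η * (‖X p - Minf k p‖ * (‖zt p.1‖ * ‖zt p.2‖ * (‖wt (k+l) p.1‖ * ‖wt (k+l) p.2‖))) := by
        refine integral_mono_of_nonneg (Filter.Eventually.of_forall fun p => norm_nonneg _) (i3.const_mul η) (Filter.Eventually.of_forall fun p => ?_)
        simp only
        rw [← mul_sub, ← mul_sub, norm_mul, norm_mul, norm_mul]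
        calc _ ≤ ‖wt (k+l) p.1‖ * ‖wt (k+l) p.2‖ * (η * (‖zt p.1‖ * ‖zt p.2‖) * ‖X p - Minf k p‖) := by gcongr; exact hUe p
          _ = _ := by ring
    _ ≤ _ := by rw [integral_const_mul]; gcongr

/-- h with the value at p removed -/
noncomputable def hp' (H : Finset ℕ) (p q : ℕ) : ℝ := if q = p then 0 else hh H q

noncomputable def XX (k : ℕ) (L : ℝ) (Y : ℕ) (h : ℕ → ℝ) (p : ℝ × ℝ) : ℂ := MY k L Y p * KK k L Y h p

lemma cc_ne (k : ℕ) {L : ℝ} (hL : 0 < L) (Y : ℕ) : (∏ q ∈ Nat.primesBelow Y, (1 - 1 / (q:ℂ))⁻¹)^k * ((L:ℂ)^k)⁻¹ ≠ 0 := by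
  have hLc : (L:ℂ) ≠ 0 := by exact_mod_cast hL.ne'
  refine mul_ne_zero (pow_ne_zero _ (Finset.prod_ne_zero_iff.mpr ?_)) (inv_ne_zero (pow_ne_zero _ hLc))
  intro q hq
  have h2 := (Nat.prime_of_mem_primesBelow hq).two_le
  refine inv_ne_zero ?_
  have hq0 : (q:ℂ) ≠ 0 := by exact_mod_cast (show q ≠ 0 by omega)
  have hq1 : (q:ℂ) ≠ 1 := by exact_mod_cast (show q ≠ 1 by omega)
  rw [sub_ne_zero]
  intro h
  rw [eq_div_iff hq0] at h
  exact hq1 (by simpa using h)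

lemma XX_cont (k : ℕ) {L : ℝ} (hL : 0 < L) (Y : ℕ) (h : ℕ → ℝ) :
    Continuous (XX k L Y h) ∧ ∃ B, 0 ≤ B ∧ ∀ p, ‖XX k L Y h p‖ ≤ B := by
  have hne := cc_ne k hL Y
  set c := (∏ q ∈ Nat.primesBelow Y, (1 - 1 / (q:ℂ))⁻¹)^k * ((L:ℂ)^k)⁻¹ with hc
  have e : XX k L Y h = fun p : ℝ × ℝ => c⁻¹ * ∏ q ∈ Nat.primesBelow Y, (1 + h q * uu (qs L q p.1) (qs L q p.2)) := by
    funext p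
    rw [euler_factorization k hL Y h p, ← hc, XX]
    field_simp
  constructor
  · rw [e]; unfold uu; fun_prop
  · refine ⟨‖c⁻¹‖ * ∏ q ∈ Nat.primesBelow Y, (1 + |h q| * 4), mul_nonneg (norm_nonneg _) (Finset.prod_nonneg fun q _ => by positivity), ?_⟩
    intro p
    rw [e]
    simp only
    rw [norm_mul, norm_prod]
    gcongr with q hq
    refine (norm_add_le _ _).trans ?_
    rw [norm_one, norm_mul, Complex.norm_real, Real.norm_eq_abs]
    gcongr
    exact (norm_uu_le (norm_qs_le hL p.1) (norm_qs_le hL p.2)).2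

lemma QQ_empty (H : Finset ℕ) (hA : Admissible H) (l : ℕ) (hl : 1 ≤ l) {L : ℝ} (hL : 0 < L) (Y : ℕ) :
    (QQ (gg H) (H.card+l) L (Nat.primesBelow Y) ∅ : ℂ) = ((SY H Y * (L^H.card)⁻¹ : ℝ) : ℂ) *
      ∫ p : ℝ × ℝ, wt (H.card+l) p.1 * wt (H.card+l) p.2 * XX H.card L Y (hh H) p := by
  rw [QQ_integral _ _ (by omega) _ _ _ (Finset.empty_subset _), ← integral_const_mul]
  congr 1
  funext p
  have e : ∏ q ∈ Nat.primesBelow Y, (if q ∈ (∅ : Finset ℕ) then (gg H q : ℂ) * ((1 - qs L q p.1) * (1 - qs L q p.2)) else 1 - gg H q * (qs L q p.1 + qs L q p.2 - qs L q p.1 * qs L q p.2))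
      = (∏ q ∈ Nat.primesBelow Y, (1 - (gg H q : ℂ))) * ∏ q ∈ Nat.primesBelow Y, (1 + hh H q * uu (qs L q p.1) (qs L q p.2)) := by
    rw [← Finset.prod_mul_distrib]
    apply Finset.prod_congr rfl
    intro q hq
    have hg : (gg H q : ℂ) = (1 - gg H q) * hh H q := by exact_mod_cast gg_eq hA (Nat.prime_of_mem_primesBelow hq)
    simp only [Finset.notMem_empty, if_false]
    unfold uu
    linear_combination ((1 - qs L q p.1) * (1 - qs L q p.2)) * hg
  rw [e, euler_factorization H.card hL Y, XX, SY]
  push_cast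
  ring

lemma QQ_p (H : Finset ℕ) (hA : Admissible H) (l : ℕ) (hl : 1 ≤ l) {L : ℝ} (hL : 0 < L) (Y r : ℕ) (hr : r ∈ Nat.primesBelow Y) :
    (QQ (gg H) (H.card+l) L (Nat.primesBelow Y) {r} : ℂ) = ((hh H r * (SY H Y * (L^H.card)⁻¹) : ℝ) : ℂ) *
      ∫ p : ℝ × ℝ, wt (H.card+l) p.1 * wt (H.card+l) p.2 * (uu (qs L r p.1) (qs L r p.2) * XX H.card L Y (hp' H r) p) := by
  rw [QQ_integral _ _ (by omega) _ _ _ (Finset.singleton_subset_iff.mpr hr), ← integral_const_mul]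
  congr 1
  funext p
  have e : ∏ q ∈ Nat.primesBelow Y, (if q ∈ ({r} : Finset ℕ) then (gg H q : ℂ) * ((1 - qs L q p.1) * (1 - qs L q p.2)) else 1 - gg H q * (qs L q p.1 + qs L q p.2 - qs L q p.1 * qs L q p.2))
      = (∏ q ∈ Nat.primesBelow Y, (1 - (gg H q : ℂ))) * (∏ q ∈ Nat.primesBelow Y, (1 + hp' H r q * uu (qs L q p.1) (qs L q p.2))) * 
        ((hh H r) * uu (qs L r p.1) (qs L r p.2)) := by
    have e2 : ((hh H r : ℂ) * uu (qs L r p.1) (qs L r p.2)) = ∏ q ∈ Nat.primesBelow Y, (if q = r then (hh H q : ℂ) * uu (qs L q p.1) (qs L q p.2) else 1) := by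
      rw [Finset.prod_ite_eq' (Nat.primesBelow Y) r (fun q => (hh H q : ℂ) * uu (qs L q p.1) (qs L q p.2)), if_pos hr]
    rw [e2, ← Finset.prod_mul_distrib, ← Finset.prod_mul_distrib]
    apply Finset.prod_congr rfl
    intro q hq
    have hg : (gg H q : ℂ) = (1 - gg H q) * hh H q := by exact_mod_cast gg_eq hA (Nat.prime_of_mem_primesBelow hq)
    simp only [Finset.mem_singleton]
    unfold uu hp'
    split_ifs with hqr
    · push_cast
      linear_combination ((1 - qs L q p.1) * (1 - qs L q p.2)) * hg
    · linear_combination ((1 - qs L q p.1) * (1 - qs L q p.2)) * hg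
  rw [e, euler_factorization H.card hL Y, XX, SY]
  push_cast
  ring

lemma SY_pos {H : Finset ℕ} (hA : Admissible H) (Y : ℕ) : 0 < SY H Y := by
  obtain ⟨c, hc, h⟩ := SY_lower H.card
  exact hc.trans_le (h H rfl hA Y)

lemma main_terms (k l : ℕ) (hk : 1 ≤ k) (hl : 3 ≤ l) (Ch ε : ℝ) (hCh : 0 < Ch) (hε : 0 < ε) : ∃ L2 : ℝ, 2 ≤ L2 ∧ ∀ L, L2 ≤ L → ∃ Y0 : ℕ, ∀ Y, Y0 ≤ Y →
    ∀ H : Finset ℕ, H.card = k → Admissible H → (∀ a ∈ H, (a:ℝ) ≤ Ch * L) →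
    (SY H Y * (L^k)⁻¹) * (I0 k l - ε) ≤ QQ (gg H) (k+l) L (Nat.primesBelow Y) ∅ ∧
    ∀ r ∈ Nat.primesBelow Y, QQ (gg H) (k+l) L (Nat.primesBelow Y) {r} ≤
      hh H r * (SY H Y * (L^k)⁻¹) * ((Real.log r / L)^2 * (I0 k (l-1) + ε)) := by
  obtain ⟨κ, hκ, L0, hL0, hAL⟩ := AL k l hl ε hε
  have hA1 : (0:ℝ) ≤ 4 * (k:ℝ)^3 := by positivity
  obtain ⟨L1, hKK⟩ := KK_small k (4 * (k:ℝ)^3 + 1) Ch κ (by linarith) hCh hκ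
  refine ⟨max L0 L1, hL0.trans (le_max_left _ _), ?_⟩
  intro L hL
  obtain ⟨Y0, hY0⟩ := hAL L ((le_max_left _ _).trans hL)
  have hL1 := hKK L ((le_max_right _ _).trans hL)
  have hL2 : 0 < L := by have := (le_max_left L0 L1).trans hL; linarith
  refine ⟨Y0, ?_⟩
  intro Y hY H hHk hA hw
  subst hHk
  have hS := SY_pos hA Y
  have hk' : (1:ℝ) ≤ H.card := by exact_mod_cast hk
  have hup : ∀ q ∈ Nat.primesBelow Y, hh H q ≤ (4 * (H.card:ℝ)^3 + 1) / q := by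
    intro q hq
    refine (hh_le hk hA (Nat.prime_of_mem_primesBelow hq)).trans ?_
    gcongr
    nlinarith [sq_nonneg (H.card:ℝ), mul_nonneg (sq_nonneg (H.card:ℝ)) (by linarith : (0:ℝ) ≤ H.card - 1)]
  have hc0 : 0 ≤ SY H Y * (L^H.card)⁻¹ := by positivity
  constructor
  · have hK := hL1 Y 0 (hh H) (fun q hq => ⟨hh_nonneg hA (Nat.prime_of_mem_primesBelow hq), hup q hq⟩)
      (fun q hq => (hh_sub hk hA (Nat.prime_of_mem_primesBelow hq) _ hw 0).1)
    have h1 := hY0 Y hY _ hK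
    obtain ⟨hXc, B, hB, hXB⟩ := XX_cont H.card hL2 Y (hh H)
    have h2 := compare H.card l hl (fun _ => 1) (XX H.card L Y (hh H)) continuous_const hXc B 1 ε hB (by simp) (fun p => by
      have h1 := one_le_zt p.1
      have h2 := one_le_zt p.2
      simp only [norm_one]; nlinarith) hXB (by norm_num) h1
    have h3 := QQ_empty H hA l (by omega) hL2 Y
    simp only [one_mul] at h2
    simp_rw [wt_Minf] at h2
    rw [main0 H.card l hk (by omega)] at h2
    set J := ∫ p : ℝ × ℝ, wt (H.card+l) p.1 * wt (H.card+l) p.2 * XX H.card L Y (hh H) p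
    have h4 := congrArg Complex.re h3
    rw [Complex.ofReal_re, Complex.re_ofReal_mul] at h4
    rw [h4]
    have h5 := (Complex.abs_re_le_norm _).trans h2
    rw [Complex.sub_re, Complex.ofReal_re, abs_le] at h5
    gcongr
    linarith [h5.1]
  · intro r hr
    have hK := hL1 Y r (hp' H r) (fun q hq => by
      have := hh_nonneg hA (Nat.prime_of_mem_primesBelow hq)
      have h2 := hup q hq
      unfold hp'
      split_ifs
      · exact ⟨le_rfl, by positivity⟩
      · exact ⟨this, h2⟩)
      (fun q hq => (hh_sub hk hA (Nat.prime_of_mem_primesBelow hq) _ hw r).2)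
    have h1 := hY0 Y hY _ hK
    obtain ⟨hXc, B, hB, hXB⟩ := XX_cont H.card hL2 Y (hp' H r)
    have hη : 0 ≤ Real.log r / L := div_nonneg (Real.log_natCast_nonneg r) hL2.le
    have h2 := compare H.card l hl (fun p => uu (qs L r p.1) (qs L r p.2)) (XX H.card L Y (hp' H r)) (by unfold uu; fun_prop) hXc B ((Real.log r / L)^2) ε hB
      (fun p => (norm_uu_le (norm_qs_le hL2 p.1) (norm_qs_le hL2 p.2)).2) (fun p => by
        unfold uu
        rw [norm_mul]
        calc _ ≤ (Real.log r / L * ‖zt p.1‖) * (Real.log r / L * ‖zt p.2‖) := by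
              gcongr
              · exact norm_one_sub_qs hL2 r p.1
              · exact norm_one_sub_qs hL2 r p.2
          _ = _ := by ring) hXB (by positivity) h1
    have h3 := QQ_p H hA l (by omega) hL2 Y r hr
    obtain ⟨ρ, hρ, hm⟩ := main1 H.card l hk (by omega) (Real.log r / L) hη
    have e : ∫ p : ℝ × ℝ, wt (H.card+l) p.1 * wt (H.card+l) p.2 * (uu (qs L r p.1) (qs L r p.2) * Minf H.card p) = (ρ : ℂ) := by
      rw [← hm]
      congr 1
      funext p
      have := wt_Minf H.card l p
      have e3 : wt (H.card+l) p.1 * wt (H.card+l) p.2 * (uu (qs L r p.1) (qs L r p.2) * Minf H.card p) = 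
        uu (qs L r p.1) (qs L r p.2) * (wt (H.card+l) p.1 * wt (H.card+l) p.2 * Minf H.card p) := by ring
      rw [e3, this]
      unfold uu qs
      ring
    rw [e] at h2
    set J := ∫ p : ℝ × ℝ, wt (H.card+l) p.1 * wt (H.card+l) p.2 * (uu (qs L r p.1) (qs L r p.2) * XX H.card L Y (hp' H r) p)
    have h4 := congrArg Complex.re h3
    rw [Complex.ofReal_re, Complex.re_ofReal_mul] at h4
    rw [h4]
    have h5 := (Complex.abs_re_le_norm _).trans h2
    rw [Complex.sub_re, Complex.ofReal_re, abs_le] at h5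
    have := hh_nonneg hA (Nat.prime_of_mem_primesBelow hr)
    gcongr
    linarith [h5.2]
end GPY
end

section
namespace GPY

lemma residues1 (H : Finset ℕ) (q : ℕ) (hq : q.Prime) : ∃ S : Finset ℕ, S.card = nuP q H ∧ (∀ s ∈ S, s < q) ∧
    ∀ n, (q ∣ tuplePoly H n ↔ n % q ∈ S) := by
  have hq0 := hq.pos
  refine ⟨(H.image (· % q)).image (fun r => (q - r) % q), ?_, ?_, ?_⟩
  · unfold nuP
    apply Finset.card_image_of_injOn
    intro a ha b hb hab
    simp only [Finset.coe_image, Set.mem_image, Finset.mem_coe] at ha hb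
    obtain ⟨x, _, rfl⟩ := ha
    obtain ⟨y, _, rfl⟩ := hb
    simp only at hab ⊢
    have h1 := Nat.mod_lt x hq0
    have h2 := Nat.mod_lt y hq0
    generalize x % q = a at *
    generalize y % q = b at *
    rcases Nat.eq_zero_or_pos a with rfl | ha
    · rcases Nat.eq_zero_or_pos b with rfl | hb
      · rfl
      · rw [Nat.sub_zero, Nat.mod_self, Nat.mod_eq_of_lt (by omega)] at hab; omega
    · rcases Nat.eq_zero_or_pos b with rfl | hb
      · rw [Nat.sub_zero, Nat.mod_self, Nat.mod_eq_of_lt (by omega)] at hab; omega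
      · rw [Nat.mod_eq_of_lt (by omega), Nat.mod_eq_of_lt (by omega)] at hab; omega
  · intro s hs
    simp only [Finset.mem_image] at hs
    obtain ⟨a, _, rfl⟩ := hs
    exact Nat.mod_lt _ hq0
  · intro n
    unfold tuplePoly
    rw [Prime.dvd_finsetProd_iff hq.prime]
    simp only [Finset.mem_image, exists_exists_and_eq_and]
    refine exists_congr fun h => and_congr_right fun _ => ?_
    have h1 := Nat.mod_lt h hq0
    have h2 := Nat.mod_lt n hq0
    rw [Nat.dvd_iff_mod_eq_zero, Nat.add_mod]
    generalize h % q = a at *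
    generalize n % q = b at *
    rcases Nat.eq_zero_or_pos a with rfl | ha
    · rw [Nat.sub_zero, Nat.mod_self, Nat.add_zero, Nat.mod_eq_of_lt h2]; exact eq_comm
    · rw [Nat.mod_eq_of_lt (show q - a < q by omega)]
      constructor
      · intro h
        obtain ⟨c, hc⟩ := Nat.dvd_of_mod_eq_zero h
        have : c = 1 := by
          have c1 : c < 2 := by by_contra hh; have := Nat.mul_le_mul_left q (show 2 ≤ c by omega); omega
          have c2 : c ≠ 0 := by rintro rfl; omega
          omega
        subst this; omega
      · intro h
        have : b + a = q := by omega
        rw [this, Nat.mod_self]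

lemma residues (H U : Finset ℕ) (hU : ∀ q ∈ U, q.Prime) : ∃ S : Finset ℕ, S.card = ∏ q ∈ U, nuP q H ∧ (∀ s ∈ S, s < ∏ q ∈ U, q) ∧
    ∀ n, ((∀ q ∈ U, q ∣ tuplePoly H n) ↔ n % (∏ q ∈ U, q) ∈ S) := by
  induction U using Finset.induction_on with
  | empty => exact ⟨{0}, by simp, by simp, by intro n; simp [Nat.mod_one]⟩
  | insert q U hqU ih =>
    obtain ⟨S, hc, hlt, hS⟩ := ih (fun r hr => hU r (Finset.mem_insert_of_mem hr))
    have hq := hU q (Finset.mem_insert_self _ _)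
    obtain ⟨T, hTc, hTlt, hT⟩ := residues1 H q hq
    have hco : Nat.Coprime q (∏ r ∈ U, r) := by
      apply Nat.Coprime.prod_right
      intro r hr
      exact (Nat.coprime_primes hq (hU r (Finset.mem_insert_of_mem hr))).mpr (fun h => hqU (h ▸ hr))
    set M := ∏ r ∈ U, r with hM
    have hM0 : M ≠ 0 := by
      rw [hM]; exact Finset.prod_ne_zero_iff.mpr fun r hr => (hU r (Finset.mem_insert_of_mem hr)).ne_zero
    refine ⟨(T ×ˢ S).image (fun x => (Nat.chineseRemainder hco x.1 x.2 : ℕ)), ?_, ?_, ?_⟩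
    · rw [Finset.card_image_of_injOn, Finset.card_product, hc, hTc, Finset.prod_insert hqU]
      rintro ⟨a, b⟩ h1 ⟨c, d⟩ h2 h
      simp only [Finset.coe_product, Set.mem_prod, Finset.mem_coe] at h1 h2
      simp only at h
      have e1 := (Nat.chineseRemainder hco a b).2
      have e2 := (Nat.chineseRemainder hco c d).2
      rw [h] at e1
      have f1 : a ≡ c [MOD q] := e1.1.symm.trans e2.1
      have f2 : b ≡ d [MOD M] := e1.2.symm.trans e2.2
      rw [Nat.ModEq, Nat.mod_eq_of_lt (hTlt _ h1.1), Nat.mod_eq_of_lt (hTlt _ h2.1)] at f1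
      rw [Nat.ModEq, Nat.mod_eq_of_lt (hlt _ h1.2), Nat.mod_eq_of_lt (hlt _ h2.2)] at f2
      rw [f1, f2]
    · intro s hs
      obtain ⟨x, _, rfl⟩ := Finset.mem_image.mp hs
      rw [Finset.prod_insert hqU]
      exact Nat.chineseRemainder_lt_mul hco _ _ hq.ne_zero hM0
    · intro n
      rw [Finset.forall_mem_insert, hS, hT, Finset.prod_insert hqU, Finset.mem_image]
      constructor
      · rintro ⟨h1, h2⟩
        refine ⟨(n % q, n % M), Finset.mem_product.mpr ⟨h1, h2⟩, ?_⟩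
        have e1 := (Nat.chineseRemainder hco (n % q) (n % M)).2
        have e3 := Nat.chineseRemainder_lt_mul hco (n % q) (n % M) hq.ne_zero hM0
        have := (Nat.modEq_and_modEq_iff_modEq_mul hco).mp ⟨e1.1.trans (Nat.mod_modEq n q), e1.2.trans (Nat.mod_modEq n M)⟩
        rw [Nat.ModEq, Nat.mod_eq_of_lt e3] at this
        exact this
      · rintro ⟨⟨a, b⟩, hx, h⟩
        simp only [Finset.mem_product] at hx h
        have e1 := (Nat.chineseRemainder hco a b).2
        rw [h] at e1
        have f1 : n ≡ a [MOD q] := ((Nat.mod_modEq n (q*M)).of_mul_right M).symm.trans e1.1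
        have f2 : n ≡ b [MOD M] := ((Nat.mod_modEq n (q*M)).of_mul_left q).symm.trans e1.2
        rw [Nat.ModEq, Nat.mod_eq_of_lt (hTlt _ hx.1)] at f1
        rw [Nat.ModEq, Nat.mod_eq_of_lt (hlt _ hx.2)] at f2
        rw [f1, f2]
        exact hx

lemma count1 (N r v : ℕ) (hr : 0 < r) : |(((Finset.Ioc N (2*N)).filter (fun n => n ≡ v [MOD r])).card : ℝ) - (N:ℝ)/r| ≤ 1 := by
  have h := Nat.Ioc_filter_modEq_card N (2*N) hr v
  set c := ((Finset.Ioc N (2*N)).filter (fun n => n ≡ v [MOD r])).card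
  have hr' : (0:ℝ) < r := by exact_mod_cast hr
  have key : (((2*N:ℕ):ℚ) - v)/r = ((N:ℚ) - v)/r + N/r := by push_cast; ring
  rw [key] at h
  have hq0 : (0:ℚ) ≤ (N:ℚ)/r := by positivity
  set a : ℚ := ((N:ℚ) - v)/r
  have f1 := Int.floor_le (a + N/r)
  have f2 := Int.lt_floor_add_one (a + N/r)
  have f3 := Int.floor_le a
  have f4 := Int.lt_floor_add_one a
  have f5 : ⌊a⌋ ≤ ⌊a + N/r⌋ := Int.floor_le_floor (by linarith)
  rw [max_eq_left (by linarith)] at h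
  have h' : (c:ℚ) = ⌊a + N/r⌋ - ⌊a⌋ := by exact_mod_cast h
  have : |(c:ℚ) - N/r| ≤ 1 := by rw [abs_le]; constructor <;> linarith
  have h2 : ((|(c:ℚ) - N/r| : ℚ) : ℝ) ≤ 1 := by exact_mod_cast this
  push_cast at h2
  exact h2

lemma count_U (H U : Finset ℕ) (hU : ∀ q ∈ U, q.Prime) (N : ℕ) :
    |(((Finset.Ioc N (2*N)).filter (fun n => ∀ q ∈ U, q ∣ tuplePoly H n)).card : ℝ) - N * ∏ q ∈ U, gg H q| ≤ ∏ q ∈ U, (nuP q H : ℝ) := by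
  obtain ⟨S, hc, hlt, hS⟩ := residues H U hU
  set M := ∏ q ∈ U, q with hM
  have hM0 : 0 < M := by
    rw [hM]; exact Finset.prod_pos fun r hr => (hU r hr).pos
  have e : ((Finset.Ioc N (2*N)).filter (fun n => ∀ q ∈ U, q ∣ tuplePoly H n)).card = ∑ s ∈ S, ((Finset.Ioc N (2*N)).filter (fun n => n ≡ s [MOD M])).card := by
    rw [Finset.card_eq_sum_card_fiberwise (f := fun n => n % M) (t := S)]
    · apply Finset.sum_congr rfl
      intro s hs
      rw [Finset.filter_filter]
      congr 1
      apply Finset.filter_congr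
      intro n _
      rw [hS, Nat.ModEq, Nat.mod_eq_of_lt (hlt s hs)]
      constructor
      · exact fun h => h.2
      · intro h; exact ⟨h ▸ hs, h⟩
    · intro n hn
      simp only [Finset.coe_filter, Set.mem_ofPred_eq] at hn
      exact (hS n).mp hn.2
  have e2 : (N:ℝ) * ∏ q ∈ U, gg H q = ∑ s ∈ S, (N:ℝ)/M := by
    rw [Finset.sum_const, hc, nsmul_eq_mul]
    unfold gg
    rw [Finset.prod_div_distrib, hM]
    push_cast; ring
  rw [e, e2]
  push_cast
  rw [← Finset.sum_sub_distrib]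
  refine (Finset.abs_sum_le_sum_abs _ _).trans ?_
  calc _ ≤ ∑ s ∈ S, (1:ℝ) := Finset.sum_le_sum fun s _ => count1 N M s hM0
    _ = _ := by rw [Finset.sum_const, hc, nsmul_eq_mul]; push_cast; ring

open Classical in
noncomputable def TT (H : Finset ℕ) (m : ℕ) (L : ℝ) (P : Finset ℕ) (n : ℕ) : ℝ :=
  ∑ D ∈ P.powerset.filter (fun D => ∀ q ∈ D, q ∣ tuplePoly H n), cD m L D

lemma sum_TT (H : Finset ℕ) (m : ℕ) (L : ℝ) (P E : Finset ℕ) (hP : ∀ q ∈ P, q.Prime) (hE : E ⊆ P) (N : ℕ) :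
    |∑ n ∈ (Finset.Ioc N (2*N)).filter (fun n => ∀ q ∈ E, q ∣ tuplePoly H n), TT H m L P n ^ 2 - N * QQ (gg H) m L P E| ≤
    ∑ D1 ∈ P.powerset, ∑ D2 ∈ P.powerset, |cD m L D1| * |cD m L D2| * ∏ q ∈ D1 ∪ D2 ∪ E, (nuP q H : ℝ) := by
  have e : ∑ n ∈ (Finset.Ioc N (2*N)).filter (fun n => ∀ q ∈ E, q ∣ tuplePoly H n), TT H m L P n ^ 2 =
      ∑ D1 ∈ P.powerset, ∑ D2 ∈ P.powerset, cD m L D1 * cD m L D2 * ((Finset.Ioc N (2*N)).filter (fun n => ∀ q ∈ D1 ∪ D2 ∪ E, q ∣ tuplePoly H n)).card := by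
    classical
    have : ∀ n, (if ∀ q ∈ E, q ∣ tuplePoly H n then TT H m L P n ^ 2 else 0) = ∑ D1 ∈ P.powerset, ∑ D2 ∈ P.powerset, 
        if ∀ q ∈ D1 ∪ D2 ∪ E, q ∣ tuplePoly H n then cD m L D1 * cD m L D2 else 0 := by
      intro n
      split_ifs with h
      · rw [sq, TT, Finset.sum_filter, Finset.sum_mul_sum]
        apply Finset.sum_congr rfl; intro D1 _
        apply Finset.sum_congr rfl; intro D2 _
        have : (∀ q ∈ D1 ∪ D2 ∪ E, q ∣ tuplePoly H n) ↔ (∀ q ∈ D1, q ∣ tuplePoly H n) ∧ (∀ q ∈ D2, q ∣ tuplePoly H n) := by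
          simp only [Finset.forall_mem_union]
          tauto
        by_cases h1 : (∀ q ∈ D1, q ∣ tuplePoly H n) <;> by_cases h2 : (∀ q ∈ D2, q ∣ tuplePoly H n)
        · rw [if_pos h1, if_pos h2, if_pos (this.mpr ⟨h1, h2⟩)]
        · rw [if_neg h2, if_neg (fun h => h2 (this.mp h).2), mul_zero]
        · rw [if_neg h1, if_neg (fun h => h1 (this.mp h).1), zero_mul]
        · rw [if_neg h1, if_neg (fun h => h1 (this.mp h).1), zero_mul]
      · symm
        apply Finset.sum_eq_zero; intro D1 _
        apply Finset.sum_eq_zero; intro D2 _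
        rw [if_neg]
        intro h'
        exact h fun q hq => h' q (Finset.mem_union_right _ hq)
    rw [Finset.sum_filter, Finset.sum_congr rfl (fun n _ => this n), Finset.sum_comm]
    apply Finset.sum_congr rfl; intro D1 _
    rw [Finset.sum_comm]
    apply Finset.sum_congr rfl; intro D2 _
    rw [← Finset.sum_filter, Finset.sum_const, nsmul_eq_mul, mul_comm]
  rw [e, QQ, Finset.mul_sum, ← Finset.sum_sub_distrib]
  refine (Finset.abs_sum_le_sum_abs _ _).trans (Finset.sum_le_sum fun D1 h1 => ?_)
  rw [Finset.mul_sum, ← Finset.sum_sub_distrib]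
  refine (Finset.abs_sum_le_sum_abs _ _).trans (Finset.sum_le_sum fun D2 h2 => ?_)
  rw [Finset.mem_powerset] at h1 h2
  have := count_U H (D1 ∪ D2 ∪ E) (fun q hq => hP q (Finset.union_subset (Finset.union_subset h1 h2) hE hq)) N
  calc _ = |cD m L D1| * |cD m L D2| * |(((Finset.Ioc N (2*N)).filter (fun n => ∀ q ∈ D1 ∪ D2 ∪ E, q ∣ tuplePoly H n)).card : ℝ) - N * ∏ q ∈ D1 ∪ D2 ∪ E, gg H q| := by
        rw [← abs_mul, ← abs_mul]; congr 1; ring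
    _ ≤ _ := by gcongr

end GPY
end

section
namespace GPY

lemma abs_cD (m : ℕ) (L : ℝ) (D : Finset ℕ) : |cD m L D| = phi m (1 - sD L D) := by
  unfold cD
  rw [abs_mul, abs_pow, abs_neg, abs_one, one_pow, one_mul, abs_of_nonneg (phi_nonneg _ _)]

lemma sD_nonneg {L : ℝ} (hL : 0 < L) (D : Finset ℕ) : 0 ≤ sD L D := by
  unfold sD
  exact Finset.sum_nonneg fun q _ => div_nonneg (Real.log_natCast_nonneg q) hL.le

lemma abs_cD_le (m : ℕ) (hm : 1 ≤ m) {L : ℝ} (hL : 0 < L) (D : Finset ℕ) (hD : ∀ q ∈ D, q.Prime) :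
    |cD m L D| ≤ Real.exp (L + 1) * ∏ q ∈ D, (q:ℝ)^(-(1 + 1/L)) := by
  rw [abs_cD]
  have e : ∏ q ∈ D, (q:ℝ)^(-(1 + 1/L)) = Real.exp (-((L+1) * sD L D)) := by
    unfold sD
    rw [Finset.mul_sum, ← Finset.sum_neg_distrib, Real.exp_sum]
    apply Finset.prod_congr rfl
    intro q hq
    have : (0:ℝ) < q := by exact_mod_cast (hD q hq).pos
    rw [Real.rpow_def_of_pos this]
    congr 1
    field_simp
  rw [e, ← Real.exp_add]
  have h0 := sD_nonneg hL D
  unfold phi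
  rcases le_or_gt (sD L D) 1 with h | h
  · rw [max_eq_left (by linarith)]
    calc (1 - sD L D)^m / m.factorial ≤ 1 / 1 := by
          gcongr
          · exact pow_le_one₀ (by linarith) (by linarith)
          · exact_mod_cast m.factorial_pos
      _ ≤ _ := by
        rw [div_one]
        apply Real.one_le_exp
        nlinarith
  · rw [max_eq_right (by linarith), zero_pow (by omega), zero_div]
    positivity

lemma err_bound : ∃ C : ℝ, 1 ≤ C ∧ ∀ (H : Finset ℕ) (m : ℕ) (L : ℝ) (Y : ℕ) (E : Finset ℕ), 1 ≤ H.card → 1 ≤ m → 1 ≤ L →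
    ∑ D1 ∈ (Nat.primesBelow Y).powerset, ∑ D2 ∈ (Nat.primesBelow Y).powerset, |cD m L D1| * |cD m L D2| * ∏ q ∈ D1 ∪ D2 ∪ E, (nuP q H : ℝ)
      ≤ (H.card:ℝ)^E.card * (Real.exp (L+1) * (C*L)^H.card)^2 := by
  obtain ⟨C, hC, hr⟩ := rankin
  refine ⟨C, hC, ?_⟩
  intro H m L Y E hk hm hL
  have hL0 : 0 < L := by linarith
  have hk1 : (1:ℝ) ≤ H.card := by exact_mod_cast hk
  set P := Nat.primesBelow Y
  have hnu : ∀ U : Finset ℕ, ∏ q ∈ U, (nuP q H : ℝ) ≤ (H.card:ℝ)^U.card := by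
    intro U
    rw [← Finset.prod_const]
    exact Finset.prod_le_prod (fun _ _ => by positivity) fun q _ => by exact_mod_cast nuP_le H q
  have hone : ∑ D ∈ P.powerset, |cD m L D| * (H.card:ℝ)^D.card ≤ Real.exp (L+1) * (C*L)^H.card := by
    calc _ ≤ ∑ D ∈ P.powerset, Real.exp (L+1) * ∏ q ∈ D, (H.card * (q:ℝ)^(-(1 + 1/L))) := by
          refine Finset.sum_le_sum fun D hD => ?_
          rw [Finset.mem_powerset] at hD
          have := abs_cD_le m hm hL0 D (fun q hq => Nat.prime_of_mem_primesBelow (hD hq))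
          rw [Finset.prod_mul_distrib, Finset.prod_const]
          calc _ ≤ (Real.exp (L + 1) * ∏ q ∈ D, (q:ℝ)^(-(1 + 1/L))) * (H.card:ℝ)^D.card := by gcongr
            _ = _ := by ring
      _ = Real.exp (L+1) * ∏ q ∈ P, (1 + H.card * (q:ℝ)^(-(1 + 1/L))) := by
          rw [← Finset.mul_sum, Finset.prod_one_add]
      _ ≤ Real.exp (L+1) * (∏ q ∈ P, (1 + (q:ℝ)^(-(1 + 1/L))))^H.card := by
          gcongr
          rw [← Finset.prod_pow]
          refine Finset.prod_le_prod (fun _ _ => by positivity) fun q _ => ?_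
          refine one_add_mul_le_pow ?_ _
          have : (0:ℝ) ≤ (q:ℝ)^(-(1 + 1/L)) := by positivity
          linarith
      _ ≤ _ := by
          gcongr
          refine (hr (1/L) (by positivity) (by rw [div_le_one hL0]; exact hL) Y).trans (le_of_eq ?_)
          field_simp
  calc _ ≤ ∑ D1 ∈ P.powerset, ∑ D2 ∈ P.powerset, (H.card:ℝ)^E.card * ((|cD m L D1| * (H.card:ℝ)^D1.card) * (|cD m L D2| * (H.card:ℝ)^D2.card)) := by
        refine Finset.sum_le_sum fun D1 _ => Finset.sum_le_sum fun D2 _ => ?_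
        calc _ ≤ |cD m L D1| * |cD m L D2| * (H.card:ℝ)^(D1.card + D2.card + E.card) := by
              gcongr
              refine (hnu _).trans ?_
              gcongr
              exact (Finset.card_union_le _ _).trans (by gcongr; exact Finset.card_union_le _ _)
          _ = _ := by rw [pow_add, pow_add]; ring
    _ = (H.card:ℝ)^E.card * (∑ D ∈ P.powerset, |cD m L D| * (H.card:ℝ)^D.card)^2 := by
        rw [sq, Finset.sum_mul_sum, Finset.mul_sum]
        apply Finset.sum_congr rfl; intro D1 _
        rw [Finset.mul_sum]
    _ ≤ _ := by
        gcongr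

lemma moeb_prod (D : Finset ℕ) (hD : ∀ q ∈ D, q.Prime) : ArithmeticFunction.moebius (∏ q ∈ D, q) = (-1)^D.card := by
  rw [ArithmeticFunction.isMultiplicative_moebius.map_prod_of_prime D hD, ← Finset.prod_const]
  exact Finset.prod_congr rfl fun q hq => ArithmeticFunction.moebius_apply_prime (hD q hq)

lemma Lam_eq (H : Finset ℕ) (l : ℕ) (hm : 1 ≤ H.card + l) (R : ℝ) (hR : 1 < R) (Y : ℕ) (hY : R < Y) (n : ℕ) (hn : 0 < n) :
    LambdaR R n H l = (Real.log R)^(H.card + l) * TT H (H.card + l) (Real.log R) (Nat.primesBelow Y) n := by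
  classical
  set m := H.card + l with hmdef
  have hL : 0 < Real.log R := Real.log_pos hR
  set L := Real.log R with hLdef
  have hP0 : tuplePoly H n ≠ 0 := by
    unfold tuplePoly
    exact Finset.prod_ne_zero_iff.mpr fun h _ => by omega
  have hmf : (m.factorial : ℝ) ≠ 0 := by exact_mod_cast m.factorial_ne_zero
  have hlog : ∀ D : Finset ℕ, (∀ q ∈ D, q.Prime) → Real.log (R / ((∏ q ∈ D, q : ℕ) : ℝ)) = L * (1 - sD L D) := by
    intro D hD
    rw [Nat.cast_prod, Real.log_div (by linarith) (Finset.prod_ne_zero_iff.mpr fun q hq => by exact_mod_cast (hD q hq).ne_zero),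
      Real.log_prod (fun q hq => by exact_mod_cast (hD q hq).ne_zero)]
    unfold sD
    rw [← Finset.sum_div, ← hLdef]
    field_simp
  have hle : ∀ D : Finset ℕ, (∀ q ∈ D, q.Prime) → (((∏ q ∈ D, q : ℕ) : ℝ) ≤ R ↔ sD L D ≤ 1) := by
    intro D hD
    have h0 : (0:ℝ) < ((∏ q ∈ D, q : ℕ) : ℝ) := by exact_mod_cast Finset.prod_pos fun q hq => (hD q hq).pos
    have h1 := hlog D hD
    rw [← one_le_div h0]
    constructor
    · intro h
      have := Real.log_nonneg h
      rw [h1] at this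
      have := nonneg_of_mul_nonneg_right this hL
      linarith
    · intro h
      have : 0 ≤ Real.log (R / ((∏ q ∈ D, q : ℕ) : ℝ)) := by rw [h1]; exact mul_nonneg hL.le (by linarith)
      by_contra hc
      push Not at hc
      have := Real.log_neg (by positivity) hc
      linarith
  have e1 : ∑ d ∈ (tuplePoly H n).divisors.filter (fun d : ℕ => (d : ℝ) ≤ R), (ArithmeticFunction.moebius d : ℝ) * (Real.log (R / d)) ^ m =
      ∑ d ∈ ((tuplePoly H n).divisors.filter (fun d : ℕ => (d : ℝ) ≤ R)).filter Squarefree, (ArithmeticFunction.moebius d : ℝ) * (Real.log (R / d)) ^ m := by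
    symm
    apply Finset.sum_filter_of_ne
    intro d _ h
    by_contra hs
    rw [ArithmeticFunction.moebius_eq_zero_of_not_squarefree hs] at h
    simp at h
  have e2 : TT H m L (Nat.primesBelow Y) n = ∑ D ∈ ((Nat.primesBelow Y).powerset.filter (fun D => ∀ q ∈ D, q ∣ tuplePoly H n)).filter (fun D => sD L D ≤ 1), cD m L D := by
    unfold TT
    symm
    apply Finset.sum_filter_of_ne
    intro D _ h
    by_contra hs
    apply h
    unfold cD phi
    rw [max_eq_right (by linarith), zero_pow (by omega)]
    simp
  unfold LambdaR
  rw [e1, e2, Finset.mul_sum, Finset.mul_sum]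
  symm
  refine Finset.sum_nbij' (fun D => ∏ q ∈ D, q) (fun d => d.primeFactors) ?_ ?_ ?_ ?_ ?_
  · intro D hD
    simp only [Finset.mem_filter, Finset.mem_powerset, Nat.mem_divisors] at hD ⊢
    have hp : ∀ q ∈ D, q.Prime := fun q hq => Nat.prime_of_mem_primesBelow (hD.1.1 hq)
    refine ⟨⟨⟨Finset.prod_primes_dvd _ (fun q hq => (hp q hq).prime) hD.1.2, hP0⟩, (hle D hp).mpr hD.2⟩, ?_⟩
    rw [← ArithmeticFunction.moebius_ne_zero_iff_squarefree, moeb_prod D hp]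
    simp
  · intro d hd
    simp only [Finset.mem_filter, Finset.mem_powerset, Nat.mem_divisors] at hd ⊢
    have hp : ∀ q ∈ d.primeFactors, q.Prime := fun q hq => Nat.prime_of_mem_primeFactors hq
    refine ⟨⟨?_, fun q hq => (Nat.dvd_of_mem_primeFactors hq).trans hd.1.1.1⟩, ?_⟩
    · intro q hq
      rw [Nat.mem_primesBelow]
      refine ⟨?_, hp q hq⟩
      have h1 : q ≤ d := Nat.le_of_mem_primeFactors hq
      have h2 : (q:ℝ) < Y := lt_of_le_of_lt ((Nat.cast_le.mpr h1).trans hd.1.2) hY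
      exact_mod_cast h2
    · rw [← hle _ hp, Nat.prod_primeFactors_of_squarefree hd.2]
      exact hd.1.2
  · intro D hD
    simp only [Finset.mem_filter, Finset.mem_powerset] at hD
    exact Nat.primeFactors_prod fun q hq => Nat.prime_of_mem_primesBelow (hD.1.1 hq)
  · intro d hd
    simp only [Finset.mem_filter] at hd
    exact Nat.prod_primeFactors_of_squarefree hd.2
  · intro D hD
    simp only [Finset.mem_filter, Finset.mem_powerset] at hD
    have hp : ∀ q ∈ D, q.Prime := fun q hq => Nat.prime_of_mem_primesBelow (hD.1.1 hq)
    rw [hlog D hp, moeb_prod D hp]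
    unfold cD phi
    rw [max_eq_left (by linarith [hD.2]), mul_pow]
    push_cast
    ring
end GPY
end

section
namespace GPY

lemma log_sq_le {w : ℝ} (hw : 1 ≤ w) : Real.log w ^ 2 ≤ 4 * w := by
  have h1 : Real.log (Real.sqrt w) ≤ Real.sqrt w - 1 := Real.log_le_sub_one_of_pos (Real.sqrt_pos.mpr (by linarith))
  rw [Real.log_sqrt (by linarith)] at h1
  have h2 := Real.log_nonneg hw
  have h3 := Real.sq_sqrt (show 0 ≤ w by linarith)
  nlinarith [Real.sqrt_nonneg w]

lemma hh_log_sum (k : ℕ) (hk : 1 ≤ k) (Ch δ η : ℝ) (hCh : 0 < Ch) (hδ : 0 < δ) (hη : 0 < η) : ∃ L3 : ℝ, 1 ≤ L3 ∧ ∀ L, L3 ≤ L →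
    ∀ H : Finset ℕ, H.card = k → Admissible H → (∀ a ∈ H, (a:ℝ) ≤ Ch * L) →
    ∑ r ∈ Nat.primesBelow (⌊Real.exp (δ * L)⌋₊ + 1), hh H r * Real.log r ^ 2 ≤ (3/4 * k * δ^2 + η) * L^2 := by
  obtain ⟨C, hC, hs⟩ := sum_log2
  obtain ⟨S, hS, hq2⟩ := sum_log_sq
  set A : ℝ := 4 * (k:ℝ)^3 + 1 with hA
  have hA0 : 0 ≤ A := by positivity
  set B : ℝ := k * C * δ + A * S + A * (3 * Ch + C * Ch) with hB
  have hB0 : 0 ≤ B := by positivity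
  refine ⟨max (max 1 (1/Ch)) (B/η), (le_max_left _ _).trans (le_max_left _ _), ?_⟩
  intro L hL H hHk hAd hw
  have hL1 : 1 ≤ L := ((le_max_left _ _).trans (le_max_left _ _)).trans hL
  have hL2 : 1/Ch ≤ L := ((le_max_right _ _).trans (le_max_left _ _)).trans hL
  have hL3 : B/η ≤ L := (le_max_right _ _).trans hL
  rw [div_le_iff₀ hη] at hL3
  have hw1 : 1 ≤ Ch * L := by rw [div_le_iff₀ hCh] at hL2; linarith
  set P := Nat.primesBelow (⌊Real.exp (δ * L)⌋₊ + 1) with hP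
  have hpr : ∀ q ∈ P, q.Prime := fun q hq => Nat.prime_of_mem_primesBelow hq
  have hpt : ∀ q ∈ P, hh H q * Real.log q ^ 2 ≤ k * (Real.log q ^ 2 / q) + A * (1/(q:ℝ)^2 * Real.log q ^ 2) +
      (if (q:ℝ) ≤ Ch * L then A * (Real.log q ^ 2 / q) else 0) := by
    intro q hq
    have hq' := hpr q hq
    have h1 := (hh_sub (by omega) hAd hq' _ hw 0).1
    have h2 : |hh H q - H.card / q| ≤ esh (4 * (H.card:ℝ)^3 + 1) (Ch*L) 0 q := by
      have : 0 ≤ 1/(q:ℝ)^2 := by positivity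
      linarith
    have h3 := (le_abs_self _).trans h2
    rw [hHk, ← hA] at h3
    unfold esh at h3
    rw [if_neg hq'.ne_zero, add_zero] at h3
    have h4 : hh H q ≤ k/q + (A * (1/(q:ℝ)^2) + (if (q:ℝ) ≤ Ch * L then A * (1/(q:ℝ)) else 0)) := by linarith
    calc _ ≤ (k/q + (A * (1/(q:ℝ)^2) + (if (q:ℝ) ≤ Ch * L then A * (1/(q:ℝ)) else 0))) * Real.log q ^ 2 := by gcongr
      _ = _ := by split_ifs <;> ring
  have s1 := hs (Real.exp (δ * L)) (Real.one_le_exp (by positivity))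
  rw [Real.log_exp, ← hP] at s1
  have s2 := (hq2 P (fun q hq => (hpr q hq).two_le)).2.2
  have s3 : ∑ q ∈ P, (if (q:ℝ) ≤ Ch * L then A * (Real.log q ^ 2 / q) else 0) ≤ A * (3/4 * Real.log (Ch*L)^2 + C * Real.log (Ch*L)) := by
    rw [← Finset.sum_filter, ← Finset.mul_sum]
    gcongr
    refine le_trans ?_ (hs (Ch * L) hw1)
    refine Finset.sum_le_sum_of_subset_of_nonneg ?_ (fun q _ _ => by positivity)
    intro q hq
    rw [Finset.mem_filter] at hq
    rw [Nat.mem_primesBelow]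
    exact ⟨Nat.lt_succ_of_le (Nat.le_floor hq.2), hpr q hq.1⟩
  have t1 := log_sq_le hw1
  have t2 : Real.log (Ch * L) ≤ Ch * L := (Real.log_le_sub_one_of_pos (by linarith)).trans (by linarith)
  calc _ ≤ ∑ q ∈ P, (k * (Real.log q ^ 2 / q) + A * (1/(q:ℝ)^2 * Real.log q ^ 2) +
      (if (q:ℝ) ≤ Ch * L then A * (Real.log q ^ 2 / q) else 0)) := Finset.sum_le_sum hpt
    _ ≤ k * (3/4 * (δ*L)^2 + C * (δ*L)) + A * S + A * (3/4 * Real.log (Ch*L)^2 + C * Real.log (Ch*L)) := by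
      rw [Finset.sum_add_distrib, Finset.sum_add_distrib, ← Finset.mul_sum, ← Finset.mul_sum]
      gcongr
    _ ≤ k * (3/4 * (δ*L)^2 + C * (δ*L)) + A * (S * L) + A * (3/4 * (4*(Ch*L)) + C * (Ch*L)) := by
      gcongr
      exact le_mul_of_one_le_right (by positivity) hL1
    _ = 3/4*k*δ^2*L^2 + B * L := by rw [hB]; ring
    _ ≤ 3/4*k*δ^2*L^2 + (L * η) * L := by gcongr
    _ = _ := by ring

lemma total_lower (H : Finset ℕ) (l : ℕ) (hk : 1 ≤ H.card) (C : ℝ)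
    (hC : ∀ (H : Finset ℕ) (m : ℕ) (L : ℝ) (Y : ℕ) (E : Finset ℕ), 1 ≤ H.card → 1 ≤ m → 1 ≤ L →
    ∑ D1 ∈ (Nat.primesBelow Y).powerset, ∑ D2 ∈ (Nat.primesBelow Y).powerset, |cD m L D1| * |cD m L D2| * ∏ q ∈ D1 ∪ D2 ∪ E, (nuP q H : ℝ)
      ≤ (H.card:ℝ)^E.card * (Real.exp (L+1) * (C*L)^H.card)^2)
    (L : ℝ) (hL : 1 ≤ L) (Y : ℕ) (hY : Real.exp L < Y) (N : ℕ) :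
    L^(2*(H.card + l)) * (N * QQ (gg H) (H.card+l) L (Nat.primesBelow Y) ∅ - (Real.exp (L+1) * (C*L)^H.card)^2)
      ≤ ∑ n ∈ Finset.Ioc N (2*N), (LambdaR (Real.exp L) n H l) ^ 2 ∧
    ∀ r ∈ Nat.primesBelow Y, ∑ n ∈ (Finset.Ioc N (2*N)).filter (fun n => r ∣ tuplePoly H n), (LambdaR (Real.exp L) n H l) ^ 2 ≤
      L^(2*(H.card + l)) * (N * QQ (gg H) (H.card+l) L (Nat.primesBelow Y) {r} + H.card * (Real.exp (L+1) * (C*L)^H.card)^2) := by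
  have hlam : ∀ n ∈ Finset.Ioc N (2*N), (LambdaR (Real.exp L) n H l) ^ 2 = L^(2*(H.card + l)) * TT H (H.card + l) L (Nat.primesBelow Y) n ^ 2 := by
    intro n hn
    rw [Finset.mem_Ioc] at hn
    rw [Lam_eq H l (by omega) (Real.exp L) (Real.one_lt_exp_iff.mpr (by linarith)) Y hY n (by omega), Real.log_exp]
    ring
  have hpr : ∀ q ∈ Nat.primesBelow Y, q.Prime := fun q hq => Nat.prime_of_mem_primesBelow hq
  constructor
  · have h1 := sum_TT H (H.card+l) L (Nat.primesBelow Y) ∅ hpr (Finset.empty_subset _) N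
    have h2 := h1.trans (hC H (H.card+l) L Y ∅ hk (by omega) hL)
    rw [Finset.sum_congr rfl hlam, ← Finset.mul_sum]
    gcongr
    simp only [Finset.notMem_empty, false_imp_iff, implies_true, Finset.filter_true, Finset.card_empty, pow_zero, one_mul] at h2
    rw [abs_le] at h2
    linarith [h2.1]
  · intro r hr
    have h1 := sum_TT H (H.card+l) L (Nat.primesBelow Y) {r} hpr (Finset.singleton_subset_iff.mpr hr) N
    have h2 := h1.trans (hC H (H.card+l) L Y {r} hk (by omega) hL)
    rw [Finset.sum_congr rfl (fun n hn => hlam n (Finset.mem_filter.mp hn).1), ← Finset.mul_sum]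
    gcongr
    simp only [Finset.mem_singleton, forall_eq, Finset.card_singleton, pow_one] at h2
    rw [abs_le] at h2
    linarith [h2.2]

lemma sum_biU_le (I : Finset ℕ) (t : ℕ → Finset ℕ) (f : ℕ → ℝ) (hf : ∀ n, 0 ≤ f n) : 
    ∑ n ∈ I.biUnion t, f n ≤ ∑ r ∈ I, ∑ n ∈ t r, f n := by
  induction I using Finset.induction_on with
  | empty => simp
  | insert a I ha ih =>
    rw [Finset.biUnion_insert, Finset.sum_insert ha]
    have h := Finset.sum_union_inter (s₁ := t a) (s₂ := I.biUnion t) (f := f)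
    have h2 : 0 ≤ ∑ n ∈ t a ∩ I.biUnion t, f n := Finset.sum_nonneg fun n _ => hf n
    linarith

lemma partial_le (H : Finset ℕ) (N : ℕ) (x : ℝ) (f : ℕ → ℝ) (hf : ∀ n, 0 ≤ f n) :
    ∑ n ∈ (Finset.Ioc N (2*N)).filter (fun n => ¬ Nat.Coprime (tuplePoly H n) (primorialReal x)), f n ≤
    ∑ r ∈ Nat.primesBelow (⌊x⌋₊ + 1), ∑ n ∈ (Finset.Ioc N (2*N)).filter (fun n => r ∣ tuplePoly H n), f n := by
  classical
  have hsub : (Finset.Ioc N (2*N)).filter (fun n => ¬ Nat.Coprime (tuplePoly H n) (primorialReal x)) ⊆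
      (Nat.primesBelow (⌊x⌋₊ + 1)).biUnion (fun r => (Finset.Ioc N (2*N)).filter (fun n => r ∣ tuplePoly H n)) := by
    intro n hn
    rw [Finset.mem_filter] at hn
    obtain ⟨p, hp, h1, h2⟩ := Nat.Prime.not_coprime_iff_dvd.mp hn.2
    unfold primorialReal at h2
    rw [Prime.dvd_finsetProd_iff hp.prime] at h2
    obtain ⟨q, hq, hpq⟩ := h2
    rw [Finset.mem_filter, Finset.mem_range] at hq
    have : p = q := (Nat.prime_dvd_prime_iff_eq hp hq.2).mp hpq
    subst this
    rw [Finset.mem_biUnion]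
    exact ⟨p, Nat.mem_primesBelow.mpr hq, Finset.mem_filter.mpr ⟨hn.1, h1⟩⟩
  refine (Finset.sum_le_sum_of_subset_of_nonneg hsub (fun n _ _ => hf n)).trans ?_
  exact sum_biU_le _ _ _ hf
end GPY
end

section
namespace GPY

lemma I0_ratio (k l : ℕ) (hl : 10 ≤ l) (hk : 50 * l ≤ k) : I0 k (l-1) ≤ 3/10 * (k:ℝ)^2 * I0 k l := by
  obtain ⟨j, rfl⟩ : ∃ j, l = j + 1 := ⟨l - 1, by omega⟩
  rw [Nat.add_sub_cancel]
  unfold I0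
  have e1 : (2*(j+1)).factorial = (2*j+2) * ((2*j+1) * (2*j).factorial) := by
    rw [show 2*(j+1) = (2*j+1)+1 by ring, Nat.factorial_succ, Nat.factorial_succ]
  have e2 : (k+2*(j+1)).factorial = (k+2*j+2) * ((k+2*j+1) * (k+2*j).factorial) := by
    rw [show k+2*(j+1) = (k+2*j+1)+1 by ring, Nat.factorial_succ, Nat.factorial_succ]
  have e3 : (j+1).factorial = (j+1) * j.factorial := Nat.factorial_succ j
  rw [e1, e2, e3]
  push_cast
  have f1 : (0:ℝ) < (2*j).factorial := by exact_mod_cast Nat.factorial_pos _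
  have f2 : (0:ℝ) < (k+2*j).factorial := by exact_mod_cast Nat.factorial_pos _
  have f3 : (0:ℝ) < j.factorial := by exact_mod_cast Nat.factorial_pos _
  have hj : (9:ℝ) ≤ j := by exact_mod_cast (show 9 ≤ j by omega)
  have hk' : 50 * ((j:ℝ)+1) ≤ k := by exact_mod_cast hk
  set a : ℝ := (j:ℝ)
  set b : ℝ := (k:ℝ)
  have key : (a+1) * (b+2*a+2) * (b+2*a+1) ≤ 3/10*b^2*(2*(2*a+1)) := by
    have h1 : b + 2*a+2 ≤ 1.04 * b := by linarith
    have h2 : b + 2*a+1 ≤ 1.04 * b := by linarith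
    calc (a+1) * (b+2*a+2) * (b+2*a+1) ≤ (a+1) * (1.04*b) * (1.04*b) := by
          gcongr
      _ ≤ _ := by nlinarith [sq_nonneg b, mul_nonneg (sq_nonneg b) (show 0 ≤ a - 9 by linarith)]
  rw [← sub_nonneg]
  have : 3/10*b^2*((2*a+2)*((2*a+1)*((2*j).factorial:ℝ)) / (((a+1)*(j.factorial:ℝ))^2*((b+2*a+2)*((b+2*a+1)*((k+2*j).factorial:ℝ))))) - ((2*j).factorial:ℝ)/((j.factorial:ℝ)^2 * ((k+2*j).factorial:ℝ))
      = ((2*j).factorial:ℝ)/((j.factorial:ℝ)^2 * ((k+2*j).factorial:ℝ)) * ((3/10*b^2*(2*(2*a+1)) - (a+1) * (b+2*a+2) * (b+2*a+1)) / ((a+1) * (b+2*a+2) * (b+2*a+1))) := by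
    have : a + 1 ≠ 0 := by linarith
    have : b+2*a+2 ≠ 0 := by linarith
    have : b+2*a+1 ≠ 0 := by linarith
    field_simp
  rw [this]
  have h3 : 0 < (a+1) * (b+2*a+2) * (b+2*a+1) := by
    have : 0 < b := by linarith
    positivity
  exact mul_nonneg (by positivity) (div_nonneg (by linarith) h3.le)

set_option maxHeartbeats 1000000 in
lemma core (k l : ℕ) (hl : 10 ≤ l) (hkl : 50 * l ≤ k) (δ Ch : ℝ) (hδ : 0 < δ) (hCh : 0 < Ch) : ∃ Λ0 : ℝ, 1 ≤ Λ0 ∧ ∀ (N : ℕ) (L : ℝ),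
    Λ0 ≤ Real.log N → Real.log N / 5 ≤ L → Real.exp ((2+δ)*L) * (Real.log N)^(4*k) ≤ N →
    ∀ H : Finset ℕ, H.card = k → Admissible H → (∀ a ∈ H, (a:ℝ) ≤ Ch * L) →
      ∑ n ∈ (Finset.Ioc N (2*N)).filter
          (fun n => ¬ Nat.Coprime (tuplePoly H n) (primorialReal (Real.exp (δ * L)))),
          (LambdaR (Real.exp L) n H l) ^ 2
        ≤ (k : ℝ)^3 * δ^2 / 4 * ∑ n ∈ Finset.Ioc N (2*N), (LambdaR (Real.exp L) n H l) ^ 2 := by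
  have hk : 1 ≤ k := by omega
  have hk1 : (1:ℝ) ≤ k := by exact_mod_cast hk
  set I := I0 k l with hI
  have hI0 : 0 < I := I0_pos k l
  have hratio := I0_ratio k l hl hkl
  rw [← hI] at hratio
  obtain ⟨C, hC1, hC⟩ := err_bound
  obtain ⟨c, hc, hSY⟩ := SY_lower k
  obtain ⟨L2, hL2, hmain⟩ := main_terms k l hk (by omega) Ch (1/100 * I) hCh (by positivity)
  obtain ⟨L3, hL3, hhsum⟩ := hh_log_sum k hk Ch δ (1/100 * k * δ^2) hCh hδ (by positivity)
  set B : ℝ := (k + (k:ℝ)^3*δ^2/4) * (Real.exp 2 * C^(2*k)) / (1/100 * (k:ℝ)^3 * δ^2 * I * c) with hB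
  refine ⟨max (max 1 (5 * L2)) (max (5 * L3) B), (le_max_left _ _).trans (le_max_left _ _), ?_⟩
  intro N L hN hLN hX H hHk hA hw
  have hlog1 : 1 ≤ Real.log N := ((le_max_left _ _).trans (le_max_left _ _)).trans hN
  have h52 : 5 * L2 ≤ Real.log N := ((le_max_right _ _).trans (le_max_left _ _)).trans hN
  have h53 : 5 * L3 ≤ Real.log N := ((le_max_left _ _).trans (le_max_right _ _)).trans hN
  have hBN : B ≤ Real.log N := ((le_max_right _ _).trans (le_max_right _ _)).trans hN
  have hL1 : 1 ≤ L := by linarith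
  have hL0 : 0 < L := by linarith
  have hN0 : (0:ℝ) < N := lt_of_lt_of_le (by positivity) hX
  obtain ⟨Y0, hY0⟩ := hmain L (by linarith)
  obtain ⟨Y1, hY1⟩ := exists_nat_gt (Real.exp L)
  set Y := max Y0 (max Y1 (⌊Real.exp (δ*L)⌋₊ + 1)) with hY
  have hYR : Real.exp L < Y := hY1.trans_le (by exact_mod_cast (le_max_left _ _).trans (le_max_right _ _))
  obtain ⟨m1, m2⟩ := hY0 Y (le_max_left _ _) H hHk hA hw
  have hs := hhsum L (by linarith) H hHk hA hw
  obtain ⟨t1, t2⟩ := total_lower H l (by omega) C hC L hL1 Y hYR N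
  rw [hHk] at t1 t2
  set G := SY H Y * (L^k)⁻¹ with hG
  have hSpos := SY_pos hA Y
  have hG0 : 0 < G := by positivity
  set X := (Real.exp (L+1) * (C*L)^k)^2 with hXdef
  have hX0 : 0 ≤ X := by positivity
  have hsubP : Nat.primesBelow (⌊Real.exp (δ*L)⌋₊ + 1) ⊆ Nat.primesBelow Y := by
    intro q hq
    rw [Nat.mem_primesBelow] at hq ⊢
    exact ⟨hq.1.trans_le ((le_max_right _ _).trans (le_max_right _ _)), hq.2⟩
  have hcardP : ((Nat.primesBelow (⌊Real.exp (δ*L)⌋₊ + 1)).card : ℝ) ≤ Real.exp (δ*L) := by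
    refine le_trans ?_ (Nat.floor_le (Real.exp_pos (δ*L)).le)
    have : (Nat.primesBelow (⌊Real.exp (δ*L)⌋₊ + 1)) ⊆ Finset.Icc 1 ⌊Real.exp (δ*L)⌋₊ := by
      intro q hq
      rw [Nat.mem_primesBelow] at hq
      rw [Finset.mem_Icc]
      exact ⟨hq.2.one_le, by omega⟩
    have := Finset.card_le_card this
    rw [Nat.card_Icc, Nat.add_sub_cancel] at this
    exact_mod_cast this
  set P := Nat.primesBelow (⌊Real.exp (δ*L)⌋₊ + 1) with hP
  set W := L^(2*(k+l)) with hW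
  have hW0 : 0 < W := by positivity
  -- upper bound for the partial sum
  have hpart : ∑ n ∈ (Finset.Ioc N (2*N)).filter
          (fun n => ¬ Nat.Coprime (tuplePoly H n) (primorialReal (Real.exp (δ * L)))),
          (LambdaR (Real.exp L) n H l) ^ 2 ≤ W * (N * G * (1/100*k*δ^2 + 3/4*k*δ^2) * (3/10*(k:ℝ)^2*I + 1/100*I) + k * Real.exp (δ*L) * X) := by
    refine (partial_le H N (Real.exp (δ*L)) (fun n => (LambdaR (Real.exp L) n H l) ^ 2) (fun n => sq_nonneg _)).trans ?_
    calc _ ≤ ∑ r ∈ P, W * (N * (hh H r * G * ((Real.log r / L)^2 * (I0 k (l-1) + 1/100*I))) + k * X) := by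
          refine Finset.sum_le_sum fun r hr => (t2 r (hsubP hr)).trans ?_
          have := m2 r (hsubP hr)
          gcongr
      _ = W * (N * G * ((∑ r ∈ P, hh H r * Real.log r^2) / L^2) * (I0 k (l-1) + 1/100*I) + k * P.card * X) := by
          rw [← Finset.mul_sum, Finset.sum_add_distrib, Finset.sum_const, nsmul_eq_mul, Finset.sum_div, Finset.mul_sum, Finset.sum_mul]
          congr 2
          · apply Finset.sum_congr rfl; intro r _
            rw [div_pow]; ring
          · ring
      _ ≤ _ := by
          have h0 : (∑ r ∈ P, hh H r * Real.log r^2) / L^2 ≤ 1/100*k*δ^2 + 3/4*k*δ^2 := by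
            rw [div_le_iff₀ (by positivity)]; linarith
          have h1 : 0 ≤ I0 k (l-1) + 1/100*I := by have := I0_pos k (l-1); positivity
          gcongr
  -- the error term is negligible
  have hLle : L ≤ Real.log N := by
    rw [Real.le_log_iff_exp_le hN0]
    calc Real.exp L ≤ Real.exp ((2+δ)*L) * 1 := by rw [mul_one]; apply Real.exp_le_exp.mpr; nlinarith
      _ ≤ Real.exp ((2+δ)*L) * (Real.log N)^(4*k) := by gcongr; exact one_le_pow₀ hlog1
      _ ≤ N := hX
  have herr : (k + (k:ℝ)^3*δ^2/4) * (Real.exp (δ*L) * X) ≤ 1/100*(k:ℝ)^3*δ^2*I*(N*G) := by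
    have e1 : Real.exp (δ*L) * X = (Real.exp 2 * C^(2*k)) * (Real.exp ((2+δ)*L) * L^(2*k)) := by
      rw [hXdef, mul_pow, ← Real.exp_nat_mul, mul_pow, mul_pow, ← pow_mul, ← pow_mul, mul_comm k 2]
      have : Real.exp (δ*L) * Real.exp (((2:ℕ):ℝ) * (L+1)) = Real.exp 2 * Real.exp ((2+δ)*L) := by
        rw [← Real.exp_add, ← Real.exp_add]; congr 1; push_cast; ring
      calc _ = (Real.exp (δ*L) * Real.exp (((2:ℕ):ℝ) * (L+1))) * (C^(2*k) * L^(2*k)) := by ring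
        _ = _ := by rw [this]; ring
    have e2 : Real.exp ((2+δ)*L) * L^(2*k) * L^k * Real.log N ≤ N := by
      refine le_trans ?_ hX
      calc _ ≤ Real.exp ((2+δ)*L) * (Real.log N)^(2*k) * (Real.log N)^k * (Real.log N)^k := by
            gcongr
            exact le_self_pow₀ hlog1 (by omega)
        _ = _ := by rw [mul_assoc, mul_assoc, ← pow_add, ← pow_add]; congr 2; ring
    have e3 : (k + (k:ℝ)^3*δ^2/4) * (Real.exp 2 * C^(2*k)) ≤ Real.log N * (1/100 * (k:ℝ)^3 * δ^2 * I * c) := by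
      rw [← div_le_iff₀ (by positivity)]; exact hBN
    have e4 : c * (L^k)⁻¹ ≤ G := by rw [hG]; gcongr; exact hSY H hHk hA Y
    set E := Real.exp ((2+δ)*L) with hE
    have hE0 : 0 < E := Real.exp_pos _
    have hLk : 0 < L^k := by positivity
    calc _ = ((k + (k:ℝ)^3*δ^2/4) * (Real.exp 2 * C^(2*k))) * (E * L^(2*k)) := by rw [e1]; ring
      _ ≤ (Real.log N * (1/100 * (k:ℝ)^3 * δ^2 * I * c)) * (E * L^(2*k)) := by gcongr
      _ = (1/100 * (k:ℝ)^3 * δ^2 * I) * ((E * L^(2*k) * L^k * Real.log N) * (c * (L^k)⁻¹)) := by field_simp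
      _ ≤ (1/100 * (k:ℝ)^3 * δ^2 * I) * (N * G) := by gcongr
  have htot : W * (N * (G * (I - 1/100*I)) - X) ≤ ∑ n ∈ Finset.Ioc N (2*N), (LambdaR (Real.exp L) n H l) ^ 2 := by
    refine le_trans ?_ t1
    gcongr
  refine hpart.trans ?_
  refine le_trans ?_ (mul_le_mul_of_nonneg_left htot (by positivity))
  have hexp1 : 1 ≤ Real.exp (δ*L) := Real.one_le_exp (by positivity)
  have hXX : X ≤ Real.exp (δ*L) * X := le_mul_of_one_le_left hX0 hexp1
  rw [show (k:ℝ)^3*δ^2/4 * (W * (N * (G * (I - 1/100*I)) - X)) = W * ((k:ℝ)^3*δ^2/4 * (N * (G * (I - 1/100*I)) - X)) by ring]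
  refine mul_le_mul_of_nonneg_left ?_ hW0.le
  have hk2 : 1 ≤ (k:ℝ)^2 := one_le_pow₀ hk1
  have u1 : (N:ℝ) * G * (1/100*k*δ^2 + 3/4*k*δ^2) * (3/10*(k:ℝ)^2*I + 1/100*I) ≤ (N:ℝ) * G * (1/100*k*δ^2 + 3/4*k*δ^2) * (3/10*(k:ℝ)^2*I + 1/100*((k:ℝ)^2*I)) := by
    gcongr
    exact le_mul_of_one_le_left hI0.le hk2
  have u2 : (k:ℝ)^3*δ^2/4 * X ≤ (k:ℝ)^3*δ^2/4 * (Real.exp (δ*L) * X) := by gcongr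
  have u3 : 0 ≤ (k:ℝ)^3*δ^2*I*(N*G) := by positivity
  linarith [u1, u2, u3, herr]
end GPY
end

/-- **Sharpened Pintz Lemma 4 (GPY IV, (2.8)).** For `k` sufficiently large, `ℓ ≍ √k`,
`δ > 0` small compared to `k^{-3/2}`, `N` sufficiently large, `N^{1/5} ≤ R ≤
N^{1/(2+δ)}(log N)^{-c₂}`, and an admissible `k`-tuple `H ⊆ [1,h]` with `h ≪ log R`:
`∑_{N<n≤2N, (P_H(n),𝒫(R^δ))>1} Λ_R(n;H,ℓ)² ≤ (k³δ²/4) ∑_{N<n≤2N} Λ_R(n;H,ℓ)²`. -/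
theorem pintz_lemma4_sharp :
    ∀ A₁ A₂ Ch : ℝ, 0 < A₁ → 0 < A₂ → 0 < Ch →
    ∃ c₀ : ℝ, 0 < c₀ ∧ ∃ k₀ : ℕ, ∀ k ℓ : ℕ, k₀ ≤ k →
      A₁ * Real.sqrt k ≤ (ℓ : ℝ) → (ℓ : ℝ) ≤ A₂ * Real.sqrt k →
    ∀ δ : ℝ, 0 < δ → δ ≤ c₀ * (k : ℝ) ^ (-(3:ℝ)/2) →
    ∃ c₂ : ℝ, ∃ N₀ : ℕ, ∀ N : ℕ, N₀ ≤ N → ∀ R : ℝ,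
      (N : ℝ) ^ ((1:ℝ)/5) ≤ R → R ≤ (N : ℝ) ^ (1/(2+δ)) * (Real.log N) ^ (-c₂) →
    ∀ h : ℝ, 0 < h → h ≤ Ch * Real.log R →
    ∀ H : Finset ℕ, H ⊆ Finset.Icc 1 ⌊h⌋₊ → H.card = k → Admissible H →
      ∑ n ∈ (Finset.Ioc N (2*N)).filter
          (fun n => ¬ Nat.Coprime (tuplePoly H n) (primorialReal (R ^ δ))),
          (LambdaR R n H ℓ) ^ 2
        ≤ (k : ℝ)^3 * δ^2 / 4 * ∑ n ∈ Finset.Ioc N (2*N), (LambdaR R n H ℓ) ^ 2 := by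
  intro A₁ A₂ Ch hA1 hA2 hCh
  refine ⟨1, one_pos, ⌈(max (10/A₁) (50*A₂))^2⌉₊, ?_⟩
  intro k ℓ hk hl1 hl2 δ hδ _
  have hkx : (max (10/A₁) (50*A₂))^2 ≤ (k:ℝ) := (Nat.le_ceil _).trans (by exact_mod_cast hk)
  have hsq : max (10/A₁) (50*A₂) ≤ Real.sqrt k := Real.le_sqrt_of_sq_le hkx
  have h1 : 10/A₁ ≤ Real.sqrt k := (le_max_left _ _).trans hsq
  have h2 : 50*A₂ ≤ Real.sqrt k := (le_max_right _ _).trans hsq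
  rw [div_le_iff₀ hA1] at h1
  have hl10 : 10 ≤ ℓ := by
    have : (10:ℝ) ≤ ℓ := by linarith
    exact_mod_cast this
  have hlk : 50 * ℓ ≤ k := by
    have h3 : Real.sqrt k * Real.sqrt k = k := Real.mul_self_sqrt (by positivity)
    have h4 := mul_le_mul_of_nonneg_right h2 (Real.sqrt_nonneg (k:ℝ))
    have : (50:ℝ) * ℓ ≤ k := by nlinarith
    exact_mod_cast this
  obtain ⟨Λ0, hΛ, hcore⟩ := GPY.core k ℓ hl10 hlk δ Ch hδ hCh
  refine ⟨4*k/(2+δ), ⌈Real.exp Λ0⌉₊, ?_⟩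
  intro N hN R hR1 hR2 h _ hh2 H hH hHk hA
  have hNe : Real.exp Λ0 ≤ (N:ℝ) := (Nat.le_ceil _).trans (by exact_mod_cast hN)
  have hN0 : (0:ℝ) < N := (Real.exp_pos _).trans_le hNe
  have hlogN : Λ0 ≤ Real.log N := (Real.le_log_iff_exp_le hN0).mpr hNe
  have hlog0 : 0 < Real.log N := by linarith
  have hR0 : 0 < R := lt_of_lt_of_le (Real.rpow_pos_of_pos hN0 _) hR1
  have hRexp : Real.exp (Real.log R) = R := Real.exp_log hR0
  have hL1 : Real.log N / 5 ≤ Real.log R := by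
    have := Real.log_le_log (Real.rpow_pos_of_pos hN0 _) hR1
    rw [Real.log_rpow hN0] at this
    linarith
  have h2δ : (0:ℝ) < 2 + δ := by linarith
  have hX : Real.exp ((2+δ) * Real.log R) * (Real.log N)^(4*k) ≤ N := by
    have e : Real.exp ((2+δ) * Real.log R) = R^(2+δ) := by
      rw [Real.rpow_def_of_pos hR0, mul_comm]
    have e2 : R^(2+δ) ≤ N * ((Real.log N)^(4*k))⁻¹ := by
      calc R^(2+δ) ≤ ((N : ℝ) ^ (1/(2+δ)) * (Real.log N) ^ (-(4*k/(2+δ))))^(2+δ) := Real.rpow_le_rpow hR0.le hR2 h2δ.le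
        _ = N * ((Real.log N)^(4*k))⁻¹ := by
          rw [Real.mul_rpow (by positivity) (by positivity), ← Real.rpow_mul hN0.le, ← Real.rpow_mul hlog0.le]
          have a1 : 1/(2+δ)*(2+δ) = 1 := by field_simp
          have a2 : -(4*(k:ℝ)/(2+δ))*(2+δ) = -((4*k:ℕ):ℝ) := by push_cast; field_simp
          rw [a1, a2, Real.rpow_one, Real.rpow_neg hlog0.le, Real.rpow_natCast]
    rw [e]
    calc _ ≤ (N * ((Real.log N)^(4*k))⁻¹) * (Real.log N)^(4*k) := by gcongr
      _ = N := by field_simp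
  have hw : ∀ a ∈ H, (a:ℝ) ≤ Ch * Real.log R := by
    intro a ha
    have h3 := Finset.mem_Icc.mp (hH ha)
    have h4 : (a:ℝ) ≤ h := (Nat.le_floor_iff' (by omega)).mp h3.2
    linarith
  have := hcore N (Real.log R) hlogN hL1 hX H hHk hA hw
  rw [hRexp] at this
  have e : Real.exp (δ * Real.log R) = R^δ := by rw [Real.rpow_def_of_pos hR0, mul_comm]
  rw [e] at this
  exact this
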